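/- Let f(z,w) = (p(z), q(z,w)) be a regular polynomial skew product of ℂ² of degree d ≥ 2. Then f is special if and only if there exists a number field K (a subfield of ℂ that is finite-dimensional over ℚ) such that for every periodic point (z₀,w₀) of f of period n, both multipliers (pⁿ)'(z₀) and ∂_w Q_{z₀}ⁿ(w₀) lie in K. -/

import Mathlib

open Polynomial

noncomputable section

def ChebT (d : ℕ) : Polynomial ℂ := dickson 1 1 d

def AffConj (f g : Polynomial ℂ) : Prop :=
  ∃ u v : ℂ, u ≠ 0 ∧ f = (C u⁻¹ * (X - C v)).comp (g.comp (C u * X + C v))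

def SpecialPoly (d : ℕ) (f : Polynomial ℂ) : Prop :=
  AffConj f (X ^ d) ∨ AffConj f (ChebT d) ∨ AffConj f (-ChebT d)

def fiber (q : Polynomial (Polynomial ℂ)) (z : ℂ) : Polynomial ℂ :=
  q.map (evalRingHom z)

def IsRegularSkew (d : ℕ) (p : Polynomial ℂ) (q : Polynomial (Polynomial ℂ)) : Prop :=
  p.natDegree = d ∧ (∀ k, q.coeff k ≠ 0 → (q.coeff k).natDegree + k ≤ d) ∧ q.coeff d ≠ 0

def polyIter (p : Polynomial ℂ) : ℕ → Polynomial ℂ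
  | 0 => X
  | n + 1 => (polyIter p n).comp p

def QIter (p : Polynomial ℂ) (q : Polynomial (Polynomial ℂ)) : ℕ → ℂ → Polynomial ℂ
  | 0, _ => X
  | n + 1, z => (QIter p q n (p.eval z)).comp (fiber q z)

def skewMap (p : Polynomial ℂ) (q : Polynomial (Polynomial ℂ)) : ℂ × ℂ → ℂ × ℂ :=
  fun zw => (p.eval zw.1, (fiber q zw.1).eval zw.2)

def TriangConj (f g : ℂ × ℂ → ℂ × ℂ) : Prop :=
  ∃ α β γ δ ε : ℂ, α ≠ 0 ∧ γ ≠ 0 ∧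
    ∀ zw : ℂ × ℂ,
      (α * (g zw).1 + β, ε * (g zw).1 + γ * (g zw).2 + δ)
        = f (α * zw.1 + β, ε * zw.1 + γ * zw.2 + δ)

def SpecialSkew (d : ℕ) (f : ℂ × ℂ → ℂ × ℂ) : Prop :=
  (∃ P Q : Polynomial ℂ,
      (P = X ^ d ∨ P = ChebT d ∨ P = -ChebT d) ∧
      (Q = X ^ d ∨ Q = ChebT d ∨ Q = -ChebT d) ∧
      TriangConj f fun zw => (P.eval zw.1, Q.eval zw.2))
  ∨ (∃ ζ : ℂ, ∃ m : ℕ, ζ ^ (d - 1) = 1 ∧ (m = 1 ∨ m = 2) ∧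
      TriangConj f fun zw => (zw.1 ^ d, (dickson 1 (ζ * zw.1 ^ m) d).eval zw.2))

theorem polyIter_eval (p : ℂ[X]) (n : ℕ) (x : ℂ) :
    (polyIter p n).eval x = (fun y => p.eval y)^[n] x := by
  induction n generalizing x with
  | zero => simp [polyIter]
  | succ n ih => simp [polyIter, eval_comp, ih]

theorem polyIter_one (p : ℂ[X]) : polyIter p 1 = p := by simp [polyIter]

theorem polyIter_add (p : ℂ[X]) (m n : ℕ) :
    polyIter p (m + n) = (polyIter p m).comp (polyIter p n) := by
  induction n with
  | zero => simp [polyIter]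
  | succ n ih => rw [← add_assoc, polyIter, ih, polyIter, comp_assoc]

theorem polyIter_succ' (p : ℂ[X]) (n : ℕ) : polyIter p (n + 1) = p.comp (polyIter p n) := by
  rw [add_comm, polyIter_add, polyIter_one]

theorem polyIter_mul (p : ℂ[X]) (m n : ℕ) : polyIter (polyIter p m) n = polyIter p (m * n) := by
  induction n with
  | zero => simp [polyIter]
  | succ n ih => rw [polyIter, ih, mul_add, mul_one, polyIter_add]

theorem natDegree_polyIter (p : ℂ[X]) (n : ℕ) : (polyIter p n).natDegree = p.natDegree ^ n := by
  induction n with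
  | zero => simp [polyIter]
  | succ n ih => rw [polyIter, natDegree_comp, ih, pow_succ]

theorem monic_polyIter {p : ℂ[X]} (hp : p.Monic) (h : p.natDegree ≠ 0) (n : ℕ) :
    (polyIter p n).Monic := by
  induction n with
  | zero => exact monic_X
  | succ n ih => exact ih.comp hp h

theorem derivative_polyIter_eval (p : ℂ[X]) (n : ℕ) (x : ℂ) :
    (derivative (polyIter p n)).eval x =
      ∏ i ∈ Finset.range n, (derivative p).eval ((polyIter p i).eval x) := by
  induction n with
  | zero => simp [polyIter]
  | succ n ih =>
    rw [polyIter_succ', derivative_comp, eval_mul, eval_comp, ih, Finset.prod_range_succ]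

/-- All multipliers of periodic points of `p` lie in `K`. -/
def MultipliersIn (K : Subfield ℂ) (p : ℂ[X]) : Prop :=
  ∀ n : ℕ, 0 < n → ∀ x : ℂ, (polyIter p n).eval x = x → (derivative (polyIter p n)).eval x ∈ K

theorem MultipliersIn.polyIter {K : Subfield ℂ} {p : ℂ[X]} (h : MultipliersIn K p) {m : ℕ}
    (hm : 0 < m) : MultipliersIn K (polyIter p m) := by
  intro n hn x hx
  rw [polyIter_mul] at hx ⊢
  exact h _ (Nat.mul_pos hm hn) x hx

/-- Outside a large disc a polynomial of degree at least two increases the modulus. -/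
theorem exists_escape_radius (p : ℂ[X]) (hd : 2 ≤ p.natDegree) :
    ∃ B : ℝ, 1 ≤ B ∧ ∀ z : ℂ, B < ‖z‖ → ‖z‖ < ‖p.eval z‖ := by
  have hdiv : 0 < p.divX.degree := by
    rw [← natDegree_pos_iff_degree_pos, natDegree_divX_eq_natDegree_tsub_one]
    omega
  have ht : Filter.Tendsto (fun z : ℂ => ‖p.divX.eval z‖) (Filter.comap norm Filter.atTop)
      Filter.atTop := p.divX.tendsto_norm_atTop hdiv Filter.tendsto_comap
  have h2 := ht.eventually (Filter.eventually_ge_atTop 2)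
  rw [Filter.eventually_comap] at h2
  obtain ⟨B, hB⟩ := Filter.eventually_atTop.1 h2
  refine ⟨max 1 (max B ‖p.coeff 0‖), le_max_left _ _, fun z hz => ?_⟩
  have h1 : 2 ≤ ‖p.divX.eval z‖ :=
    hB ‖z‖ (((le_max_left _ _).trans (le_max_right _ _)).trans hz.le) z rfl
  have h3 : ‖p.coeff 0‖ < ‖z‖ := ((le_max_right _ _).trans (le_max_right _ _)).trans_lt hz
  have h4 : p.eval z = p.divX.eval z * z + p.coeff 0 := by
    conv_lhs => rw [← p.divX_mul_X_add]
    simp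
  have h5 : ‖p.divX.eval z * z‖ ≤ ‖p.eval z‖ + ‖p.coeff 0‖ := by
    have : p.divX.eval z * z = p.eval z - p.coeff 0 := by rw [h4]; ring
    rw [this]; exact norm_sub_le _ _
  rw [norm_mul] at h5
  nlinarith [norm_nonneg z]

theorem norm_le_of_cycle {p : ℂ[X]} {B : ℝ} (hB : ∀ z : ℂ, B < ‖z‖ → ‖z‖ < ‖p.eval z‖)
    {y : ℕ → ℂ} {n : ℕ} (hn : 0 < n) (hy : ∀ i, y (i + 1) = p.eval (y i)) (hyn : y n = y 0) :
    ‖y 0‖ ≤ B := by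
  by_contra! hlt
  have key : ∀ i, ‖y 0‖ ≤ ‖y i‖ ∧ ‖y i‖ < ‖y (i + 1)‖ := by
    intro i
    induction i with
    | zero => exact ⟨le_rfl, by rw [hy]; exact hB _ hlt⟩
    | succ i ih =>
      have h1 := ih.1.trans ih.2.le
      exact ⟨h1, by rw [hy (i + 1)]; exact hB _ (hlt.trans_le h1)⟩
  obtain ⟨m, rfl⟩ : ∃ m, n = m + 1 := ⟨n - 1, by omega⟩
  have := key m
  rw [hyn] at this
  linarith

theorem exists_bound_periodic (p : ℂ[X]) (hd : 2 ≤ p.natDegree) :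
    ∃ C : ℝ, 1 ≤ C ∧ ∀ (y : ℕ → ℂ) (n : ℕ), 0 < n → (∀ i, y (i + 1) = p.eval (y i)) →
      y n = y 0 → ‖(derivative p).eval (y 0)‖ ≤ C := by
  obtain ⟨B, hB1, hB⟩ := exists_escape_radius p hd
  obtain ⟨C, hC⟩ := (isCompact_closedBall (0 : ℂ) B).exists_bound_of_continuousOn
    (f := fun z => (derivative p).eval z) (derivative p).continuous.continuousOn
  refine ⟨max 1 C, le_max_left _ _, fun y n hn hy hyn => ?_⟩
  refine (hC _ ?_).trans (le_max_right _ _)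
  simpa using norm_le_of_cycle hB hn hy hyn

theorem isCycle_shift {α : Type*} {g : α → α} {y : ℕ → α} {n : ℕ}
    (hy : ∀ i, y (i + 1) = g (y i)) (hyn : y n = y 0) (i : ℕ) : y (i + n) = y i := by
  induction i with
  | zero => simpa using hyn
  | succ i ih => rw [add_right_comm, hy, ih, hy]

theorem exists_norm_prod_le (p : ℂ[X]) (hd : 2 ≤ p.natDegree) :
    ∃ C : ℝ, 1 ≤ C ∧ ∀ (y : ℕ → ℂ) (n : ℕ), 0 < n → (∀ i, y (i + 1) = p.eval (y i)) →
      y n = y 0 → ‖∏ i ∈ Finset.range n, (derivative p).eval (y i)‖ ≤ C ^ n := by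
  obtain ⟨C, hC1, hC⟩ := exists_bound_periodic p hd
  refine ⟨C, hC1, fun y n hn hy hyn => ?_⟩
  rw [norm_prod]
  refine (Finset.prod_le_prod (fun _ _ => norm_nonneg _) (g := fun _ => C) fun i _ => ?_).trans
    (by simp)
  refine hC (fun j => y (i + j)) n hn (fun j => hy (i + j)) ?_
  simpa using isCycle_shift (g := fun z => p.eval z) hy hyn i

section Integrality

variable {F : Type*} [Field F]

theorem exists_nat_mul_coeff_isIntegral [CharZero F] [Algebra.IsAlgebraic ℚ F] (p : F[X]) :
    ∃ N : ℕ, 0 < N ∧ ∀ i, IsIntegral ℤ ((N : F) * p.coeff i) := by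
  have halg : ∀ a : F, ∃ N : ℕ, 0 < N ∧ IsIntegral ℤ ((N : F) * a) := by
    intro a
    have ha : IsAlgebraic ℤ a :=
      (IsFractionRing.isAlgebraic_iff ℤ ℚ F).2 (Algebra.IsAlgebraic.isAlgebraic a)
    obtain ⟨y, hy0, hy⟩ := ha.exists_integral_multiple
    refine ⟨y.natAbs, Int.natAbs_pos.2 hy0, ?_⟩
    rcases Int.natAbs_eq y with h | h
    · have : ((y.natAbs : ℕ) : F) = (y : F) := by rw [h]; simp
      rw [this]; simpa [Algebra.smul_def] using hy
    · have : ((y.natAbs : ℕ) : F) = -(y : F) := by rw [h]; simp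
      rw [this]; simpa [Algebra.smul_def] using hy.neg
  choose N hN0 hN using halg
  refine ⟨∏ i ∈ p.support, N (p.coeff i), Finset.prod_pos fun i _ => hN0 _, fun i => ?_⟩
  by_cases hi : i ∈ p.support
  · rw [← Finset.mul_prod_erase _ _ hi]
    push_cast
    rw [mul_right_comm]
    refine (hN _).mul ?_
    exact IsIntegral.prod _ fun j _ => by
      simpa using isIntegral_algebraMap (R := ℤ) (x := (N (p.coeff j) : ℤ))
  · rw [notMem_support_iff.1 hi, mul_zero]; exact isIntegral_zero

theorem isIntegral_mul_of_cycle {p : F[X]} (hp : p.Monic) (hd : 2 ≤ p.natDegree) {N : ℕ}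
    (hcoeff_int : ∀ i, IsIntegral ℤ ((N : F) * p.coeff i)) {y : ℕ → F} {n : ℕ}
    (hn : 0 < n) (hy : ∀ i, y (i + 1) = p.eval (y i)) (hyn : y n = y 0) :
    IsIntegral ℤ ((N : F) * y 0) := by
  let S := integralClosure ℤ F
  have hcoef : ∀ i, (p.scaleRoots (N : F)).coeff i ∈ S := by
    intro i
    rw [coeff_scaleRoots]
    rcases lt_trichotomy i p.natDegree with h | h | h
    · obtain ⟨k, hk⟩ : ∃ k, p.natDegree - i = k + 1 := ⟨p.natDegree - i - 1, by omega⟩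
      rw [hk, pow_succ', ← mul_assoc, mul_comm (p.coeff i)]
      exact (hcoeff_int i).mul ((isIntegral_natCast N).pow k)
    · subst h; simp only [tsub_self, pow_zero, mul_one, hp.coeff_natDegree]; exact isIntegral_one
    · rw [coeff_eq_zero_of_natDegree_lt h, zero_mul]; exact isIntegral_zero
  obtain ⟨P, hPm, hPdeg, hPmon⟩ := lifts_and_natDegree_eq_and_monic (f := algebraMap S F)
    (p := p.scaleRoots (N : F))
    (by rw [lifts_iff_coeff_lifts]; exact fun i => ⟨⟨_, hcoef i⟩, rfl⟩)
    ((monic_scaleRoots_iff _).2 hp)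
  rw [natDegree_scaleRoots] at hPdeg
  have hPev : ∀ w : F, aeval ((N : F) * w) P = (N : F) ^ p.natDegree * p.eval w := by
    intro w
    rw [aeval_def, ← eval_map, hPm]
    have := scaleRoots_eval₂_mul (p := p) (RingHom.id F) w (N : F)
    simpa using this
  have main : ∀ m, ∃ R : S[X], R.Monic ∧ R.natDegree = p.natDegree ^ m ∧
      aeval ((N : F) * y 0) R = (N : F) ^ (p.natDegree ^ m) * y m := by
    intro m
    induction m with
    | zero => exact ⟨X, monic_X, by simp, by simp⟩
    | succ m ih =>
      obtain ⟨R, hR, hRd, hRe⟩ := ih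
      have hpos : 0 < p.natDegree ^ m := by positivity
      obtain ⟨e, he⟩ : ∃ e, p.natDegree ^ m = e + 1 := ⟨p.natDegree ^ m - 1, by omega⟩
      refine ⟨(P.scaleRoots ((N : S) ^ e)).comp R,
        Monic.comp ((monic_scaleRoots_iff _).2 hPmon) hR (by omega), ?_, ?_⟩
      · rw [natDegree_comp, natDegree_scaleRoots, hPdeg, hRd, pow_succ']
      · rw [aeval_comp, hRe, he, pow_succ, mul_assoc]
        have := scaleRoots_eval₂_mul (p := P) (algebraMap S F) ((N : F) * y m) ((N : S) ^ e)
        simp only [map_pow, map_natCast, ← aeval_def] at this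
        rw [this, hPev, hPdeg, ← hy, ← mul_assoc, ← pow_mul, ← pow_add]
        congr 2
        rw [pow_succ, he]; ring
  obtain ⟨R, hR, hRd, hRe⟩ := main n
  have h2 : 2 ≤ p.natDegree ^ n := hd.trans (Nat.le_self_pow hn.ne' _)
  obtain ⟨e, he⟩ : ∃ e, p.natDegree ^ n = e + 1 := ⟨p.natDegree ^ n - 1, by omega⟩
  have hy_int : IsIntegral S ((N : F) * y 0) := by
    refine ⟨R - C ((N : S) ^ e) * X, hR.sub_of_left ?_, ?_⟩
    · refine (degree_C_mul_X_le _).trans_lt ?_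
      rw [degree_eq_natDegree hR.ne_zero, hRd]; exact_mod_cast h2
    · rw [← aeval_def, map_sub, hRe, hyn, he]
      simp
      ring
  exact isIntegral_trans _ hy_int

theorem isIntegral_prod_derivative_of_cycle {p : F[X]} (hp : p.Monic) (hd : 2 ≤ p.natDegree)
    {N : ℕ} (hcoeff_int : ∀ i, IsIntegral ℤ ((N : F) * p.coeff i)) {y : ℕ → F} {n : ℕ}
    (hn : 0 < n) (hy : ∀ i, y (i + 1) = p.eval (y i)) (hyn : y n = y 0) :
    IsIntegral ℤ (((N ^ p.natDegree : ℕ) : F) ^ n *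
      ∏ i ∈ Finset.range n, (derivative p).eval (y i)) := by
  have hprod : ((N ^ p.natDegree : ℕ) : F) ^ n * ∏ i ∈ Finset.range n, (derivative p).eval (y i)
      = ∏ i ∈ Finset.range n, ((N : F) ^ p.natDegree * (derivative p).eval (y i)) := by
    rw [Finset.prod_mul_distrib]; simp
  rw [hprod]
  refine IsIntegral.prod _ fun i _ => ?_
  have hyi : IsIntegral ℤ ((N : F) * y i) := by
    have := isIntegral_mul_of_cycle hp hd hcoeff_int (y := fun j => y (i + j)) hn
      (fun j => hy (i + j)) (by simpa using isCycle_shift (g := fun z => p.eval z) hy hyn i)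
    simpa using this
  rw [derivative_eval, sum_def, Finset.mul_sum]
  refine IsIntegral.sum _ fun j hj => ?_
  have hj' : j ≤ p.natDegree := le_natDegree_of_mem_supp _ hj
  rcases Nat.eq_zero_or_pos j with rfl | hpos
  · simpa using isIntegral_zero
  have : (N : F) ^ p.natDegree * (p.coeff j * (j : F) * y i ^ (j - 1)) =
      ((N : F) * p.coeff j) * (j : F) * ((N : F) * y i) ^ (j - 1) * (N : F) ^ (p.natDegree - j) := by
    have h : p.natDegree = 1 + (j - 1) + (p.natDegree - j) := by omega
    conv_lhs => rw [h]
    rw [pow_add, pow_add]; ring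
  rw [this]
  exact ((((hcoeff_int j).mul (isIntegral_natCast j)).mul (hyi.pow _))).mul
    ((isIntegral_natCast N).pow _)

end Integrality

theorem exists_algebraic_quotient (K R A : Type) [Field K] [CommRing R] [CommRing A]
    [Nontrivial A] [Algebra K R] [Algebra R A] [Algebra.FiniteType K R] [Algebra.IsIntegral R A] :
    ∃ (F : Type) (_ : Field F) (_ : Algebra K F) (_ : Algebra.IsAlgebraic K F) (π : A →+* F),
      ∀ k : K, π (algebraMap R A (algebraMap K R k)) = algebraMap K F k := by
  obtain ⟨M, hM⟩ := Ideal.exists_maximal A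
  let m : Ideal R := M.comap (algebraMap R A)
  have hm : m.IsMaximal := Ideal.isMaximal_comap_of_isIntegral_of_isMaximal (R := R) M
  let _ : Field (R ⧸ m) := Ideal.Quotient.field m
  let _ : Field (A ⧸ M) := Ideal.Quotient.field M
  have hft' : Algebra.FiniteType K (R ⧸ m) :=
    Algebra.FiniteType.of_surjective (Ideal.Quotient.mkₐ K m) (Ideal.Quotient.mkₐ_surjective K m)
  have hfin : Module.Finite K (R ⧸ m) := finite_of_finite_type_of_isJacobsonRing K (R ⧸ m)
  have h1 : (algebraMap K (R ⧸ m)).IsIntegral := fun x => Algebra.IsIntegral.isIntegral x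
  let ψ : R ⧸ m →+* A ⧸ M := Ideal.quotientMap M (algebraMap R A) le_rfl
  have h2 : ψ.IsIntegral := by
    refine RingHom.IsIntegral.quotient (I := M) (f := algebraMap R A) ?_
    exact fun x => Algebra.IsIntegral.isIntegral x
  let _ : Algebra K (A ⧸ M) := (ψ.comp (algebraMap K (R ⧸ m))).toAlgebra
  have h3 : Algebra.IsIntegral K (A ⧸ M) := ⟨fun x => RingHom.IsIntegral.trans _ _ h1 h2 x⟩
  exact ⟨A ⧸ M, inferInstance, inferInstance, inferInstance, Ideal.Quotient.mk M, fun k => rfl⟩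

/-- A finitely generated extension of `K` inside `ℂ`, together with everything integral over it,
can be specialized to an algebraic extension of `K`. -/
theorem exists_specialization (K : Subfield ℂ) (S : Finset ℂ) :
    ∃ (A : Subring ℂ) (F : Type) (_ : Field F) (_ : Algebra K F) (_ : Algebra.IsAlgebraic K F)
      (π : A →+* F), (∀ k : K, ∃ h : (k : ℂ) ∈ A, π ⟨k, h⟩ = algebraMap K F k) ∧
      (∀ x ∈ S, x ∈ A) ∧ ∀ x : ℂ, IsIntegral A x → x ∈ A := by
  let R : Subalgebra K ℂ := Algebra.adjoin K (S : Set ℂ)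
  let A := integralClosure R ℂ
  have hft : Algebra.FiniteType K R := Algebra.FiniteType.adjoin_of_finite S.finite_toSet
  obtain ⟨F, iF, iA, hF, π, hπ⟩ := exists_algebraic_quotient K R A
  refine ⟨A.toSubring, F, iF, iA, hF, π,
    fun k => ⟨(algebraMap R A (algebraMap K R k)).2, hπ k⟩, fun x hx => ?_, fun x hx => ?_⟩
  · exact (algebraMap R A ⟨x, Algebra.subset_adjoin hx⟩).2
  · have hx' : IsIntegral A x := hx
    exact isIntegral_trans (R := R) x hx'

/-- Multipliers of cycles of a monic polynomial that lie in a number field have size and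
denominators growing at most exponentially with the period. -/
theorem exists_height_bound (K : Subfield ℂ) [FiniteDimensional ℚ K] (p : ℂ[X]) (hp : p.Monic)
    (hd : 2 ≤ p.natDegree) :
    ∃ (L : ℕ) (B : ℝ), 0 < L ∧ 1 ≤ B ∧ ∀ (n : ℕ) (x : ℂ) (μ : K), 0 < n →
      (polyIter p n).eval x = x → (μ : ℂ) = (derivative (polyIter p n)).eval x →
      IsIntegral ℤ ((L : K) ^ n * μ) ∧ ∀ σ : K →+* ℂ, ‖σ μ‖ ≤ B ^ n := by
  obtain ⟨A, F, _, _, halg, π, hK, hS, hA⟩ := exists_specialization K p.coeffs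
  have hcoef : (p.coeffs : Set ℂ) ⊆ A := fun x hx => hS x hx
  let pA : A[X] := p.toSubring A hcoef
  have hpA : pA.map A.subtype = p := map_toSubring p A hcoef
  have hpAm : pA.Monic := (monic_toSubring p A hcoef).2 hp
  let r : F[X] := pA.map π
  have hr : r.Monic := hpAm.map π
  have hrd : r.natDegree = p.natDegree := by
    rw [hpAm.natDegree_map, natDegree_toSubring]
  have : CharZero F := charZero_of_injective_algebraMap (algebraMap K F).injective
  have hQ : Algebra.IsAlgebraic ℚ F := Algebra.IsAlgebraic.trans ℚ K F
  obtain ⟨N, hN, hcoeff_int⟩ := exists_nat_mul_coeff_isIntegral r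
  -- bounds at the complex embeddings
  have hσ : ∀ σ : K →+* ℂ, ∃ τ : F →+* ℂ, τ.comp (algebraMap K F) = σ := by
    intro σ
    let _ : Algebra K ℂ := σ.toAlgebra
    exact ⟨(IsAlgClosed.lift : F →ₐ[K] ℂ).toRingHom, AlgHom.comp_algebraMap _⟩
  choose τ hτ using hσ
  have hBσ := fun σ : K →+* ℂ => exists_norm_prod_le (r.map (τ σ)) (by
    rw [hr.natDegree_map, hrd]; exact hd)
  choose B hB1 hB using hBσ
  have : NumberField K := ⟨⟩
  refine ⟨N ^ p.natDegree, 1 + ∑ σ, B σ, by positivity, ?_, ?_⟩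
  · linarith [Finset.sum_nonneg (s := Finset.univ) fun σ _ => zero_le_one.trans (hB1 σ)]
  intro n x μ hn hx hμ
  have hlift : ∀ m, ∃ R : A[X], R.Monic ∧ R.natDegree = p.natDegree ^ m ∧
      R.map A.subtype = polyIter p m := by
    intro m
    induction m with
    | zero => exact ⟨X, monic_X, by simp, by simp [polyIter]⟩
    | succ m ih =>
      obtain ⟨R, hR, hRd, hRm⟩ := ih
      have hne : pA.natDegree ≠ 0 := by rw [natDegree_toSubring]; omega
      refine ⟨R.comp pA, hR.comp hpAm hne, ?_, ?_⟩
      · rw [natDegree_comp, hRd, natDegree_toSubring, pow_succ]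
      · rw [Polynomial.map_comp, hRm, hpA, polyIter]
  have hxA : x ∈ A := by
    refine hA x ?_
    obtain ⟨R, hR, hRd, hRm⟩ := hlift n
    refine ⟨R - X, hR.sub_of_left ?_, ?_⟩
    · rw [degree_eq_natDegree hR.ne_zero, hRd, degree_X]
      exact_mod_cast hd.trans (Nat.le_self_pow hn.ne' _)
    · change eval₂ A.subtype x (R - X) = 0
      rw [← eval_map, Polynomial.map_sub, hRm, map_X, eval_sub, hx, eval_X, sub_self]
  let y : ℕ → A := fun i => (fun w => pA.eval w)^[i] ⟨x, hxA⟩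
  have hevalA : ∀ (P : A[X]) (w : A), ((P.eval w : A) : ℂ) = (P.map A.subtype).eval (w : ℂ) := by
    intro P w
    rw [eval_map]
    exact (eval₂_at_apply A.subtype w).symm
  have hyc : ∀ i, (y i : ℂ) = (polyIter p i).eval x := by
    intro i
    induction i with
    | zero => simp [y, polyIter]
    | succ i ih =>
      simp only [y, Function.iterate_succ_apply'] at ih ⊢
      rw [hevalA, hpA, ih, polyIter_succ', eval_comp]
  have hy : ∀ i, y (i + 1) = pA.eval (y i) := fun i => Function.iterate_succ_apply' _ _ _
  have hyn : y n = y 0 := by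
    apply Subtype.ext
    rw [hyc, hx]
    simp [y]
  obtain ⟨hμA, hμπ⟩ := hK μ
  have hprodA : (⟨(μ : ℂ), hμA⟩ : A) = ∏ i ∈ Finset.range n, (derivative pA).eval (y i) := by
    apply Subtype.ext
    change (μ : ℂ) = A.subtype _
    rw [map_prod, hμ, derivative_polyIter_eval]
    refine Finset.prod_congr rfl fun i _ => ?_
    change _ = (((derivative pA).eval (y i) : A) : ℂ)
    rw [hevalA, ← derivative_map, hpA, hyc]
  have hμF : algebraMap K F μ = ∏ i ∈ Finset.range n, (derivative r).eval (π (y i)) := by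
    rw [← hμπ, hprodA, map_prod]
    refine Finset.prod_congr rfl fun i _ => ?_
    rw [derivative_map, eval_map, eval₂_at_apply]
  have hyF : ∀ i, π (y (i + 1)) = r.eval (π (y i)) := by
    intro i
    rw [hy, eval_map, eval₂_at_apply]
  constructor
  · have h1 := isIntegral_prod_derivative_of_cycle hr (by rw [hrd]; exact hd) hcoeff_int
      (y := fun i => π (y i)) hn hyF (by rw [hyn])
    rw [← hμF, hrd] at h1
    have h2 : ((N ^ p.natDegree : ℕ) : F) ^ n * algebraMap K F μ =
        algebraMap K F (((N ^ p.natDegree : ℕ) : K) ^ n * μ) := by simp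
    rw [h2] at h1
    exact (isIntegral_algebraMap_iff (algebraMap K F).injective).1 h1
  · intro σ
    have h1 := hB σ (fun i => τ σ (π (y i))) n hn (fun i => by
      rw [hyF, eval_map (τ σ), eval₂_at_apply]) (by rw [hyn])
    have h2 : σ μ = ∏ i ∈ Finset.range n,
        (derivative (r.map (τ σ))).eval (τ σ (π (y i))) := by
      conv_lhs => rw [← hτ σ]
      rw [RingHom.comp_apply, hμF, map_prod]
      refine Finset.prod_congr rfl fun i _ => ?_
      rw [derivative_map r (τ σ), eval_map (τ σ), eval₂_at_apply]
    rw [h2]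
    refine h1.trans (pow_le_pow_left₀ (zero_le_one.trans (hB1 σ)) ?_ n)
    have := Finset.single_le_sum (f := B) (s := Finset.univ)
      (fun σ _ => zero_le_one.trans (hB1 σ)) (Finset.mem_univ σ)
    linarith

/-- A holomorphic function with many zeros is small. -/
theorem norm_le_prod_of_zeros {r ρ : ℝ} (hρ : 0 < ρ) (hρr : ρ < r) (S : Finset ℂ) :
    ∀ {f : ℂ → ℂ} {A : ℝ}, DifferentiableOn ℂ f (Metric.ball 0 r) →
      (∀ z ∈ Metric.closedBall (0 : ℂ) ρ, ‖f z‖ ≤ A) →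
      (∀ s ∈ S, ‖s‖ ≤ ρ / 2 ∧ f s = 0) → ∀ z ∈ Metric.closedBall (0 : ℂ) ρ,
      ‖f z‖ ≤ A * ∏ s ∈ S, (2 / ρ * ‖z - s‖) := by
  induction S using Finset.induction_on with
  | empty => intro f A _ hA _ z hz; simpa using hA z hz
  | insert s S hs ih =>
    intro f A hf hA hS z hz
    obtain ⟨hsρ, hfs⟩ := hS s (Finset.mem_insert_self _ _)
    have hsball : Metric.ball (0 : ℂ) r ∈ nhds s :=
      Metric.isOpen_ball.mem_nhds (by simp only [Metric.mem_ball, dist_zero_right]; linarith)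
    have hg : DifferentiableOn ℂ (dslope f s) (Metric.ball 0 r) :=
      (Complex.differentiableOn_dslope hsball).2 hf
    have hfg : ∀ w, f w = (w - s) * dslope f s w := by
      intro w
      have := sub_smul_dslope f s w
      rw [hfs, sub_zero, smul_eq_mul] at this
      exact this.symm
    have hsub : Metric.closedBall (0 : ℂ) ρ ⊆ Metric.ball 0 r := Metric.closedBall_subset_ball hρr
    have hgb : ∀ w ∈ Metric.closedBall (0 : ℂ) ρ, ‖dslope f s w‖ ≤ A * (2 / ρ) := by
      intro w hw
      have hd : DiffContOnCl ℂ (dslope f s) (Metric.ball 0 ρ) := by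
        refine DifferentiableOn.diffContOnCl (hg.mono ?_)
        rw [closure_ball _ hρ.ne']; exact hsub
      refine Complex.norm_le_of_forall_mem_frontier_norm_le Metric.isBounded_ball hd ?_
        (by rwa [closure_ball _ hρ.ne'])
      intro v hv
      rw [frontier_ball _ hρ.ne', mem_sphere_zero_iff_norm] at hv
      have h1 := hA v (by simp [hv])
      rw [hfg, norm_mul] at h1
      have h2 : ρ / 2 ≤ ‖v - s‖ := by
        have := norm_sub_norm_le v s
        linarith
      have h3 : ρ / 2 * ‖dslope f s v‖ ≤ A :=
        (mul_le_mul_of_nonneg_right h2 (norm_nonneg _)).trans h1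
      rw [mul_div_assoc', le_div_iff₀ hρ]
      linarith
    have hgS : ∀ t ∈ S, ‖t‖ ≤ ρ / 2 ∧ dslope f s t = 0 := by
      intro t ht
      obtain ⟨h1, h2⟩ := hS t (Finset.mem_insert_of_mem ht)
      refine ⟨h1, ?_⟩
      rw [hfg] at h2
      exact (mul_eq_zero.1 h2).resolve_left (sub_ne_zero.2 fun h => hs (h ▸ ht))
    have := ih hg hgb hgS z hz
    rw [hfg, norm_mul, Finset.prod_insert hs]
    calc ‖z - s‖ * ‖dslope f s z‖
        ≤ ‖z - s‖ * (A * (2 / ρ) * ∏ s ∈ S, (2 / ρ * ‖z - s‖)) := by gcongr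
      _ = _ := by ring

open NumberField in
theorem exists_small_integral_solution (K : Type*) [Field K] [NumberField K] :
    ∃ c : ℝ, 1 ≤ c ∧ ∀ (q : ℕ) (a : Matrix (Fin q) (Fin (2 * q)) (𝓞 K)) (A : ℝ), 0 < q →
      1 ≤ A → (∀ i l, house (a i l : K) ≤ A) →
      ∃ ξ : Fin (2 * q) → 𝓞 K, ξ ≠ 0 ∧ a.mulVec ξ = 0 ∧ ∀ l, house (ξ l : K) ≤ c * q * A := by
  classical
  obtain ⟨c, hc⟩ : ∃ c : ℝ, ∀ (q : ℕ) (a : Matrix (Fin q) (Fin (2 * q)) (𝓞 K)) (A : ℝ)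
      (_ : 0 < q) (_ : a ≠ 0) (_ : ∀ i l, house (algebraMap (𝓞 K) K (a i l)) ≤ A),
      ∃ ξ : Fin (2 * q) → 𝓞 K, ξ ≠ 0 ∧ a.mulVec ξ = 0 ∧
        ∀ l, house (ξ l).1 ≤ c * ((c * (2 * q : ℕ) * A) ^ ((q : ℝ) / ((2 * q : ℕ) - q))) :=
    ⟨_, fun q a A h0 ha h => house.exists_ne_zero_int_vec_house_le K a ha h0 (by omega)
      (Fintype.card_fin _) h (Fintype.card_fin _)⟩
  refine ⟨2 * c ^ 2 + 1, by nlinarith [sq_nonneg c], fun q a A hq hA h => ?_⟩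
  have hq1 : (1 : ℝ) ≤ q := by exact_mod_cast hq
  by_cases ha : a = 0
  · subst ha
    refine ⟨fun _ => 1, ?_, by simp, fun l => ?_⟩
    · have : NeZero (2 * q) := ⟨by omega⟩
      exact fun h => one_ne_zero (congrFun h 0)
    · have : house (((1 : 𝓞 K) : 𝓞 K) : K) = 1 := by
        have := house_intCast (K := K) 1
        simpa using this
      rw [this]
      nlinarith [mul_le_mul hq1 hA zero_le_one (zero_le_one.trans hq1), sq_nonneg c,
        mul_nonneg (mul_nonneg (sq_nonneg c) (zero_le_one.trans hq1)) (zero_le_one.trans hA)]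
  · obtain ⟨ξ, h0, h1, h2⟩ := hc q a A hq ha h
    refine ⟨ξ, h0, h1, fun l => (h2 l).trans ?_⟩
    have hexp : (q : ℝ) / ((2 * q : ℕ) - q) = 1 := by
      push_cast
      rw [div_eq_one_iff_eq] <;> linarith
    rw [hexp, Real.rpow_one]
    push_cast
    nlinarith [mul_le_mul hq1 hA zero_le_one (zero_le_one.trans hq1)]

open NumberField in
theorem one_le_norm_mul_house_pow {K : Type*} [Field K] [NumberField K] {α : K}
    (hα : IsIntegral ℤ α) (h0 : α ≠ 0) (σ : K →+* ℂ) :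
    1 ≤ ‖σ α‖ * house α ^ (Module.finrank ℚ K - 1) := by
  refine le_trans ?_ (norm_norm_le_norm_mul_house_pow α σ)
  have h1 : IsIntegral ℤ (Algebra.norm ℚ α) := Algebra.isIntegral_norm ℚ hα
  obtain ⟨k, hk⟩ := IsIntegrallyClosed.isIntegral_iff.1 h1
  have hne : Algebra.norm ℚ α ≠ 0 := Algebra.norm_ne_zero_iff.2 h0
  rw [← hk] at hne ⊢
  have hk0 : k ≠ 0 := by rintro rfl; simp at hne
  have h2 : (1 : ℝ) ≤ |(k : ℝ)| := by exact_mod_cast Int.one_le_abs hk0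
  simpa [Int.norm_eq_abs] using h2

open NumberField in
theorem house_le_of_forall {K : Type*} [Field K] [NumberField K] {α : K} {A : ℝ} (hA : 0 ≤ A)
    (h : ∀ σ : K →+* ℂ, ‖σ α‖ ≤ A) : house α ≤ A :=
  (pi_norm_le_iff_of_nonneg hA).2 h

theorem eq_zero_of_zeros_tendsto {f : ℂ → ℂ} {r : ℝ} (hr : 0 < r)
    (hf : DifferentiableOn ℂ f (Metric.ball 0 r)) {x : ℕ → ℂ} (hx0 : ∀ j, x j ≠ 0)
    (hx : Filter.Tendsto x Filter.atTop (nhds 0)) (h : ∀ᶠ j in Filter.atTop, f (x j) = 0) :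
    ∀ z ∈ Metric.ball (0 : ℂ) r, f z = 0 := by
  have han : AnalyticOnNhd ℂ f (Metric.ball 0 r) := hf.analyticOnNhd Metric.isOpen_ball
  refine han.eqOn_zero_of_preconnected_of_frequently_eq_zero
    (convex_ball _ _).isPreconnected (Metric.mem_ball_self hr) ?_
  have hx' : Filter.Tendsto x Filter.atTop (nhdsWithin 0 {0}ᶜ) :=
    tendsto_nhdsWithin_iff.2 ⟨hx, Filter.Eventually.of_forall hx0⟩
  exact hx'.frequently h.frequently

open NumberField in
set_option maxHeartbeats 1000000 in
/-- Holomorphic functions whose values along a geometric sequence are, up to a common factor,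
elements of a number field of at most exponential height, satisfy a linear relation once there
are enough of them. -/
theorem exists_linear_relation (K : Subfield ℂ) [FiniteDimensional ℚ K] {l θ : ℂ}
    (hl : 1 < ‖l‖) (hθ : θ ≠ 0) {L : ℕ} (hL : 0 < L) {B : ℝ} (hB : 1 ≤ B) :
    ∃ M : ℕ, ∀ (r : ℝ) (V : Fin M → ℂ → ℂ) (μ : Fin M → ℕ → K) (m₀ : ℕ), 0 < r →
      (∀ i, DifferentiableOn ℂ (V i) (Metric.ball 0 r)) →
      (∀ i j, m₀ ≤ j → IsIntegral ℤ ((L : K) ^ j * μ i j) ∧ (∀ σ : K →+* ℂ, ‖σ (μ i j)‖ ≤ B ^ j) ∧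
        (μ i j : ℂ) = θ ^ j * V i (l⁻¹ ^ j)) →
      ∃ c : Fin M → ℂ, c ≠ 0 ∧ ∀ z ∈ Metric.ball (0 : ℂ) r, ∑ i, c i * V i z = 0 := by
  have : NumberField K := ⟨⟩
  obtain ⟨c, hc1, hc⟩ := exists_small_integral_solution K
  set b := ‖l‖ with hb
  have hb0 : 0 < b := zero_lt_one.trans hl
  set H : ℝ := L * B with hH
  have hL1 : (1 : ℝ) ≤ L := by exact_mod_cast hL
  have hH1 : 1 ≤ H := by rw [hH]; nlinarith
  set t : ℝ := max 1 ‖θ‖ with ht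
  have ht1 : 1 ≤ t := le_max_left _ _
  set E : ℝ := 2 * L * t * H * (2 * H ^ 2) ^ (Module.finrank ℚ K - 1) with hE
  have hE0 : 0 < E := by positivity
  obtain ⟨e, he⟩ := pow_unbounded_of_one_lt E hl
  obtain ⟨e, he, he1⟩ : ∃ e : ℕ, E < b ^ e ∧ 1 ≤ e :=
    ⟨e + 1, he.trans_le (pow_le_pow_right₀ hl.le (by omega)), by omega⟩
  obtain ⟨q, hq⟩ : ∃ q, q = 4 * e := ⟨_, rfl⟩
  refine ⟨2 * q, fun r V μ m₀ hr hV hμ => ?_⟩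
  set ρ := r / 2 with hρ
  have hρ0 : 0 < ρ := by positivity
  have hρr : ρ < r := by rw [hρ]; linarith
  have hbd : ∃ D : ℝ, 1 ≤ D ∧ ∀ i, ∀ z ∈ Metric.closedBall (0 : ℂ) ρ, ‖V i z‖ ≤ D := by
    have : ∀ i, ∃ D : ℝ, ∀ z ∈ Metric.closedBall (0 : ℂ) ρ, ‖V i z‖ ≤ D := fun i =>
      (isCompact_closedBall (0 : ℂ) ρ).exists_bound_of_continuousOn
        ((hV i).continuousOn.mono (Metric.closedBall_subset_ball hρr))
    choose D hD using this
    refine ⟨1 + ∑ i, |D i|, ?_, fun i z hz => (hD i z hz).trans ?_⟩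
    · linarith [Finset.sum_nonneg (s := Finset.univ) fun i _ => abs_nonneg (D i)]
    · have := Finset.single_le_sum (f := fun i => |D i|) (s := Finset.univ)
        (fun i _ => abs_nonneg _) (Finset.mem_univ i)
      linarith [le_abs_self (D i)]
  obtain ⟨D, hD1, hD⟩ := hbd
  -- the starting index
  obtain ⟨m₁, hm₁⟩ := pow_unbounded_of_one_lt (4 / ρ) hl
  obtain ⟨m₂, hm₂⟩ := pow_unbounded_of_one_lt ((2 * q : ℕ) * c * q * D) (one_lt_two (α := ℝ))
  obtain ⟨m', h1, h2, h3, h4⟩ : ∃ m' : ℕ, m₀ ≤ m' ∧ m₁ ≤ m' ∧ m₂ ≤ m' ∧ 2 * e ≤ m' :=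
    ⟨m₀ + m₁ + m₂ + 2 * e, by omega, by omega, by omega, by omega⟩
  have hm₁' : 4 / ρ ≤ b ^ m' := hm₁.le.trans (pow_le_pow_right₀ hl.le h2)
  set m := 2 * m' with hm
  have hm₂' : ((2 * q : ℕ) : ℝ) * c * q * D ≤ 2 ^ m :=
    hm₂.le.trans (pow_le_pow_right₀ one_le_two (by omega))
  have hq1 : (1 : ℝ) ≤ q := by exact_mod_cast (by omega : 1 ≤ q)
  let x : ℕ → ℂ := fun j => l⁻¹ ^ j
  have hl0 : l ≠ 0 := norm_ne_zero_iff.1 hb0.ne'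
  have hx : ∀ j, ‖x j‖ = (b ^ j)⁻¹ := fun j => by simp [x, hb]
  have hxinj : Function.Injective x := by
    intro i j hij
    have := congrArg norm hij
    rw [hx, hx, inv_inj] at this
    exact pow_right_injective₀ hb0 hl.ne' this
  have hx4 : ∀ j, m ≤ j → ‖x j‖ ≤ ρ / 4 * (b ^ m')⁻¹ := by
    intro j hj
    rw [hx]
    have h5 : (b ^ m')⁻¹ ≤ ρ / 4 := by
      rw [inv_le_comm₀ (by positivity) (by positivity), inv_div]; exact hm₁'
    calc (b ^ j)⁻¹ ≤ (b ^ m)⁻¹ := by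
          apply inv_anti₀ (by positivity); exact pow_le_pow_right₀ hl.le hj
      _ = (b ^ m')⁻¹ * (b ^ m')⁻¹ := by rw [hm, two_mul, pow_add, mul_inv]
      _ ≤ _ := by gcongr
  have hbm' : (b ^ m')⁻¹ ≤ 1 := inv_le_one_of_one_le₀ (one_le_pow₀ hl.le)
  have hhouse : ∀ i j, m₀ ≤ j → house ((L : K) ^ j * μ i j) ≤ H ^ j := by
    intro i j hj
    refine house_le_of_forall (by positivity) fun σ => ?_
    rw [map_mul, norm_mul, map_pow, map_natCast, norm_pow, Complex.norm_natCast, hH, mul_pow]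
    gcongr
    exact (hμ i j hj).2.1 σ
  obtain ⟨ξ, hξ0, hξ1, hξ2⟩ := hc q (fun i k => ⟨(L : K) ^ (m + i : ℕ) * μ k (m + i),
    (hμ k (m + i) (by omega)).1⟩) (H ^ (m + q)) (by omega) (one_le_pow₀ hH1) (fun i k =>
      (hhouse k (m + i) (by omega)).trans (pow_le_pow_right₀ hH1 (by omega)))
  let f : ℂ → ℂ := fun z => ∑ i, ((ξ i : K) : ℂ) * V i z
  have hf : DifferentiableOn ℂ f (Metric.ball 0 r) :=
    DifferentiableOn.fun_sum fun i _ => (hV i).const_mul _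
  have hξn : ∀ i, ‖((ξ i : K) : ℂ)‖ ≤ c * q * H ^ (m + q) := fun i =>
    (norm_embedding_le_house (ξ i : K) K.subtype).trans (hξ2 i)
  have hcard : ((Finset.univ : Finset (Fin (2 * q))).card : ℝ) = (2 * q : ℕ) := by simp
  have hfb : ∀ z ∈ Metric.closedBall (0 : ℂ) ρ, ‖f z‖ ≤ 2 ^ m * H ^ (m + q) := by
    intro z hz
    calc ‖f z‖ ≤ ∑ i : Fin (2 * q), (c * q * H ^ (m + q)) * D := by
          refine norm_sum_le_of_le _ fun i _ => ?_
          rw [norm_mul]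
          exact mul_le_mul (hξn i) (hD i z hz) (norm_nonneg _) (by positivity)
      _ = ((2 * q : ℕ) * c * q * D) * H ^ (m + q) := by
          rw [Finset.sum_const, nsmul_eq_mul, hcard]; ring
      _ ≤ _ := by gcongr
  have hsum : ∀ J, m₀ ≤ J → (((∑ i, (ξ i : K) * ((L : K) ^ J * μ i J) : K)) : ℂ) =
      (L : ℂ) ^ J * θ ^ J * f (x J) := by
    intro J hJ
    simp only [f]
    push_cast
    rw [Finset.mul_sum]
    refine Finset.sum_congr rfl fun i _ => ?_
    rw [(hμ i J hJ).2.2]; ring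
  have hne : ∀ J, (L : ℂ) ^ J * θ ^ J ≠ 0 := fun J =>
    mul_ne_zero (pow_ne_zero _ (by exact_mod_cast hL.ne')) (pow_ne_zero _ hθ)
  have hzero : ∀ J, m ≤ J → f (x J) = 0 := by
    intro J
    induction J using Nat.strong_induction_on with
    | _ J ih =>
      intro hJ
      by_cases hJq : J < m + q
      · have h5 := congrFun hξ1 ⟨J - m, by omega⟩
        have h6 : ∑ i, (ξ i : K) * ((L : K) ^ J * μ i J) = 0 := by
          have h7 := congrArg (fun w : 𝓞 K => (w : K)) h5
          simp only [Matrix.mulVec, dotProduct, Pi.zero_apply, map_sum,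
            map_zero, Nat.add_sub_cancel' hJ] at h7
          rw [← h7]
          exact Finset.sum_congr rfl fun i _ => mul_comm _ _
        have h8 := hsum J (by omega)
        rw [h6] at h8
        simpa [hne J] using h8.symm
      · push Not at hJq
        by_contra hfJ
        set α : K := ∑ i, (ξ i : K) * ((L : K) ^ J * μ i J) with hα
        have hα0 : α ≠ 0 := by
          intro h0
          have h8 := hsum J (by omega)
          rw [← hα, h0] at h8
          exact hfJ (by simpa [hne J] using h8.symm)
        have hαint : IsIntegral ℤ α := IsIntegral.sum _ fun i _ =>
          (RingOfIntegers.isIntegral_coe (ξ i)).mul (hμ i J (by omega)).1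
        have hlow := one_le_norm_mul_house_pow hαint hα0 K.subtype
        have hαhouse : house α ≤ (2 * H ^ 2) ^ J := by
          calc house α ≤ ∑ i : Fin (2 * q), (c * q * H ^ (m + q)) * H ^ J := by
                refine (house_sum_le_sum_house _ _).trans (Finset.sum_le_sum fun i _ => ?_)
                refine (house_mul_le _ _).trans ?_
                exact mul_le_mul (hξ2 i) (hhouse i J (by omega)) (house_nonneg _) (by positivity)
            _ = ((2 * q : ℕ) * c * q) * H ^ (m + q) * H ^ J := by
                rw [Finset.sum_const, nsmul_eq_mul, hcard]; ring
            _ ≤ ((2 * q : ℕ) * c * q * D) * H ^ J * H ^ J := by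
                have hH2 : H ^ (m + q) ≤ H ^ J := pow_le_pow_right₀ hH1 hJq
                have hD2 : ((2 * q : ℕ) * c * q : ℝ) ≤ (2 * q : ℕ) * c * q * D :=
                  le_mul_of_one_le_right (by positivity) hD1
                exact mul_le_mul_of_nonneg_right
                  (mul_le_mul hD2 hH2 (by positivity) (by positivity)) (by positivity)
            _ ≤ 2 ^ J * H ^ J * H ^ J := by
                gcongr
                exact hm₂'.trans (pow_le_pow_right₀ one_le_two hJ)
            _ = _ := by rw [mul_pow 2 (H ^ 2) J, ← pow_mul H 2 J, mul_comm 2 J, pow_mul H J 2]; ring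
        have hfJ : ‖f (x J)‖ ≤ (2 * H) ^ J * (b ^ m')⁻¹ ^ (J - m) := by
          have hsmall := norm_le_prod_of_zeros hρ0 hρr ((Finset.Ico m J).image x) hf hfb
            (by
              intro s hs
              obtain ⟨j, hj, rfl⟩ := Finset.mem_image.1 hs
              rw [Finset.mem_Ico] at hj
              refine ⟨(hx4 j hj.1).trans ?_, ih j hj.2 hj.1⟩
              nlinarith) (x J)
            (by
              rw [mem_closedBall_zero_iff]
              refine (hx4 J hJ).trans ?_
              nlinarith)
          refine hsmall.trans ?_
          have hcardI : ((Finset.Ico m J).image x).card = J - m := by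
            rw [Finset.card_image_of_injective _ hxinj, Nat.card_Ico]
          have hprod : ∏ s ∈ (Finset.Ico m J).image x, (2 / ρ * ‖x J - s‖) ≤
              (b ^ m')⁻¹ ^ (J - m) := by
            rw [← hcardI, ← Finset.prod_const]
            refine Finset.prod_le_prod (fun _ _ => by positivity) ?_
            intro s hs
            obtain ⟨j, hj, rfl⟩ := Finset.mem_image.1 hs
            rw [Finset.mem_Ico] at hj
            have h9 : ‖x J - x j‖ ≤ ρ / 2 * (b ^ m')⁻¹ := by
              have := norm_sub_le (x J) (x j)
              have := hx4 J hJ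
              have := hx4 j hj.1
              linarith
            calc 2 / ρ * ‖x J - x j‖ ≤ 2 / ρ * (ρ / 2 * (b ^ m')⁻¹) := by gcongr
              _ = _ := by field_simp
          rw [mul_pow 2 H J]
          have hH2 : H ^ (m + q) ≤ H ^ J := pow_le_pow_right₀ hH1 hJq
          have h22 : (2 : ℝ) ^ m ≤ 2 ^ J := pow_le_pow_right₀ one_le_two hJ
          exact mul_le_mul (mul_le_mul h22 hH2 (by positivity) (by positivity)) hprod
            (Finset.prod_nonneg fun _ _ => by positivity) (by positivity)
        have hexp : e * J ≤ m' * (J - m) := by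
          obtain ⟨u, hu⟩ : ∃ u, J = m + q + u := ⟨J - (m + q), by omega⟩
          obtain ⟨v, hv⟩ : ∃ v, m' = 2 * e + v := ⟨m' - 2 * e, by omega⟩
          have : J - m = q + u := by omega
          rw [this, hu, hm, hq, hv]
          exact Nat.le.intro (k := e * u + 2 * e * v + v * u) (by ring)
        have hnorm : ‖K.subtype α‖ = (L : ℝ) ^ J * ‖θ‖ ^ J * ‖f (x J)‖ := by
          have h8 := hsum J (by omega)
          rw [← hα] at h8
          change ‖(α : ℂ)‖ = _
          rw [h8]; simp
        have hcontra : (1 : ℝ) ≤ E ^ J * (b ^ (e * J))⁻¹ := by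
          calc (1 : ℝ) ≤ ‖K.subtype α‖ * house α ^ (Module.finrank ℚ K - 1) := hlow
            _ ≤ ((L : ℝ) ^ J * t ^ J * ((2 * H) ^ J * (b ^ m')⁻¹ ^ (J - m))) *
                ((2 * H ^ 2) ^ J) ^ (Module.finrank ℚ K - 1) := by
                rw [hnorm]
                gcongr
                · exact pow_nonneg (house_nonneg _) _
                · exact le_max_right _ _
                · exact house_nonneg _
            _ = E ^ J * (b ^ (m' * (J - m)))⁻¹ := by
                rw [hE, inv_pow, ← pow_mul, ← pow_mul, mul_comm J (Module.finrank ℚ K - 1),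
                  pow_mul (2 * H ^ 2) _ J]
                simp only [mul_pow]
                ring
            _ ≤ E ^ J * (b ^ (e * J))⁻¹ := by
                gcongr
                exact hl.le
        rw [pow_mul, ← div_eq_mul_inv, le_div_iff₀ (by positivity), one_mul] at hcontra
        have hJ0 : J ≠ 0 := by omega
        exact absurd hcontra (not_le.2 (pow_lt_pow_left₀ he hE0.le hJ0))
  refine ⟨fun i => ((ξ i : K) : ℂ), ?_, ?_⟩
  · intro h0
    apply hξ0
    funext i
    have := congrFun h0 i
    simp only [Pi.zero_apply] at this ⊢
    exact_mod_cast this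
  · refine eq_zero_of_zeros_tendsto hr hf (x := x) (fun j => pow_ne_zero _ (inv_ne_zero hl0)) ?_
      (Filter.eventually_atTop.2 ⟨m, hzero⟩)
    refine tendsto_pow_atTop_nhds_zero_of_norm_lt_one ?_
    rw [norm_inv]
    exact inv_lt_one_of_one_lt₀ hl

theorem finite_orbit_inter_periodicPts {α : Type*} (g : α → α) (c : α) :
    {y | y ∈ Function.periodicPts g ∧ ∃ n, g^[n] c = y}.Finite := by
  by_cases h : ∃ n, g^[n] c ∈ Function.periodicPts g
  · obtain ⟨n, k, hk, hper⟩ := h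
    refine ((Finset.range (n + k)).finite_toSet.image fun i => g^[i] c).subset ?_
    rintro _ ⟨-, m, rfl⟩
    rcases lt_or_ge m (n + k) with hm | hm
    · exact ⟨m, by simpa using hm, rfl⟩
    · refine ⟨(m - n) % k + n, ?_, ?_⟩
      · have := Nat.mod_lt (m - n) hk
        simp only [Finset.coe_range, Set.mem_Iio]
        omega
      · have h1 := hper.iterate_mod_apply (m - n)
        dsimp only
        rw [Function.iterate_add_apply, h1, ← Function.iterate_add_apply, Nat.sub_add_cancel]
        omega
  · refine Set.finite_empty.subset ?_
    rintro _ ⟨hy, n, rfl⟩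
    exact h ⟨n, hy⟩

/-- Along infinitely many times no point of a finite set returns close to itself, fixed points
excepted. -/
theorem exists_frequently_not_close_return (p : ℂ[X]) (S : Finset ℂ) :
    ∃ η : ℝ, 0 < η ∧ ∀ n₀ : ℕ, ∃ n, n₀ ≤ n ∧ ∀ c ∈ S, p.eval c ≠ c →
      η ≤ ‖(polyIter p n).eval c - c‖ := by
  set g : ℂ → ℂ := fun y => p.eval y with hg
  obtain ⟨Q, hQ0, hQ⟩ : ∃ Q : ℕ, 0 < Q ∧ ∀ c ∈ S, c ∈ Function.periodicPts g →
      Function.IsPeriodicPt g Q c := by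
    classical
    refine ⟨∏ c ∈ S, max 1 (Function.minimalPeriod g c), Finset.prod_pos fun c _ => by simp,
      fun c hc hper => ?_⟩
    have h1 := Function.minimalPeriod_pos_of_mem_periodicPts hper
    have h2 : max 1 (Function.minimalPeriod g c) = Function.minimalPeriod g c := by omega
    have h3 := Finset.dvd_prod_of_mem (fun c => max 1 (Function.minimalPeriod g c)) hc
    rw [h2] at h3
    exact (Function.isPeriodicPt_minimalPeriod g c).trans_dvd h3
  set W := Q * (S.card + 1) with hW
  have hη : ∀ c ∈ S, ∃ η : ℝ, 0 < η ∧ (c ∈ Function.periodicPts g → g c ≠ c → η ≤ ‖g c - c‖) ∧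
      (c ∉ Function.periodicPts g → ∀ k, 0 < k → k ≤ W → ∀ y, ‖y - c‖ < η →
        η ≤ ‖g^[k] y - c‖) := by
    intro c _
    by_cases hc : c ∈ Function.periodicPts g
    · by_cases hf : g c = c
      · exact ⟨1, one_pos, fun _ h => absurd hf h, fun h => absurd hc h⟩
      · exact ⟨‖g c - c‖, by simpa [sub_eq_zero] using hf, fun _ _ => le_rfl,
          fun h => absurd hc h⟩
    · have hk : ∀ k, 0 < k → ∀ᶠ η in nhdsWithin (0 : ℝ) (Set.Ioi 0),
          ∀ y, ‖y - c‖ < η → η ≤ ‖g^[k] y - c‖ := by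
        intro k hk
        have hne : g^[k] c ≠ c := fun h => hc ⟨k, hk, h⟩
        have hδ : 0 < ‖g^[k] c - c‖ := by simpa [sub_eq_zero] using hne
        have hcont : Continuous g^[k] := Continuous.iterate p.continuous k
        obtain ⟨ε, hε, hε'⟩ := Metric.continuous_iff.1 hcont c (‖g^[k] c - c‖ / 2) (by positivity)
        filter_upwards [Ioo_mem_nhdsGT (show 0 < min ε (‖g^[k] c - c‖ / 2) by positivity)]
          with η hη y hy
        have h1 := hε' y (by rw [dist_eq_norm]; exact hy.trans (hη.2.trans_le (min_le_left _ _)))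
        rw [dist_eq_norm] at h1
        have h2 := hη.2.le.trans (min_le_right _ _)
        have h3 := norm_sub_le (g^[k] y - c) (g^[k] y - g^[k] c)
        have h4 : g^[k] y - c - (g^[k] y - g^[k] c) = g^[k] c - c := by ring
        rw [h4] at h3
        linarith
      have hall : ∀ᶠ η in nhdsWithin (0 : ℝ) (Set.Ioi 0), ∀ k ∈ Finset.Icc 1 W,
          ∀ y, ‖y - c‖ < η → η ≤ ‖g^[k] y - c‖ :=
        (Filter.eventually_all_finset _).2 fun k hk' => hk k (Finset.mem_Icc.1 hk').1
      obtain ⟨η, hη1, hη2⟩ := (hall.and self_mem_nhdsWithin).exists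
      exact ⟨η, hη2, fun h => absurd h hc, fun _ k h1 h2 => hη1 k (Finset.mem_Icc.2 ⟨h1, h2⟩)⟩
  choose! η hη0 hη1 hη2 using hη
  obtain ⟨η₀, hη₀, hle⟩ : ∃ η₀ : ℝ, 0 < η₀ ∧ ∀ c ∈ S, η₀ ≤ η c := by
    rcases S.eq_empty_or_nonempty with rfl | hne
    · exact ⟨1, one_pos, by simp⟩
    · obtain ⟨c, hc, hmin⟩ := S.exists_min_image η hne
      exact ⟨η c, hη0 c hc, hmin⟩
  refine ⟨η₀, hη₀, fun n₀ => ?_⟩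
  by_contra! hbad
  have hbad' : ∀ l : ℕ, ∃ c ∈ S, p.eval c ≠ c ∧
      ‖(polyIter p (1 + Q * (n₀ + l))).eval c - c‖ < η₀ := fun l =>
    hbad _ (by nlinarith)
  choose c hcS hcf hc using hbad'
  obtain ⟨l, hl, l', hl', hne, heq⟩ := Finset.exists_ne_map_eq_of_card_lt_of_maps_to
    (s := Finset.range (S.card + 1)) (t := S) (by simp) (f := c) (fun l _ => hcS l)
  wlog hlt : l < l' generalizing l l'
  · exact this l' hl' l hl hne.symm heq.symm (by omega)
  simp only [Finset.mem_range] at hl hl'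
  have hnp : c l ∉ Function.periodicPts g := by
    intro hper
    have h1 := hQ _ (hcS l) hper
    have h2 := hc l
    rw [polyIter_eval, Function.iterate_add_apply, (h1.mul_const (n₀ + l)).eq] at h2
    exact absurd h2 (not_lt.2 ((hle _ (hcS l)).trans (hη1 _ (hcS l) hper (hcf l))))
  have h1 := hη2 _ (hcS l) hnp (Q * (l' - l)) (Nat.mul_pos hQ0 (by omega))
    (Nat.mul_le_mul_left _ (by omega)) _ ((hc l).trans_le (hle _ (hcS l)))
  have h2 := hc l'
  have h3 : 1 + Q * (n₀ + l') = Q * (l' - l) + (1 + Q * (n₀ + l)) := by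
    obtain ⟨u, rfl⟩ := Nat.exists_eq_add_of_lt hlt
    rw [show l + u + 1 - l = u + 1 by omega]; ring
  rw [← heq, polyIter_eval, h3, Function.iterate_add_apply] at h2
  rw [polyIter_eval] at h1
  exact absurd h2 (not_lt.2 ((hle _ (hcS l)).trans h1))

theorem comp_sub_dvd (p f g : ℂ[X]) : f - g ∣ p.comp f - p.comp g := by
  have := sub_dvd_eval_sub f g (p.map C)
  simpa [comp, eval₂_eq_eval_map] using this

theorem polyIter_sub_X_dvd_comp (p : ℂ[X]) (n : ℕ) :
    polyIter p n - X ∣ (polyIter p n - X).comp p := by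
  have := comp_sub_dvd p (polyIter p n) X
  rwa [← polyIter_succ', comp_X, polyIter,
    show (polyIter p n).comp p - p = (polyIter p n - X).comp p by
    simp] at this

theorem natDegree_polyIter_sub_X {p : ℂ[X]} (hd : 2 ≤ p.natDegree) {n : ℕ} (hn : 0 < n) :
    (polyIter p n - X).natDegree = p.natDegree ^ n := by
  rw [natDegree_sub_eq_left_of_natDegree_lt, natDegree_polyIter]
  rw [natDegree_X, natDegree_polyIter]
  exact Nat.one_lt_pow hn.ne' hd

theorem monic_polyIter_sub_X {p : ℂ[X]} (hp : p.Monic) (hd : 2 ≤ p.natDegree) {n : ℕ}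
    (hn : 0 < n) : (polyIter p n - X).Monic := by
  refine (monic_polyIter hp (by omega) n).sub_of_left ?_
  rw [degree_X, degree_eq_natDegree (monic_polyIter hp (by omega) n).ne_zero, natDegree_polyIter]
  exact_mod_cast Nat.one_lt_pow hn.ne' hd

theorem rootMultiplicity_eq_one_of_derivative_ne_zero {f : ℂ[X]} {x : ℂ}
    (hx : f.eval x = 0) (h : (derivative f).eval x ≠ 0) : f.rootMultiplicity x = 1 := by
  have hf : f ≠ 0 := by rintro rfl; simp at h
  have h1 : 0 < f.rootMultiplicity x := (rootMultiplicity_pos hf).2 hx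
  have h2 : ¬ 1 < f.rootMultiplicity x := fun h' =>
    h ((one_lt_rootMultiplicity_iff_isRoot hf).1 h').2
  omega

theorem rootMultiplicity_le_of_dvd_comp {p f : ℂ[X]} {x : ℂ} (hf : f ≠ 0) (hdvd : f ∣ f.comp p)
    (h0 : f.comp p ≠ 0) (hx : (derivative p).eval x ≠ 0) :
    f.rootMultiplicity x ≤ f.rootMultiplicity (p.eval x) := by
  obtain ⟨h, hh, hh'⟩ := exists_eq_pow_rootMultiplicity_mul_and_not_dvd f hf (p.eval x)
  set m := f.rootMultiplicity (p.eval x)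
  obtain ⟨k, hk⟩ : X - C x ∣ p - C (p.eval x) := X_sub_C_dvd_sub_C_eval
  have hkx : k.eval x ≠ 0 := by
    have := congrArg (fun u => (derivative u).eval x) hk
    simp at this
    rwa [← this]
  have hcomp : f.comp p = (X - C x) ^ m * (k ^ m * h.comp p) := by
    conv_lhs => rw [hh]
    simp only [mul_comp, pow_comp, sub_comp, X_comp, C_comp, hk]
    rw [mul_pow, mul_assoc]
  have hne : (k ^ m * h.comp p).eval x ≠ 0 := by
    rw [eval_mul, eval_pow, eval_comp]
    refine mul_ne_zero (pow_ne_zero _ hkx) fun h0 => hh' ?_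
    exact dvd_iff_isRoot.2 h0
  calc f.rootMultiplicity x ≤ (f.comp p).rootMultiplicity x :=
        rootMultiplicity_le_rootMultiplicity_of_dvd h0 hdvd x
    _ = m := by
        rw [hcomp] at h0 ⊢
        rw [rootMultiplicity_mul h0, rootMultiplicity_X_sub_C_pow,
          rootMultiplicity_eq_zero (p := k ^ m * h.comp p) hne, add_zero]

section cycles

variable {p : ℂ[X]} {n : ℕ} {x : ℂ}

theorem rootMultiplicity_le_apply (hp : p.Monic) (hd : 2 ≤ p.natDegree) (hn : 0 < n)
    (hx : (polyIter p n).eval x = x) :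
    (polyIter p n - X).rootMultiplicity x ≤ (polyIter p n - X).rootMultiplicity (p.eval x) := by
  have hf0 : polyIter p n - X ≠ 0 := (monic_polyIter_sub_X hp hd hn).ne_zero
  by_cases h : (derivative p).eval x = 0
  · have h1 : (derivative (polyIter p n)).eval x = 0 := by
      rw [derivative_polyIter_eval]
      exact Finset.prod_eq_zero (Finset.mem_range.2 hn) (by simpa [polyIter] using h)
    rw [rootMultiplicity_eq_one_of_derivative_ne_zero (by simp [hx]) (by simp [h1])]
    refine (rootMultiplicity_pos hf0).2 ?_
    have : (polyIter p n).eval (p.eval x) = p.eval x := by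
      rw [← eval_comp, ← polyIter, polyIter_succ', eval_comp, hx]
    simp [this]
  · refine rootMultiplicity_le_of_dvd_comp hf0 (polyIter_sub_X_dvd_comp p n) ?_ h
    exact ((monic_polyIter_sub_X hp hd hn).comp hp (by omega)).ne_zero

theorem rootMultiplicity_iterate (hp : p.Monic) (hd : 2 ≤ p.natDegree) (hn : 0 < n)
    (hx : (polyIter p n).eval x = x) :
    (polyIter p n - X).rootMultiplicity (p.eval x) = (polyIter p n - X).rootMultiplicity x := by
  have hper : ∀ i, (polyIter p n).eval ((polyIter p i).eval x) = (polyIter p i).eval x := by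
    intro i
    rw [← eval_comp, ← polyIter_add, add_comm, polyIter_add, eval_comp, hx]
  have hmono : Monotone fun i =>
      (polyIter p n - X).rootMultiplicity ((polyIter p i).eval x) := by
    refine monotone_nat_of_le_succ fun i => ?_
    rw [polyIter_succ', eval_comp]
    exact rootMultiplicity_le_apply hp hd hn (hper i)
  refine le_antisymm ?_ (rootMultiplicity_le_apply hp hd hn hx)
  have h1 := hmono (show 1 ≤ n from hn)
  dsimp only at h1
  rwa [polyIter_one, hx] at h1

/-- A product over an invariant set of periodic points, raised to the period, is the product of
the multipliers. -/
theorem prod_pow_eq_prod_multiplier (hp : p.Monic) (hd : 2 ≤ p.natDegree) (hn : 0 < n)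
    (S : Finset ℂ) (hS : ∀ x ∈ S, (polyIter p n).eval x = x) (hmap : ∀ x ∈ S, p.eval x ∈ S) :
    (∏ x ∈ S, ‖(derivative p).eval x‖ ^ (polyIter p n - X).rootMultiplicity x) ^ n =
      ∏ x ∈ S, ‖(derivative (polyIter p n)).eval x‖ ^ (polyIter p n - X).rootMultiplicity x := by
  set m := fun x => (polyIter p n - X).rootMultiplicity x with hm
  have hmapi : ∀ i, ∀ x ∈ S, (polyIter p i).eval x ∈ S := by
    intro i
    induction i with
    | zero => intro x hx; simpa [polyIter] using hx
    | succ i ih => intro x hx; rw [polyIter_succ', eval_comp]; exact hmap _ (ih x hx)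
  have hsucc : ∀ h : ℂ → ℝ, ∏ x ∈ S, h (p.eval x) = ∏ x ∈ S, h x := by
    intro h
    obtain ⟨k, rfl⟩ : ∃ k, n = k + 1 := ⟨n - 1, by omega⟩
    refine Finset.prod_nbij' (fun x => p.eval x) (fun x => (polyIter p k).eval x) hmap (hmapi k)
      ?_ ?_ (fun _ _ => rfl)
    · intro x hx
      have := hS x hx
      rwa [polyIter, eval_comp] at this
    · intro x hx
      have := hS x hx
      rwa [polyIter_succ', eval_comp] at this
  have hiter : ∀ i, ∏ x ∈ S, ‖(derivative p).eval ((polyIter p i).eval x)‖ ^ m x =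
      ∏ x ∈ S, ‖(derivative p).eval x‖ ^ m x := by
    intro i
    induction i with
    | zero => simp [polyIter]
    | succ i ih =>
      rw [← ih, ← hsucc fun x => ‖(derivative p).eval ((polyIter p i).eval x)‖ ^ m x]
      refine Finset.prod_congr rfl fun x hx => ?_
      rw [polyIter, eval_comp]
      dsimp only [m]
      rw [rootMultiplicity_iterate hp hd hn (hS x hx)]
  have : ∀ x ∈ S, ‖(derivative (polyIter p n)).eval x‖ ^ m x =
      ∏ i ∈ Finset.range n, ‖(derivative p).eval ((polyIter p i).eval x)‖ ^ m x := by
    intro x _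
    rw [derivative_polyIter_eval, norm_prod, Finset.prod_pow]
  rw [Finset.prod_congr rfl this, Finset.prod_comm, Finset.prod_congr rfl fun i _ => hiter i]
  simp [hm]

end cycles

/-- A periodic point whose multiplier has modulus larger than one. -/
def IsRepelling (p : ℂ[X]) (x : ℂ) : Prop :=
  ∃ k, 0 < k ∧ (polyIter p k).eval x = x ∧ 1 < ‖(derivative (polyIter p k)).eval x‖

theorem exists_prod_le_of_finite_repelling {p : ℂ[X]} (hp : p.Monic) (hd : 2 ≤ p.natDegree)
    (hfin : {x | IsRepelling p x}.Finite) :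
    ∃ A : ℝ, ∀ n, 0 < n → ∀ S : Finset ℂ, (∀ x ∈ S, (polyIter p n).eval x = x) →
      (∀ x ∈ S, p.eval x ∈ S) →
      ∏ x ∈ S, ‖(derivative p).eval x‖ ^ (polyIter p n - X).rootMultiplicity x ≤ A := by
  classical
  obtain ⟨B, hB1, hB⟩ := exists_norm_prod_le p hd
  have hBn : ∀ n, 0 < n → ∀ x, (polyIter p n).eval x = x →
      ‖(derivative (polyIter p n)).eval x‖ ≤ B ^ n := by
    intro n hn x hx
    rw [derivative_polyIter_eval]
    refine hB (fun i => (polyIter p i).eval x) n hn (fun i => ?_) ?_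
    · rw [polyIter_succ', eval_comp]
    · simpa [polyIter] using hx
  refine ⟨B ^ hfin.toFinset.card, fun n hn S hS hmap => ?_⟩
  refine le_of_pow_le_pow_left₀ hn.ne' (by positivity) ?_
  rw [prod_pow_eq_prod_multiplier hp hd hn S hS hmap]
  calc _ ≤ ∏ x ∈ S, (if x ∈ hfin.toFinset then B ^ n else 1) := by
        refine Finset.prod_le_prod (fun _ _ => by positivity) fun x hx => ?_
        by_cases h1 : 1 < ‖(derivative (polyIter p n)).eval x‖
        · rw [if_pos (hfin.mem_toFinset.2 ⟨n, hn, hS x hx, h1⟩),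
            rootMultiplicity_eq_one_of_derivative_ne_zero (by simp [hS x hx]), pow_one]
          · exact hBn n hn x (hS x hx)
          · intro h0
            rw [derivative_sub, derivative_X, eval_sub, eval_one, sub_eq_zero] at h0
            rw [h0] at h1
            simp at h1
        · refine (pow_le_one₀ (norm_nonneg _) (not_lt.1 h1)).trans ?_
          split_ifs
          · exact one_le_pow₀ hB1
          · exact le_rfl
    _ = (B ^ n) ^ (S.filter (· ∈ hfin.toFinset)).card := by
        rw [Finset.prod_ite]; simp
    _ ≤ (B ^ n) ^ hfin.toFinset.card := by
        refine pow_le_pow_right₀ (one_le_pow₀ hB1) (Finset.card_le_card fun x hx => ?_)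
        exact (Finset.mem_filter.1 hx).2
    _ = _ := by rw [← pow_mul, ← pow_mul, mul_comm]

theorem eval_eq_prod_roots (f : ℂ[X]) (x : ℂ) :
    f.eval x = f.leadingCoeff * (f.roots.map fun a => x - a).prod := by
  conv_lhs => rw [(IsAlgClosed.splits f).eq_prod_roots]
  rw [eval_mul, eval_C, eval_multiset_prod, Multiset.map_map]
  simp

theorem infinite_repelling {p : ℂ[X]} (hp : p.Monic) (hd : 2 ≤ p.natDegree) :
    {x | IsRepelling p x}.Infinite := by
  classical
  intro hfin
  obtain ⟨A, hA⟩ := exists_prod_le_of_finite_repelling hp hd hfin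
  set R := (derivative p).roots with hR
  have hp'0 : derivative p ≠ 0 := by
    intro h
    have := derivative_eq_zero.1 h
    omega
  have hlc : ‖(derivative p).leadingCoeff‖ = p.natDegree := by
    rw [leadingCoeff, natDegree_derivative, coeff_derivative,
      Nat.sub_add_cancel (by omega), hp.coeff_natDegree]
    rw [one_mul, ← Nat.cast_succ, Nat.succ_eq_add_one, Nat.sub_add_cancel (by omega)]
    simp
  set F := R.toFinset.filter fun c => p.eval c = c with hF
  obtain ⟨η, hη, hret⟩ := exists_frequently_not_close_return p R.toFinset
  obtain ⟨ρ, hρ1, hρ⟩ : ∃ ρ : ℝ, 1 ≤ ρ ∧ ∀ a ∈ R.toFinset, ∀ c ∈ R.toFinset, ‖c - a‖ ≤ ρ := by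
    obtain ⟨B, hB⟩ := (R.toFinset.finite_toSet.isBounded).exists_norm_le
    refine ⟨max 1 (B + B), le_max_left _ _, fun a ha c hc => ?_⟩
    exact (norm_sub_le _ _).trans ((add_le_add (hB c hc) (hB a ha)).trans (le_max_right _ _))
  have hFR : ∀ a ∈ F, a ∈ R.toFinset ∧ p.eval a = a := fun a ha =>
    by rwa [hF, Finset.mem_filter] at ha
  set κ : ℝ := min 1 η / ρ ^ F.card with hκ
  have hκ0 : 0 < κ := by positivity
  have key : ∀ n₀ : ℕ, ∃ n, n₀ ≤ n ∧
      (2 : ℝ) ^ (p.natDegree ^ n - F.card) * κ ^ R.card ≤ A := by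
    intro n₀
    obtain ⟨n, hn, hn'⟩ := hret (n₀ + 1)
    have hn0 : 0 < n := by omega
    refine ⟨n, by omega, ?_⟩
    set f := polyIter p n - X with hf
    have hfm : f.Monic := monic_polyIter_sub_X hp hd hn0
    set m := fun x => f.rootMultiplicity x with hm
    set S := f.roots.toFinset \ F with hS
    have hfix : ∀ a ∈ F, (polyIter p n).eval a = a := by
      intro a ha
      rw [polyIter_eval]
      exact Function.iterate_fixed (hFR a ha).2 n
    have hcrit : ∀ a ∈ F, (derivative (polyIter p n)).eval a = 0 := by
      intro a ha
      rw [derivative_polyIter_eval]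
      refine Finset.prod_eq_zero (Finset.mem_range.2 hn0) ?_
      have := (hFR a ha).1
      rw [Multiset.mem_toFinset, hR, mem_roots hp'0] at this
      simpa [polyIter] using this
    have hm1 : ∀ a ∈ F, m a = 1 := fun a ha =>
      rootMultiplicity_eq_one_of_derivative_ne_zero (by simp [hf, hfix a ha])
        (by simp [hf, hcrit a ha])
    have hFsub : F ⊆ f.roots.toFinset := by
      intro a ha
      rw [Multiset.mem_toFinset, mem_roots hfm.ne_zero]
      simp [hf, hfix a ha]
    set g : ℂ[X] := ∏ x ∈ S, (X - C x) ^ m x with hg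
    set h : ℂ[X] := ∏ a ∈ F, (X - C a) with hh
    have hfgh : f = g * h := by
      have h1 := (IsAlgClosed.splits f).eq_prod_roots
      rw [hfm.leadingCoeff, C_1, one_mul, prod_multiset_root_eq_finset_root,
        ← Finset.prod_sdiff hFsub] at h1
      rw [h1, hg, hh]
      congr 1
      refine Finset.prod_congr rfl fun a ha => ?_
      have := hm1 a ha
      dsimp only [m] at this
      rw [this, pow_one]
    have hSfix : ∀ x ∈ S, (polyIter p n).eval x = x := by
      intro x hx
      have := (Finset.mem_sdiff.1 hx).1
      rw [Multiset.mem_toFinset, mem_roots hfm.ne_zero] at this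
      simpa [hf, sub_eq_zero] using this
    have hSmap : ∀ x ∈ S, p.eval x ∈ S := by
      intro x hx
      have hx' := hSfix x hx
      refine Finset.mem_sdiff.2 ⟨?_, fun hF' => (Finset.mem_sdiff.1 hx).2 ?_⟩
      · rw [Multiset.mem_toFinset, mem_roots hfm.ne_zero]
        have : (polyIter p n).eval (p.eval x) = p.eval x := by
          rw [← eval_comp, ← polyIter, polyIter_succ', eval_comp, hx']
        simp [hf, this]
      · have : p.eval x = x := by
          obtain ⟨k, rfl⟩ : ∃ k, n = k + 1 := ⟨n - 1, by omega⟩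
          rw [polyIter, eval_comp, polyIter_eval, Function.iterate_fixed (hFR _ hF').2] at hx'
          exact hx'
        rwa [this] at hF'
    have hgc : ∀ c ∈ R, κ ≤ ‖g.eval c‖ := by
      intro c hc
      have hc' : c ∈ R.toFinset := Multiset.mem_toFinset.2 hc
      have hprod : ∀ F' ⊆ F, ‖∏ a ∈ F', (c - a)‖ ≤ ρ ^ F.card := by
        intro F' hF'
        rw [norm_prod]
        calc _ ≤ ∏ _a ∈ F', ρ := Finset.prod_le_prod (fun _ _ => norm_nonneg _)
              fun a ha => hρ a (hFR a (hF' ha)).1 c hc'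
          _ = ρ ^ F'.card := by simp
          _ ≤ _ := pow_le_pow_right₀ hρ1 (Finset.card_le_card hF')
      rw [hκ, div_le_iff₀ (by positivity)]
      by_cases hcF : c ∈ F
      · have h1 : (derivative f).eval c = g.eval c * ∏ a ∈ F.erase c, (c - a) := by
          have h2 : h = (X - C c) * ∏ a ∈ F.erase c, (X - C a) :=
            (Finset.mul_prod_erase F _ hcF).symm
          rw [hfgh, h2]
          simp [eval_prod]
        have h3 : (derivative f).eval c = -1 := by simp [hf, hcrit c hcF]
        have h4 : 1 = ‖g.eval c‖ * ‖∏ a ∈ F.erase c, (c - a)‖ := by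
          rw [← norm_mul, ← h1, h3]; simp
        refine (min_le_left _ _).trans ?_
        rw [h4]
        gcongr
        exact hprod _ (Finset.erase_subset _ _)
      · have hne : p.eval c ≠ c := fun h0 => hcF (Finset.mem_filter.2 ⟨hc', h0⟩)
        have h1 := hn' c hc' hne
        have h2 : (polyIter p n).eval c - c = g.eval c * ∏ a ∈ F, (c - a) := by
          have : f.eval c = (polyIter p n).eval c - c := by simp [hf]
          rw [← this, hfgh]
          simp [hh, eval_prod]
        refine (min_le_right _ _).trans (h1.trans ?_)
        rw [h2, norm_mul]
        gcongr
        exact hprod _ subset_rfl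
    have hdeg : ∑ x ∈ S, m x = p.natDegree ^ n - F.card := by
      have h1 := natDegree_polyIter_sub_X hd hn0
      rw [← hf, hfgh, natDegree_mul, hg, hh, natDegree_prod_of_monic, natDegree_prod_of_monic] at h1
      · simp at h1
        omega
      · exact fun a _ => monic_X_sub_C a
      · exact fun a _ => (monic_X_sub_C a).pow _
      · exact (monic_prod_of_monic _ _ fun a _ => (monic_X_sub_C a).pow _).ne_zero
      · exact (monic_prod_of_monic _ _ fun a _ => monic_X_sub_C a).ne_zero
    have hprod : ∏ x ∈ S, ‖(derivative p).eval x‖ ^ m x =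
        (p.natDegree : ℝ) ^ (p.natDegree ^ n - F.card) * (R.map fun c => ‖g.eval c‖).prod := by
      have h1 : ∀ x ∈ S, ‖(derivative p).eval x‖ ^ m x =
          (p.natDegree : ℝ) ^ m x * (R.map fun c => ‖x - c‖ ^ m x).prod := by
        intro x _
        rw [eval_eq_prod_roots, norm_mul, hlc, mul_pow, Multiset.prod_map_pow]
        congr 2
        have := Multiset.prod_hom ((derivative p).roots.map fun a => x - a) (normHom : ℂ →*₀ ℝ)
        rw [Multiset.map_map] at this
        exact this.symm
      rw [Finset.prod_congr rfl h1, Finset.prod_mul_distrib, Finset.prod_pow_eq_pow_sum, hdeg]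
      congr 1
      have h2 : ∏ x ∈ S, (R.map fun c => ‖x - c‖ ^ m x).prod =
          (R.map fun c => ∏ x ∈ S, ‖x - c‖ ^ m x).prod := Multiset.prod_map_prod_map S.val R
      rw [h2]
      congr 2
      funext c
      rw [hg, eval_prod, norm_prod]
      refine Finset.prod_congr rfl fun x _ => ?_
      rw [eval_pow, norm_pow]
      simp [norm_sub_rev]
    refine le_trans ?_ (hA n hn0 S hSfix hSmap)
    rw [hprod]
    have h3 : κ ^ R.card ≤ (R.map fun c => ‖g.eval c‖).prod := by
      have := Multiset.prod_map_le_prod_map₀ (s := R) (fun _ => κ) (fun c => ‖g.eval c‖)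
        (fun _ _ => hκ0.le) hgc
      simpa using this
    refine mul_le_mul (pow_le_pow_left₀ zero_le_two ?_ _) h3 (by positivity) (by positivity)
    exact_mod_cast hd
  obtain ⟨N, hN⟩ := pow_unbounded_of_one_lt (A / κ ^ R.card) (one_lt_two)
  obtain ⟨n, hn, hle⟩ := key (N + F.card)
  have h1 : N ≤ p.natDegree ^ n - F.card := by
    have : n < p.natDegree ^ n := Nat.lt_pow_self hd
    omega
  have h2 : A < 2 ^ N * κ ^ R.card := (div_lt_iff₀ (by positivity)).1 hN
  have h3 : (2 : ℝ) ^ N * κ ^ R.card ≤ 2 ^ (p.natDegree ^ n - F.card) * κ ^ R.card := by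
    gcongr
    exact one_le_two
  linarith

/-- There is a repelling periodic point outside the forward orbits of the critical points. -/
theorem exists_repelling_not_postcritical {p : ℂ[X]} (hp : p.Monic) (hd : 2 ≤ p.natDegree) :
    ∃ x k, 0 < k ∧ (polyIter p k).eval x = x ∧ 1 < ‖(derivative (polyIter p k)).eval x‖ ∧
      ∀ n y, (polyIter p n).eval y = x → (derivative (polyIter p n)).eval y ≠ 0 := by
  have hp'0 : derivative p ≠ 0 := by
    intro h
    have := derivative_eq_zero.1 h
    omega
  set g : ℂ → ℂ := fun y => p.eval y with hg
  have hfin : (⋃ c ∈ (derivative p).roots.toFinset,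
      {y | y ∈ Function.periodicPts g ∧ ∃ n, g^[n] c = y}).Finite :=
    Set.Finite.biUnion (Finset.finite_toSet _) fun c _ => finite_orbit_inter_periodicPts g c
  obtain ⟨x, ⟨k, hk, hx, hx1⟩, hnot⟩ := ((infinite_repelling hp hd).sdiff hfin).nonempty
  refine ⟨x, k, hk, hx, hx1, fun n y hy h0 => hnot ?_⟩
  rw [derivative_polyIter_eval, Finset.prod_eq_zero_iff] at h0
  obtain ⟨i, hi, hc⟩ := h0
  rw [Finset.mem_range] at hi
  refine Set.mem_biUnion (x := (polyIter p i).eval y) ?_ ⟨⟨k, hk, ?_⟩, n - i, ?_⟩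
  · simpa [mem_roots hp'0] using hc
  · rw [polyIter_eval] at hx; exact hx
  · rw [← polyIter_eval, ← eval_comp, ← polyIter_add, Nat.sub_add_cancel hi.le, hy]

theorem exists_norm_eval_sub_le_sq (P : ℂ[X]) (x : ℂ) :
    ∃ A : ℝ, 0 ≤ A ∧ ∀ h : ℂ, ‖h‖ ≤ 1 →
      ‖P.eval (x + h) - P.eval x - (derivative P).eval x * h‖ ≤ A * ‖h‖ ^ 2 := by
  obtain ⟨q, hq⟩ : (X : ℂ[X]) ^ 2 ∣ taylor x P - C (P.eval x) - C ((derivative P).eval x) * X := by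
    rw [X_pow_dvd_iff]
    intro i hi
    interval_cases i <;> simp [taylor_coeff_one]
  obtain ⟨A, hA⟩ := (isCompact_closedBall (0 : ℂ) 1).exists_bound_of_continuousOn
    (f := fun z => q.eval z) q.continuous.continuousOn
  refine ⟨max A 0, le_max_right _ _, fun h hh => ?_⟩
  have h1 := congrArg (fun u => u.eval h) hq
  simp only [eval_sub, taylor_eval, eval_C, eval_mul, eval_X, eval_pow] at h1
  rw [add_comm x h, h1, norm_mul, norm_pow, mul_comm]
  gcongr
  exact (hA h (by simpa using hh)).trans (le_max_left _ _)

theorem exists_lipschitz_near (P : ℂ[X]) (x : ℂ) {Λ : ℝ} (hΛ : ‖(derivative P).eval x‖ < Λ) :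
    ∃ R > 0, ∀ y z, ‖y - x‖ < R → ‖z - x‖ < R → ‖P.eval y - P.eval z‖ ≤ Λ * ‖y - z‖ := by
  have h := (P.hasStrictDerivAt x).hasStrictFDerivAt
  have hΛ0 : 0 ≤ Λ := (norm_nonneg _).trans hΛ.le
  lift Λ to NNReal using hΛ0
  obtain ⟨s, hs, hlip⟩ := h.exists_lipschitzOnWith_of_nnnorm_lt Λ (by
    rw [← NNReal.coe_lt_coe]
    simpa using hΛ)
  obtain ⟨R, hR, hRs⟩ := Metric.mem_nhds_iff.1 hs
  refine ⟨R, hR, fun y z hy hz => ?_⟩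
  have := hlip.norm_sub_le (hRs (by simpa [dist_eq_norm] using hy))
    (hRs (by simpa [dist_eq_norm] using hz))
  simpa using this

/-- A repelling fixed point of a polynomial has an entire linearizing function. -/
theorem exists_linearization {P : ℂ[X]} {x₀ l : ℂ} (hx : P.eval x₀ = x₀)
    (hl : (derivative P).eval x₀ = l) (h1 : 1 < ‖l‖) :
    ∃ φ : ℂ → ℂ, Differentiable ℂ φ ∧ φ 0 = x₀ ∧ deriv φ 0 = 1 ∧
      ∀ s, φ (l * s) = P.eval (φ s) := by
  have hl0 : l ≠ 0 := norm_pos_iff.1 (zero_lt_one.trans h1)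
  obtain ⟨Λ, hΛ1, hΛ2⟩ : ∃ Λ, ‖l‖ < Λ ∧ Λ < ‖l‖ ^ 2 := exists_between (by nlinarith)
  obtain ⟨R, hR, hlip⟩ := exists_lipschitz_near P x₀ (hl ▸ hΛ1)
  obtain ⟨A, hA0, hA⟩ := exists_norm_eval_sub_le_sq P x₀
  set κ := Λ / ‖l‖ ^ 2 with hκ
  have hΛ0 : 0 < Λ := zero_lt_one.trans (h1.trans hΛ1)
  have hκ0 : 0 < κ := by positivity
  have hκ1 : κ < 1 := (div_lt_one (by positivity)).2 hΛ2
  obtain ⟨r, hr0, hr1, hrR, hrA⟩ : ∃ r : ℝ, 0 < r ∧ r ≤ 1 ∧ 2 * r < R ∧ A * r * (1 - κ)⁻¹ ≤ 1 := by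
    have h1κ : 0 < (1 - κ)⁻¹ := inv_pos.2 (by linarith)
    refine ⟨min 1 (min (R / 4) (1 / (A * (1 - κ)⁻¹ + 1))), by positivity, min_le_left _ _, ?_, ?_⟩
    · have := (min_le_right 1 (min (R / 4) (1 / (A * (1 - κ)⁻¹ + 1)))).trans (min_le_left _ _)
      linarith
    · have := (min_le_right 1 (min (R / 4) (1 / (A * (1 - κ)⁻¹ + 1)))).trans (min_le_right _ _)
      rw [le_div_iff₀ (by positivity)] at this
      have h0 : 0 ≤ min 1 (min (R / 4) (1 / (A * (1 - κ)⁻¹ + 1))) := by positivity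
      nlinarith
  set φ : ℕ → ℂ → ℂ := fun n s => (polyIter P n).eval (x₀ + s / l ^ n) with hφ
  have hφ0 : ∀ s, φ 0 s = x₀ + s := by intro s; simp [hφ, polyIter]
  have hφs : ∀ n s, φ (n + 1) s = P.eval (φ n (s / l)) := by
    intro n s
    simp only [hφ]
    rw [polyIter_succ', eval_comp, pow_succ', div_div]
  have hgeom : ∀ n, ∑ i ∈ Finset.range n, κ ^ i ≤ (1 - κ)⁻¹ := fun n =>
    (tsum_geometric_of_lt_one hκ0.le hκ1) ▸
      (summable_geometric_of_lt_one hκ0.le hκ1).sum_le_tsum _ fun _ _ => by positivity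
  have hsl : ∀ s : ℂ, ‖s / l‖ ≤ ‖s‖ := fun s => by
    rw [norm_div]; exact div_le_self (norm_nonneg _) h1.le
  have hind : ∀ n, ∀ s : ℂ, ‖s‖ ≤ r →
      ‖φ n s - x₀‖ ≤ (1 + A * r * ∑ i ∈ Finset.range n, κ ^ i) * ‖s‖ ∧
      ‖φ (n + 1) s - φ n s‖ ≤ A * κ ^ n * ‖s‖ ^ 2 := by
    have hball : ∀ n, (∀ s : ℂ, ‖s‖ ≤ r →
        ‖φ n s - x₀‖ ≤ (1 + A * r * ∑ i ∈ Finset.range n, κ ^ i) * ‖s‖) →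
        ∀ s : ℂ, ‖s‖ ≤ r → ‖φ n s - x₀‖ < R := by
      intro n h s hs
      refine ((h s hs).trans ?_).trans_lt hrR
      have h2 : A * r * ∑ i ∈ Finset.range n, κ ^ i ≤ 1 :=
        (mul_le_mul_of_nonneg_left (hgeom n) (by positivity)).trans hrA
      nlinarith [norm_nonneg s]
    intro n
    induction n with
    | zero =>
      intro s hs
      refine ⟨by simp [hφ0], ?_⟩
      rw [hφs, hφ0, hφ0]
      have h2 := hA (s / l) ((hsl s).trans (hs.trans hr1))
      rw [hx, hl, mul_div_cancel₀ _ hl0, sub_sub] at h2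
      rw [pow_zero, mul_one]
      refine h2.trans ?_
      gcongr
      exact hsl s
    | succ n ih =>
      have hfst : ∀ s : ℂ, ‖s‖ ≤ r →
          ‖φ (n + 1) s - x₀‖ ≤ (1 + A * r * ∑ i ∈ Finset.range (n + 1), κ ^ i) * ‖s‖ := by
        intro s hs
        have h2 := norm_sub_le_norm_sub_add_norm_sub (φ (n + 1) s) (φ n s) x₀
        rw [Finset.sum_range_succ]
        have h3 : A * κ ^ n * ‖s‖ ^ 2 ≤ A * r * κ ^ n * ‖s‖ := by
          have : ‖s‖ ^ 2 ≤ r * ‖s‖ := by nlinarith [norm_nonneg s]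
          calc _ ≤ A * κ ^ n * (r * ‖s‖) := by gcongr
            _ = _ := by ring
        linarith [(ih s hs).1, (ih s hs).2]
      intro s hs
      refine ⟨hfst s hs, ?_⟩
      have hs' := (hsl s).trans hs
      rw [hφs (n + 1) s, hφs n s]
      refine (hlip _ _ (hball (n + 1) hfst _ hs') (hball n (fun s hs => (ih s hs).1) _ hs')).trans ?_
      calc _ ≤ Λ * (A * κ ^ n * ‖s / l‖ ^ 2) := by
            gcongr
            exact (ih _ hs').2
        _ = A * κ ^ (n + 1) * ‖s‖ ^ 2 := by
            rw [norm_div, div_pow, pow_succ, hκ]; ring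
  have hdist : ∀ s : ℂ, ‖s‖ ≤ r → ∀ n, dist (φ n s) (φ (n + 1) s) ≤ A * r ^ 2 * κ ^ n := by
    intro s hs n
    rw [dist_comm, dist_eq_norm]
    refine ((hind n s hs).2).trans ?_
    calc _ ≤ A * κ ^ n * r ^ 2 := by gcongr
      _ = _ := by ring
  have hloc : ∀ s : ℂ, ‖s‖ ≤ r → ∃ y, Filter.Tendsto (fun n => φ n s) Filter.atTop (nhds y) :=
    fun s hs => cauchySeq_tendsto_of_complete (cauchySeq_of_le_geometric κ _ hκ1 (hdist s hs))
  have hstep : ∀ s y, Filter.Tendsto (fun n => φ n s) Filter.atTop (nhds y) →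
      Filter.Tendsto (fun n => φ n (l * s)) Filter.atTop (nhds (P.eval y)) := by
    intro s y h
    rw [← Filter.tendsto_add_atTop_iff_nat 1]
    have : (fun n => φ (n + 1) (l * s)) = fun n => P.eval (φ n s) := by
      funext n; rw [hφs, mul_div_cancel_left₀ _ hl0]
    rw [this]
    exact (P.continuous.tendsto y).comp h
  have hpow : ∀ s y, Filter.Tendsto (fun n => φ n s) Filter.atTop (nhds y) → ∀ m : ℕ,
      Filter.Tendsto (fun n => φ n (l ^ m * s)) Filter.atTop (nhds ((polyIter P m).eval y)) := by
    intro s y h m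
    induction m with
    | zero => simpa [polyIter] using h
    | succ m ih =>
      have := hstep _ _ ih
      rwa [← mul_assoc, ← pow_succ', ← eval_comp, ← polyIter_succ'] at this
  have hscale : ∀ s : ℂ, ∃ m : ℕ, ‖s / l ^ m‖ < r := by
    intro s
    obtain ⟨m, hm⟩ := pow_unbounded_of_one_lt (‖s‖ / r) h1
    refine ⟨m, ?_⟩
    rw [norm_div, norm_pow, div_lt_iff₀ (by positivity)]
    rw [div_lt_iff₀ hr0] at hm
    linarith
  have hex : ∀ s : ℂ, ∃ y, Filter.Tendsto (fun n => φ n s) Filter.atTop (nhds y) := by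
    intro s
    obtain ⟨m, hm⟩ := hscale s
    obtain ⟨y, hy⟩ := hloc _ hm.le
    refine ⟨(polyIter P m).eval y, ?_⟩
    have := hpow _ _ hy m
    rwa [mul_div_cancel₀ _ (pow_ne_zero _ hl0)] at this
  choose Φ hΦ using hex
  have hfun : ∀ s, Φ (l * s) = P.eval (Φ s) := fun s =>
    tendsto_nhds_unique (hΦ _) (hstep _ _ (hΦ s))
  have hfunpow : ∀ m : ℕ, ∀ s, Φ (l ^ m * s) = (polyIter P m).eval (Φ s) := fun m s =>
    tendsto_nhds_unique (hΦ _) (hpow _ _ (hΦ s) m)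
  have hunif : TendstoUniformlyOn φ Φ Filter.atTop (Metric.ball 0 r) := by
    rw [Metric.tendstoUniformlyOn_iff]
    intro ε hε
    have hlim : Filter.Tendsto (fun n => A * r ^ 2 * κ ^ n / (1 - κ)) Filter.atTop (nhds 0) := by
      have := ((tendsto_pow_atTop_nhds_zero_of_lt_one hκ0.le hκ1).const_mul (A * r ^ 2)).div_const
        (1 - κ)
      simpa using this
    filter_upwards [hlim.eventually_lt_const hε] with n hn s hs
    rw [mem_ball_zero_iff] at hs
    rw [dist_comm]
    exact (dist_le_of_le_geometric_of_tendsto κ _ hκ1 (hdist s hs.le) (hΦ s) n).trans_lt hn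
  have hφd : ∀ n, Differentiable ℂ (φ n) := by
    intro n
    exact (polyIter P n).differentiable.comp ((differentiable_id.div_const _).const_add x₀)
  have hΦd : DifferentiableOn ℂ Φ (Metric.ball 0 r) :=
    hunif.tendstoLocallyUniformlyOn.differentiableOn
      (Filter.Eventually.of_forall fun n => (hφd n).differentiableOn) Metric.isOpen_ball
  refine ⟨Φ, ?_, ?_, ?_, hfun⟩
  · intro s
    obtain ⟨m, hm⟩ := hscale s
    have hEq : Φ = fun s => (polyIter P m).eval (Φ (s / l ^ m)) := by
      funext s
      rw [← hfunpow, mul_div_cancel₀ _ (pow_ne_zero _ hl0)]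
    rw [hEq]
    have h2 : DifferentiableAt ℂ Φ (s / l ^ m) :=
      hΦd.differentiableAt (Metric.isOpen_ball.mem_nhds (by simpa using hm))
    exact (polyIter P m).differentiable.differentiableAt.comp s
      (h2.comp s (differentiableAt_id.div_const _))
  · refine tendsto_nhds_unique (hΦ 0) ?_
    have : ∀ n, φ n 0 = x₀ := by
      intro n
      simp only [hφ, zero_div, add_zero]
      rw [polyIter_eval]
      exact Function.iterate_fixed hx n
    simp [this]
  · have h2 := (hunif.tendstoLocallyUniformlyOn.deriv
      (Filter.Eventually.of_forall fun n => (hφd n).differentiableOn) Metric.isOpen_ball).tendsto_at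
        (Metric.mem_ball_self hr0)
    refine tendsto_nhds_unique h2 ?_
    have : ∀ n, deriv (φ n) 0 = 1 := by
      intro n
      have h3 : HasDerivAt (fun s : ℂ => x₀ + s / l ^ n) (1 / l ^ n) 0 :=
        ((hasDerivAt_id (0 : ℂ)).div_const _).const_add x₀
      have h4 := ((polyIter P n).hasDerivAt (x₀ + 0 / l ^ n)).comp (0 : ℂ) h3
      refine h4.deriv.trans ?_
      rw [zero_div, add_zero, derivative_polyIter_eval]
      have : ∀ i, (polyIter P i).eval x₀ = x₀ := by
        intro i
        rw [polyIter_eval]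
        exact Function.iterate_fixed hx i
      simp only [this, hl]
      simp [hl0]
    simp [this]

/-- An entire function of polynomial growth is a polynomial. -/
theorem exists_polynomial_of_growth {f : ℂ → ℂ} (hf : Differentiable ℂ f) {A : ℝ} {e : ℕ}
    (h : ∀ z, ‖f z‖ ≤ A * (1 + ‖z‖ ^ e)) : ∃ q : ℂ[X], ∀ z, f z = q.eval z := by
  have hzero : ∀ n, e < n → iteratedDeriv n f 0 = 0 := by
    intro n hn
    have hlim : Filter.Tendsto (fun R : ℝ => n.factorial * (A * (1 + R ^ e)) / R ^ n)
        Filter.atTop (nhds 0) := by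
      have h1 : Filter.Tendsto (fun R : ℝ => 1 / R ^ n) Filter.atTop (nhds 0) := by
        simp only [one_div]
        exact (Filter.tendsto_pow_atTop (α := ℝ) (by omega : n ≠ 0)).inv_tendsto_atTop
      have h2 : Filter.Tendsto (fun R : ℝ => R ^ e / R ^ n) Filter.atTop (nhds 0) :=
        tendsto_pow_div_pow_atTop_zero hn
      have h3 := (h1.add h2).const_mul (n.factorial * A)
      simp only [add_zero, mul_zero] at h3
      refine h3.congr fun R => ?_
      ring
    have hle : ‖iteratedDeriv n f 0‖ ≤ 0 := by
      refine ge_of_tendsto hlim ?_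
      filter_upwards [Filter.eventually_gt_atTop 0] with R hR
      refine Complex.norm_iteratedDeriv_le_of_forall_mem_sphere_norm_le n hR
        hf.diffContOnCl fun z hz => ?_
      have : ‖z‖ = R := by simpa using hz
      rw [← this]
      exact h z
    exact norm_le_zero_iff.1 hle
  refine ⟨∑ n ∈ Finset.range (e + 1), C ((n.factorial : ℂ)⁻¹ * iteratedDeriv n f 0) * X ^ n,
    fun z => ?_⟩
  rw [← Complex.taylorSeries_eq_of_entire' 0 z hf, tsum_eq_sum (s := Finset.range (e + 1))]
  · simp [eval_finsetSum]
  · intro n hn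
    rw [hzero n (by simpa using hn)]
    simp

/-- A nowhere vanishing entire function has an entire logarithm. -/
theorem exists_entire_log {f : ℂ → ℂ} (hf : Differentiable ℂ f) (h0 : ∀ z, f z ≠ 0) :
    ∃ H : ℂ → ℂ, Differentiable ℂ H ∧ ∀ z, f z = Complex.exp (H z) := by
  have hg : Differentiable ℂ fun z => deriv f z / f z :=
    (hf.contDiff (n := 2)).differentiable_deriv_two.div hf h0
  obtain ⟨F, hF⟩ := hg.isExactOn_univ.with_val_at 0 (Complex.log (f 0))
  have hF' : ∀ z, HasDerivAt F (deriv f z / f z) z := fun z => hF.2 z (Set.mem_univ z)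
  refine ⟨F, fun z => (hF' z).differentiableAt, fun z => ?_⟩
  have hd : ∀ z, HasDerivAt (fun z => f z * Complex.exp (-F z)) 0 z := by
    intro z
    have := (hf z).hasDerivAt.mul (hF' z).neg.cexp
    refine this.congr_deriv ?_
    field_simp [h0 z]
    ring
  have hc : f z * Complex.exp (-F z) = f 0 * Complex.exp (-F 0) :=
    is_const_of_deriv_eq_zero (fun z => (hd z).differentiableAt) (fun z => (hd z).deriv) z 0
  rw [hF.1, Complex.exp_neg (Complex.log _), Complex.exp_log (h0 0), mul_inv_cancel₀ (h0 0),
    Complex.exp_neg] at hc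
  field_simp at hc
  exact hc

/-- A nonconstant entire function of finite order that omits a value attains all others. -/
theorem attains_of_omits {f : ℂ → ℂ} (hf : Differentiable ℂ f) {A : ℝ} {e : ℕ}
    (h : ∀ z, ‖f z‖ ≤ Real.exp (A * (1 + ‖z‖ ^ e))) {y₀ : ℂ} (hy₀ : ∀ z, f z ≠ y₀)
    (hne : ∃ z, f z ≠ f 0) {y : ℂ} (hy : y ≠ y₀) : ∃ z, f z = y := by
  obtain ⟨H, hH, hfH⟩ := exists_entire_log (f := fun z => f z - y₀) (hf.sub_const y₀)
    fun z => sub_ne_zero.2 (hy₀ z)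
  have hA0 : ∃ M : ℝ, 0 < M ∧ ∀ z, (H z).re ≤ M * (1 + ‖z‖ ^ e) := by
    refine ⟨|A| + ‖y₀‖ + 1, by positivity, fun z => ?_⟩
    have hz : 0 ≤ ‖z‖ ^ e := by positivity
    have h1 : Real.exp (H z).re ≤ Real.exp (|A| * (1 + ‖z‖ ^ e) + ‖y₀‖) := by
      rw [← Complex.norm_exp, ← hfH z, Real.exp_add]
      have h2 : Real.exp (A * (1 + ‖z‖ ^ e)) ≤ Real.exp (|A| * (1 + ‖z‖ ^ e)) :=
        Real.exp_le_exp.2 (mul_le_mul_of_nonneg_right (le_abs_self A) (by linarith))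
      have h3 : 1 ≤ Real.exp (|A| * (1 + ‖z‖ ^ e)) := Real.one_le_exp (by positivity)
      have h4 := Real.add_one_le_exp ‖y₀‖
      have h5 := norm_sub_le (f z) y₀
      have h6 := h z
      nlinarith [norm_nonneg y₀]
    rw [Real.exp_le_exp] at h1
    nlinarith [norm_nonneg y₀]
  obtain ⟨M, hM0, hM⟩ := hA0
  have hgrow : ∃ A' : ℝ, ∀ z, ‖H z‖ ≤ A' * (1 + ‖z‖ ^ e) := by
    refine ⟨2 * (M * (1 + 3 ^ e)) + 3 * ‖H 0‖, fun z => ?_⟩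
    have hz0 := norm_nonneg z
    have hpow : (2 * ‖z‖ + 1) ^ e ≤ 3 ^ e * (1 + ‖z‖ ^ e) := by
      rcases le_total ‖z‖ 1 with hz | hz
      · have : (2 * ‖z‖ + 1) ^ e ≤ 3 ^ e := by gcongr; linarith
        have h2 : (0 : ℝ) ≤ 3 ^ e * ‖z‖ ^ e := by positivity
        linarith
      · have : (2 * ‖z‖ + 1) ^ e ≤ (3 * ‖z‖) ^ e := by gcongr; linarith
        rw [mul_pow] at this
        have h2 : (0 : ℝ) ≤ 3 ^ e := by positivity
        linarith
    have hb := Complex.borelCaratheodory (f := H) (M := M * (1 + (2 * ‖z‖ + 1) ^ e))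
      (R := 2 * ‖z‖ + 1) (z := z) (by positivity) hH.differentiableOn (fun w hw => by
        have hw' : ‖w‖ < 2 * ‖z‖ + 1 := by simpa using hw
        refine (hM w).trans ?_
        gcongr) (by positivity) (by simp; linarith)
    have hden : 0 < 2 * ‖z‖ + 1 - ‖z‖ := by linarith
    have h1 : 2 * (M * (1 + (2 * ‖z‖ + 1) ^ e)) * ‖z‖ / (2 * ‖z‖ + 1 - ‖z‖) ≤
        2 * (M * (1 + (2 * ‖z‖ + 1) ^ e)) := by
      rw [div_le_iff₀ hden]
      have : 0 ≤ 2 * (M * (1 + (2 * ‖z‖ + 1) ^ e)) := by positivity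
      nlinarith
    have h2 : ‖H 0‖ * (2 * ‖z‖ + 1 + ‖z‖) / (2 * ‖z‖ + 1 - ‖z‖) ≤ 3 * ‖H 0‖ := by
      rw [div_le_iff₀ hden]
      nlinarith [norm_nonneg (H 0)]
    have h3 : 2 * (M * (1 + (2 * ‖z‖ + 1) ^ e)) ≤ 2 * (M * ((1 + 3 ^ e) * (1 + ‖z‖ ^ e))) := by
      have : 0 ≤ ‖z‖ ^ e := by positivity
      gcongr
      nlinarith
    have h4 : 3 * ‖H 0‖ ≤ 3 * ‖H 0‖ * (1 + ‖z‖ ^ e) := by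
      have : 0 ≤ ‖z‖ ^ e := by positivity
      nlinarith [norm_nonneg (H 0)]
    calc ‖H z‖ ≤ _ := hb
      _ ≤ _ := add_le_add (h1.trans h3) (h2.trans h4)
      _ = _ := by ring
  obtain ⟨A', hA'⟩ := hgrow
  obtain ⟨q, hq⟩ := exists_polynomial_of_growth hH hA'
  have hdeg : 0 < q.degree := by
    by_contra! h0
    rw [degree_le_zero_iff] at h0
    obtain ⟨z, hz⟩ := hne
    apply hz
    have h1 := hfH z
    have h2 := hfH 0
    rw [hq, h0] at h1 h2
    simp only [eval_C] at h1 h2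
    rw [← h2] at h1
    simpa using h1
  obtain ⟨z, hz⟩ := IsAlgClosed.exists_root (q - C (Complex.log (y - y₀))) (by
    rw [degree_sub_C hdeg]; exact hdeg.ne')
  refine ⟨z, ?_⟩
  have h1 := hfH z
  have h2 : q.eval z = Complex.log (y - y₀) := by simpa [sub_eq_zero] using hz
  rw [hq, h2, Complex.exp_log (sub_ne_zero.2 hy)] at h1
  simpa using h1

/-- `φ` is an entire linearization of `P` at the repelling fixed point `x₀` of multiplier `l`,
all preimages of `x₀` being noncritical. -/
structure IsLinearization (P : ℂ[X]) (x₀ l : ℂ) (φ : ℂ → ℂ) : Prop where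
  one_lt : 1 < ‖l‖
  diff : Differentiable ℂ φ
  map_zero : φ 0 = x₀
  deriv_zero : deriv φ 0 = 1
  map_mul : ∀ s, φ (l * s) = P.eval (φ s)
  deriv_ne : ∀ t, φ t = x₀ → deriv φ t ≠ 0

theorem map_pow_of_map_mul {P : ℂ[X]} {l : ℂ} {φ : ℂ → ℂ} (h : ∀ s, φ (l * s) = P.eval (φ s))
    (n : ℕ) (s : ℂ) : φ (l ^ n * s) = (polyIter P n).eval (φ s) := by
  induction n generalizing s with
  | zero => simp [polyIter]
  | succ n ih => rw [pow_succ, mul_assoc, ih, h, polyIter, eval_comp]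

namespace IsLinearization

variable {P : ℂ[X]} {x₀ l : ℂ} {φ : ℂ → ℂ}

theorem map_pow (h : IsLinearization P x₀ l φ) (n : ℕ) (s : ℂ) :
    φ (l ^ n * s) = (polyIter P n).eval (φ s) := map_pow_of_map_mul h.map_mul n s

theorem ne_zero (h : IsLinearization P x₀ l φ) : l ≠ 0 := by
  rintro rfl
  exact absurd h.one_lt (by simp)

theorem deriv_map_pow (h : IsLinearization P x₀ l φ) (n : ℕ) (s : ℂ) :
    l ^ n * deriv φ (l ^ n * s) = (derivative (polyIter P n)).eval (φ s) * deriv φ s := by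
  have h1 : HasDerivAt (fun s => φ (l ^ n * s)) (deriv φ (l ^ n * s) * (l ^ n * 1)) s :=
    (h.diff (l ^ n * s)).hasDerivAt.comp s ((hasDerivAt_id s).const_mul (l ^ n))
  have h2 : HasDerivAt (fun s => (polyIter P n).eval (φ s))
      ((derivative (polyIter P n)).eval (φ s) * deriv φ s) s :=
    ((polyIter P n).hasDerivAt (φ s)).comp s (h.diff s).hasDerivAt
  rw [← h2.deriv, ← funext (h.map_pow n), h1.deriv]
  ring

theorem derivative_eval (h : IsLinearization P x₀ l φ) : (derivative P).eval x₀ = l := by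
  have := h.deriv_map_pow 1 0
  simpa [h.deriv_zero, h.map_zero, polyIter_one] using this.symm

theorem comp_self (h : IsLinearization P x₀ l φ) :
    IsLinearization (P.comp P) x₀ (l ^ 2) φ where
  one_lt := by
    rw [norm_pow]
    exact one_lt_pow₀ h.one_lt two_ne_zero
  diff := h.diff
  map_zero := h.map_zero
  deriv_zero := h.deriv_zero
  map_mul s := by rw [pow_two, mul_assoc, h.map_mul, h.map_mul, eval_comp]
  deriv_ne := h.deriv_ne

theorem exists_growth (h : IsLinearization P x₀ l φ) (hd : 2 ≤ P.natDegree) {e : ℕ}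
    (he : (P.natDegree : ℝ) ≤ ‖l‖ ^ e) :
    ∃ A : ℝ, ∀ s, ‖φ s‖ ≤ Real.exp (A * (1 + ‖s‖ ^ e)) := by
  obtain ⟨c, hc1, hc⟩ : ∃ c : ℝ, 1 ≤ c ∧ ∀ y, ‖P.eval y‖ ≤ c * max 1 ‖y‖ ^ P.natDegree := by
    refine ⟨1 + ∑ i ∈ Finset.range (P.natDegree + 1), ‖P.coeff i‖, ?_, fun y => ?_⟩
    · have : 0 ≤ ∑ i ∈ Finset.range (P.natDegree + 1), ‖P.coeff i‖ := by positivity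
      linarith
    · rw [eval_eq_sum_range, add_mul, Finset.sum_mul]
      have h1 : (0 : ℝ) ≤ 1 * max 1 ‖y‖ ^ P.natDegree := by positivity
      refine (norm_sum_le _ _).trans (le_add_of_nonneg_of_le h1 (Finset.sum_le_sum fun i hi => ?_))
      rw [norm_mul, norm_pow]
      gcongr
      calc ‖y‖ ^ i ≤ max 1 ‖y‖ ^ i := by gcongr; exact le_max_right _ _
        _ ≤ _ := pow_le_pow_right₀ (le_max_left _ _) (by simpa [Nat.lt_succ_iff] using hi)
  have hstep : ∀ s, c * max 1 ‖φ (l * s)‖ ≤ (c * max 1 ‖φ s‖) ^ P.natDegree := by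
    intro s
    have hm : 1 ≤ max 1 ‖φ s‖ := le_max_left _ _
    have h1 : max 1 ‖φ (l * s)‖ ≤ c * max 1 ‖φ s‖ ^ P.natDegree := by
      refine max_le ?_ (by rw [h.map_mul]; exact hc _)
      nlinarith [one_le_pow₀ hm (n := P.natDegree)]
    rw [mul_pow]
    calc c * max 1 ‖φ (l * s)‖ ≤ c * (c * max 1 ‖φ s‖ ^ P.natDegree) := by gcongr
      _ = c ^ 2 * max 1 ‖φ s‖ ^ P.natDegree := by ring
      _ ≤ _ := by gcongr
  have hiter : ∀ n s, c * max 1 ‖φ (l ^ n * s)‖ ≤ (c * max 1 ‖φ s‖) ^ P.natDegree ^ n := by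
    intro n
    induction n with
    | zero => intro s; simp
    | succ n ih =>
      intro s
      rw [pow_succ', mul_assoc]
      refine (hstep _).trans ?_
      rw [pow_succ, pow_mul]
      gcongr
      exact ih s
  obtain ⟨M, hM⟩ := (isCompact_closedBall (0 : ℂ) ‖l‖).exists_bound_of_continuousOn
    h.diff.continuous.continuousOn
  have hball : ∀ u, ‖u‖ ≤ ‖l‖ → c * max 1 ‖φ u‖ ≤ Real.exp (c * max 1 M) := by
    intro u hu
    have h1 : max 1 ‖φ u‖ ≤ max 1 M := max_le_max le_rfl (hM u (by simpa using hu))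
    have h2 := Real.add_one_le_exp (c * max 1 M)
    have h3 : c * max 1 ‖φ u‖ ≤ c * max 1 M := by gcongr
    linarith
  have hA : 0 ≤ c * max 1 M := by positivity
  have hle : ∀ s, ‖φ s‖ ≤ c * max 1 ‖φ s‖ := by
    intro s
    have := le_max_right 1 ‖φ s‖
    nlinarith [norm_nonneg (φ s)]
  refine ⟨c * max 1 M, fun s => ?_⟩
  rcases le_or_gt 1 ‖s‖ with hs | hs
  · obtain ⟨n, hn1, hn2⟩ := exists_nat_pow_near hs h.one_lt
    have hln : (l ^ n) ≠ 0 := pow_ne_zero _ h.ne_zero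
    have hs' : s = l ^ n * (s / l ^ n) := by field_simp
    have hu : ‖s / l ^ n‖ ≤ ‖l‖ := by
      rw [norm_div, norm_pow, div_le_iff₀ (pow_pos (norm_pos_iff.2 h.ne_zero) n), ← pow_succ']
      exact hn2.le
    have h1 := hiter n (s / l ^ n)
    rw [← hs'] at h1
    have h0 : 0 ≤ c * max 1 ‖φ (s / l ^ n)‖ := by positivity
    refine ((hle s).trans h1).trans ((pow_le_pow_left₀ h0 (hball _ hu) _).trans ?_)
    rw [← Real.exp_nat_mul, Real.exp_le_exp, mul_comm]
    gcongr
    push_cast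
    calc (P.natDegree : ℝ) ^ n ≤ (‖l‖ ^ e) ^ n := by gcongr
      _ = (‖l‖ ^ n) ^ e := by rw [← pow_mul, ← pow_mul, mul_comm]
      _ ≤ ‖s‖ ^ e := by gcongr
      _ ≤ 1 + ‖s‖ ^ e := by linarith
  · refine ((hle s).trans (hball s (by linarith [h.one_lt]))).trans (Real.exp_le_exp.2 ?_)
    have : 0 ≤ ‖s‖ ^ e := by positivity
    nlinarith

end IsLinearization

theorem eq_pow_of_forall_eval_eq {P : ℂ[X]} (hP : P.Monic) (hd : 2 ≤ P.natDegree) {y₀ : ℂ}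
    (h : ∀ y, P.eval y = y₀ → y = y₀) : P = (X - C y₀) ^ P.natDegree + C y₀ := by
  have hdeg : (P - C y₀).natDegree = P.natDegree := natDegree_sub_C
  have hm : (P - C y₀).Monic := by
    refine hP.sub_of_left ?_
    refine degree_C_le.trans_lt ?_
    rw [← natDegree_pos_iff_degree_pos]
    omega
  have hs := IsAlgClosed.splits (P - C y₀)
  have hr : (P - C y₀).roots = Multiset.replicate P.natDegree y₀ := by
    rw [Multiset.eq_replicate]
    refine ⟨by rw [← hdeg]; exact hs.natDegree_eq_card_roots.symm, fun y hy => h y ?_⟩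
    have := (mem_roots'.1 hy).2
    simpa [sub_eq_zero] using this
  have := hs.eq_prod_roots_of_monic hm
  rw [hr] at this
  simp only [Multiset.map_replicate, Multiset.prod_replicate] at this
  rw [← this]
  ring

namespace IsLinearization

variable {P : ℂ[X]} {x₀ l : ℂ} {φ : ℂ → ℂ}

/-- Either `φ` takes the value `x₀` away from the origin, or `P` is conjugate to a power map. -/
theorem exists_zero_or_power (h : IsLinearization P x₀ l φ) (hP : P.Monic)
    (hd : 2 ≤ P.natDegree) :
    (∃ t, t ≠ 0 ∧ φ t = x₀) ∨ ∃ y₀, P = (X - C y₀) ^ P.natDegree + C y₀ := by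
  obtain ⟨y, hy, hyx⟩ : ∃ y, P.eval y = x₀ ∧ y ≠ x₀ := by
    by_contra! hcon
    have h1 := eq_pow_of_forall_eval_eq hP hd hcon
    have h2 := h.derivative_eval
    rw [h1] at h2
    simp only [derivative_add, derivative_X_sub_C_pow, derivative_C, add_zero, eval_mul,
      eval_pow, eval_sub, eval_X, eval_C, sub_self] at h2
    rw [zero_pow (by omega), mul_zero] at h2
    exact h.ne_zero h2.symm
  by_cases hat : ∃ t, φ t = y
  · left
    obtain ⟨t, ht⟩ := hat
    refine ⟨l * t, ?_, by rw [h.map_mul, ht, hy]⟩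
    refine mul_ne_zero h.ne_zero ?_
    rintro rfl
    exact hyx (by rw [← ht, h.map_zero])
  · right
    push Not at hat
    refine ⟨y, eq_pow_of_forall_eval_eq hP hd fun y' hy' => ?_⟩
    by_contra hne
    obtain ⟨e, he⟩ := pow_unbounded_of_one_lt (P.natDegree : ℝ) h.one_lt
    obtain ⟨A, hA⟩ := h.exists_growth hd he.le
    have hnc : ∃ z, φ z ≠ φ 0 := by
      by_contra! hc
      have h1 := h.deriv_zero
      rw [show φ = fun _ => φ 0 from funext hc] at h1
      simp at h1
    obtain ⟨s, hs⟩ := attains_of_omits h.diff hA hat hnc hne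
    exact hat (l * s) (by rw [h.map_mul, hs, hy'])

end IsLinearization

theorem exists_isLinearization {p : ℂ[X]} (hp : p.Monic) (hd : 2 ≤ p.natDegree) :
    ∃ k x₀ l φ, 0 < k ∧ IsLinearization (polyIter p k) x₀ l φ := by
  obtain ⟨x, k, hk, hx, hrep, hpc⟩ := exists_repelling_not_postcritical hp hd
  obtain ⟨φ, hφ, h0, h1, hm⟩ := exists_linearization hx rfl hrep
  refine ⟨k, x, _, φ, hk, hrep, hφ, h0, h1, hm, fun t ht => ?_⟩
  obtain ⟨l, hl⟩ : ∃ l, l = (derivative (polyIter p k)).eval x := ⟨_, rfl⟩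
  rw [← hl] at hm hrep
  have hl0 : l ≠ 0 := by
    rintro rfl
    exact absurd hrep (by simp)
  have hcont : ContinuousAt (deriv φ) 0 :=
    (hφ.contDiff (n := 2)).differentiable_deriv_two.continuous.continuousAt
  have hne : ∀ᶠ u in nhds (0 : ℂ), deriv φ u ≠ 0 := hcont.eventually_ne (by rw [h1]; simp)
  have hlim : Filter.Tendsto (fun n : ℕ => (l⁻¹) ^ n * t) Filter.atTop (nhds 0) := by
    have h2 := (tendsto_pow_atTop_nhds_zero_of_norm_lt_one (x := l⁻¹) (by
      rw [norm_inv]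
      exact inv_lt_one_of_one_lt₀ hrep)).mul_const t
    simpa using h2
  obtain ⟨n, hn⟩ := (hlim.eventually hne).exists
  have hs : t = l ^ n * ((l⁻¹) ^ n * t) := by
    rw [← mul_assoc, ← mul_pow, mul_inv_cancel₀ hl0]
    simp
  obtain ⟨s, hsdef⟩ : ∃ s, s = (l⁻¹) ^ n * t := ⟨_, rfl⟩
  rw [← hsdef] at hs hn
  have hiter := map_pow_of_map_mul hm n
  have e1 : HasDerivAt (fun s => φ (l ^ n * s)) (deriv φ (l ^ n * s) * (l ^ n * 1)) s :=
    (hφ (l ^ n * s)).hasDerivAt.comp s ((hasDerivAt_id s).const_mul (l ^ n))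
  have e2 : HasDerivAt (fun s => (polyIter (polyIter p k) n).eval (φ s))
      ((derivative (polyIter (polyIter p k) n)).eval (φ s) * deriv φ s) s :=
    ((polyIter (polyIter p k) n).hasDerivAt (φ s)).comp s (hφ s).hasDerivAt
  rw [← funext hiter] at e2
  have e3 := e1.unique e2
  rw [← hs] at e3
  intro h4
  rw [h4, zero_mul, polyIter_mul] at e3
  refine mul_ne_zero (hpc _ (φ s) ?_) hn e3.symm
  rw [← polyIter_mul, ← hiter, ← hs, ht]

theorem exists_analytic_solution {k F : ℂ → ℂ} (hk : AnalyticAt ℂ k 0) (hF : AnalyticAt ℂ F 0) :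
    ∃ S : ℂ × ℂ → ℂ, AnalyticAt ℂ S 0 ∧ S 0 = 0 ∧
      ∀ᶠ x in nhds (0 : ℂ × ℂ), S x = x.1 * k (x.1 * x.2 * F (S x)) := by
  obtain ⟨f, hf⟩ : ∃ f : (ℂ × ℂ) × ℂ → ℂ, f = fun u => u.2 - u.1.1 * k (u.1.1 * u.1.2 * F u.2) :=
    ⟨_, rfl⟩
  have hfa : AnalyticAt ℂ f 0 := by
    have h1 : AnalyticAt ℂ (fun u : (ℂ × ℂ) × ℂ => u.2) 0 := analyticAt_snd
    have h2 : AnalyticAt ℂ (fun u : (ℂ × ℂ) × ℂ => u.1.1) 0 := analyticAt_fst.comp analyticAt_fst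
    have h3 : AnalyticAt ℂ (fun u : (ℂ × ℂ) × ℂ => u.1.2) 0 := analyticAt_snd.comp analyticAt_fst
    have h4 : AnalyticAt ℂ (fun u : (ℂ × ℂ) × ℂ => F u.2) 0 := AnalyticAt.fun_comp hF h1
    have h5 : AnalyticAt ℂ (fun u : (ℂ × ℂ) × ℂ => k (u.1.1 * u.1.2 * F u.2)) 0 := by
      refine AnalyticAt.fun_comp (g := k) ?_ ((h2.mul h3).mul h4)
      simpa using hk
    rw [hf]
    exact h1.sub (h2.mul h5)
  have hcd : ContDiffAt ℂ ⊤ f 0 := hfa.contDiffAt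
  have hinv : (fderiv ℂ f 0 ∘L .inr ℂ (ℂ × ℂ) ℂ) = ContinuousLinearMap.id ℂ ℂ := by
    have h1 : HasFDerivAt (fun s : ℂ => f ((0 : ℂ × ℂ), s))
        (fderiv ℂ f 0 ∘L .inr ℂ (ℂ × ℂ) ℂ) 0 :=
      HasFDerivAt.comp (g := f) (0 : ℂ) hfa.differentiableAt.hasFDerivAt
        (ContinuousLinearMap.inr ℂ (ℂ × ℂ) ℂ).hasFDerivAt
    have h2 : (fun s : ℂ => f ((0 : ℂ × ℂ), s)) = fun s => s := by
      funext s
      simp [hf]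
    rw [h2] at h1
    exact h1.unique (hasFDerivAt_id 0)
  have hI : (fderiv ℂ f 0 ∘L .inr ℂ (ℂ × ℂ) ℂ).IsInvertible := by
    rw [hinv]
    exact ContinuousLinearMap.isInvertible_equiv (f := ContinuousLinearEquiv.refl ℂ ℂ)
  refine ⟨hcd.implicitFunction (by simp) hI, ?_, ?_, ?_⟩
  · exact (hcd.contDiffAt_implicitFunction (by simp) hI).analyticAt
  · exact hcd.implicitFunction_apply_self (by simp) hI
  · filter_upwards [hcd.eventually_apply_implicitFunction (by simp) hI] with x hx
    have h0 : f 0 = 0 := by simp [hf]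
    have h1 := (congrFun hf (x, hcd.implicitFunction (by simp) hI x)).symm.trans (hx.trans h0)
    exact sub_eq_zero.1 h1

/-- A germ at the origin which, up to a power of `l`, is a deck transformation of `φ`. -/
structure IsWord (φ : ℂ → ℂ) (l : ℂ) (B : ℕ) (F : ℂ → ℂ) : Prop where
  analyticAt : AnalyticAt ℂ F 0
  map_zero_ne : F 0 ≠ 0
  deriv_ne : deriv F 0 ≠ 0
  eventually_eq : ∀ᶠ s in nhds 0, φ (l ^ B * F s) = φ s

theorem IsWord.eventually_deriv {φ : ℂ → ℂ} {l : ℂ} {B : ℕ} {F : ℂ → ℂ} (h : IsWord φ l B F)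
    (hφ : Differentiable ℂ φ) :
    ∀ᶠ s in nhds 0, deriv φ (l ^ B * F s) * (l ^ B * deriv F s) = deriv φ s := by
  filter_upwards [h.eventually_eq.eventually_nhds, h.analyticAt.eventually_analyticAt] with s hs hFs
  have h1 : HasDerivAt (fun s => φ (l ^ B * F s)) (deriv φ (l ^ B * F s) * (l ^ B * deriv F s)) s :=
    (hφ _).hasDerivAt.comp s (hFs.differentiableAt.hasDerivAt.const_mul _)
  rw [← h1.deriv]
  exact Filter.EventuallyEq.deriv_eq hs

theorem IsLinearization.exists_periodic_family {P : ℂ[X]} {x₀ l : ℂ} {φ k F : ℂ → ℂ} {B : ℕ}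
    (h : IsLinearization P x₀ l φ) (hk : IsWord φ l 0 k) (hF : IsWord φ l B F) :
    ∃ r : ℝ, 0 < r ∧ ∃ V : ℂ × ℂ → ℂ,
      (∀ δ, ‖δ‖ < r → DifferentiableOn ℂ (fun x => V (x, δ)) (Metric.ball 0 r)) ∧
      (∀ x, ‖x‖ < r → Filter.Tendsto (fun δ => V (x, δ)) (nhds 0)
        (nhds ((deriv k 0 * deriv F (x * k 0))⁻¹))) ∧
      ∀ j b : ℕ, ‖l⁻¹ ^ j‖ < r → ‖l⁻¹ ^ b‖ < r → ∃ y,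
        (polyIter P (2 * j + b + B)).eval y = y ∧
        (derivative (polyIter P (2 * j + b + B))).eval y =
          l ^ (2 * j + b) * V (l⁻¹ ^ j, l⁻¹ ^ b) := by
  obtain ⟨S, hS, hS0, hSeq⟩ := exists_analytic_solution hk.analyticAt hF.analyticAt
  obtain ⟨T, hT⟩ : ∃ T : ℂ × ℂ → ℂ, T = fun x => x.1 * x.2 * F (S x) := ⟨_, rfl⟩
  have hTa : AnalyticAt ℂ T 0 := by
    rw [hT]
    refine (analyticAt_fst.mul analyticAt_snd).mul (AnalyticAt.fun_comp ?_ hS)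
    rw [hS0]
    exact hF.analyticAt
  have hT0 : T 0 = 0 := by simp [hT]
  obtain ⟨V, hV⟩ : ∃ V : ℂ × ℂ → ℂ, V = fun x => (deriv k (T x) * deriv F (S x))⁻¹ := ⟨_, rfl⟩
  have hVa : AnalyticAt ℂ V 0 := by
    rw [hV]
    refine AnalyticAt.inv ((AnalyticAt.fun_comp ?_ hTa).mul (AnalyticAt.fun_comp ?_ hS)) ?_
    · rw [hT0]; exact hk.analyticAt.deriv
    · rw [hS0]; exact hF.analyticAt.deriv
    · rw [hT0, hS0]; exact mul_ne_zero hk.deriv_ne hF.deriv_ne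
  have hφne : ∀ᶠ s in nhds (0 : ℂ), deriv φ s ≠ 0 :=
    ((h.diff.contDiff (n := 2)).differentiable_deriv_two.continuous.continuousAt).eventually_ne
      (by rw [h.deriv_zero]; simp)
  have hSt : Filter.Tendsto S (nhds 0) (nhds 0) := by
    simpa [hS0] using hS.continuousAt.tendsto
  have hTt : Filter.Tendsto T (nhds 0) (nhds 0) := by
    simpa [hT0] using hTa.continuousAt.tendsto
  have hkne := hk.analyticAt.deriv.continuousAt.eventually_ne hk.deriv_ne
  have hFne := hF.analyticAt.deriv.continuousAt.eventually_ne hF.deriv_ne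
  have hall := hVa.eventually_analyticAt.and <| hSeq.and <|
    (hSt.eventually (hF.eventually_eq.and ((hF.eventually_deriv h.diff).and (hφne.and hFne)))).and
    (hTt.eventually (hk.eventually_eq.and ((hk.eventually_deriv h.diff).and (hφne.and hkne))))
  obtain ⟨r, hr, hball⟩ := Metric.eventually_nhds_iff.1 hall
  have hball' : ∀ x δ : ℂ, ‖x‖ < r → ‖δ‖ < r → dist ((x, δ) : ℂ × ℂ) 0 < r := by
    intro x δ hx hδ
    rw [dist_zero_right, Prod.norm_mk]
    exact max_lt hx hδ
  refine ⟨r, hr, V, ?_, ?_, ?_⟩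
  · intro δ hδ x hx
    have h1 : AnalyticAt ℂ V (x, δ) := (hball (hball' x δ (by simpa using hx) hδ)).1
    exact (h1.fun_comp (f := fun x => (x, δ)) (analyticAt_id.prod
      analyticAt_const)).differentiableAt.differentiableWithinAt
  · intro x hx
    have h0 := hball (hball' x 0 hx (by simpa using hr))
    have h1 : ContinuousAt (fun δ : ℂ => V (x, δ)) 0 :=
      ContinuousAt.comp (g := V) (f := fun δ => (x, δ)) h0.1.continuousAt (by fun_prop)
    have h2 : V (x, 0) = (deriv k 0 * deriv F (x * k 0))⁻¹ := by
      have h3 : T (x, 0) = 0 := by simp [hT]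
      have h4 : S (x, 0) = x * k 0 := by
        have := h0.2.1
        simpa using this
      rw [hV]
      simp only [h3, h4]
    rw [← h2]
    exact h1.tendsto
  · intro j b hj hb
    obtain ⟨-, hs, ⟨e1, e2, e3, e4⟩, e5, e6, e7, e8⟩ := hball (hball' _ _ hj hb)
    obtain ⟨s, hsd⟩ : ∃ s, s = S (l⁻¹ ^ j, l⁻¹ ^ b) := ⟨_, rfl⟩
    obtain ⟨s', hsd'⟩ : ∃ s', s' = T (l⁻¹ ^ j, l⁻¹ ^ b) := ⟨_, rfl⟩
    have hs' : s' = l⁻¹ ^ j * l⁻¹ ^ b * F s := by rw [hsd', hT, hsd]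
    have hVe : V (l⁻¹ ^ j, l⁻¹ ^ b) = (deriv k s' * deriv F s)⁻¹ := by rw [hV, hsd, hsd']
    rw [← hsd] at e1 e2 e3 e4
    rw [← hsd'] at e5 e6 e7 e8
    simp only [← hsd, ← hs'] at hs
    have hl := h.ne_zero
    have f1 : l ^ j * s = k s' := by
      rw [hs, ← mul_assoc, ← mul_pow, mul_inv_cancel₀ hl]
      simp
    have f2 : l ^ (j + b + B) * s' = l ^ B * F s := by
      rw [hs', pow_add, pow_add, inv_pow, inv_pow]
      field_simp
    simp only [pow_zero, one_mul] at e5 e6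
    have g1 : (polyIter P j).eval (φ s) = φ s' := by rw [← h.map_pow, f1, e5]
    have g2 : (polyIter P (j + b + B)).eval (φ s') = φ s := by rw [← h.map_pow, f2, e1]
    have d1 := h.deriv_map_pow j s
    have d2 := h.deriv_map_pow (j + b + B) s'
    rw [f1] at d1
    rw [f2] at d2
    have hn : 2 * j + b + B = (j + b + B) + j := by ring
    refine ⟨φ s, ?_, ?_⟩
    · rw [hn, polyIter_add, eval_comp, g1, g2]
    · rw [hn, polyIter_add, derivative_comp, eval_mul, eval_comp, g1, hVe]
      have hlB : l ^ B ≠ 0 := pow_ne_zero _ hl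
      have hx1 : (derivative (polyIter P j)).eval (φ s) =
          l ^ j * deriv φ s' / (deriv k s' * deriv φ s) := by
        rw [eq_div_iff (mul_ne_zero e8 e3), ← e6]
        linear_combination (- deriv k s') * d1
      have hx2 : (derivative (polyIter P (j + b + B))).eval (φ s') =
          l ^ (j + b) * deriv φ s / (deriv F s * deriv φ s') := by
        rw [eq_div_iff (mul_ne_zero e4 e7), ← e2]
        rw [pow_add l (j + b) B] at d2
        linear_combination (- deriv F s) * d2
      rw [hx1, hx2]
      field_simp
      ring

theorem exists_pos_forall_le {ι : Type*} [Finite ι] (r : ι → ℝ) (hr : ∀ i, 0 < r i) :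
    ∃ ρ : ℝ, 0 < ρ ∧ ∀ i, ρ ≤ r i := by
  have h1 : ∀ᶠ ρ in nhdsWithin (0 : ℝ) (Set.Ioi 0), ∀ i, ρ ≤ r i :=
    Filter.eventually_all.2 fun i =>
      ((eventually_le_nhds (hr i)).filter_mono nhdsWithin_le_nhds)
  obtain ⟨ρ, h2, h3⟩ := (h1.and self_mem_nhdsWithin).exists
  exact ⟨ρ, h3, h2⟩

theorem IsLinearization.tendsto_inv_pow {P : ℂ[X]} {x₀ l : ℂ} {φ : ℂ → ℂ}
    (h : IsLinearization P x₀ l φ) :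
    Filter.Tendsto (fun n : ℕ => l⁻¹ ^ n) Filter.atTop (nhds 0) :=
  tendsto_pow_atTop_nhds_zero_of_norm_lt_one (by
    rw [norm_inv]
    exact inv_lt_one_of_one_lt₀ h.one_lt)

theorem IsLinearization.eventually_norm_inv_pow_lt {P : ℂ[X]} {x₀ l : ℂ} {φ : ℂ → ℂ}
    (h : IsLinearization P x₀ l φ) {r : ℝ} (hr : 0 < r) :
    ∀ᶠ n : ℕ in Filter.atTop, ‖l⁻¹ ^ n‖ < r := by
  have := h.tendsto_inv_pow.norm
  rw [norm_zero] at this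
  exact this.eventually_lt_const hr

theorem IsLinearization.exists_dependence (K : Subfield ℂ) [FiniteDimensional ℚ K] {P : ℂ[X]}
    {x₀ l : ℂ} {φ k : ℂ → ℂ} (h : IsLinearization P x₀ l φ) (hP : P.Monic)
    (hd : 2 ≤ P.natDegree) (hm : MultipliersIn K P) (hk : IsWord φ l 0 k) :
    ∃ M, ∀ (F : Fin M → ℂ → ℂ) (B : Fin M → ℕ), (∀ i, IsWord φ l (B i) (F i)) →
      ∃ c : Fin M → ℂ, c ≠ 0 ∧ ∀ᶠ s in nhds 0, ∑ i, c i * (deriv (F i) s)⁻¹ = 0 := by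
  obtain ⟨L, H, hL, hH, hbound⟩ := exists_height_bound K P hP hd
  obtain ⟨M, hM⟩ := exists_linear_relation K h.one_lt (pow_ne_zero 2 h.ne_zero)
    (pow_pos hL 3) (one_le_pow₀ hH (n := 3))
  refine ⟨M, fun F B hF => ?_⟩
  choose ρ hρ V hVd hVt hVp using fun i => h.exists_periodic_family hk (hF i)
  obtain ⟨r, hr, hrρ⟩ := exists_pos_forall_le ρ hρ
  have hl := h.ne_zero
  have hrel : ∀ b : ℕ, ‖l⁻¹ ^ b‖ < r → ∃ c : Fin M → ℂ, ‖c‖ = 1 ∧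
      ∀ z ∈ Metric.ball (0 : ℂ) r, ∑ i, c i * V i (z, l⁻¹ ^ b) = 0 := by
    intro b hb
    obtain ⟨m₀, hm₀⟩ : ∃ m₀ : ℕ, ∀ j, m₀ ≤ j → ‖l⁻¹ ^ j‖ < r ∧ ∀ i, b + B i ≤ j :=
      Filter.eventually_atTop.1 ((h.eventually_norm_inv_pow_lt hr).and
        (Filter.eventually_all.2 fun i => Filter.eventually_ge_atTop (b + B i)))
    have hμ : ∀ i j, ∃ μ : K, m₀ ≤ j →
        IsIntegral ℤ (((L ^ 3 : ℕ) : K) ^ j * μ) ∧ (∀ σ : K →+* ℂ, ‖σ μ‖ ≤ (H ^ 3) ^ j) ∧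
          (μ : ℂ) = (l ^ 2) ^ j * (l ^ b * V i (l⁻¹ ^ j, l⁻¹ ^ b)) := by
      intro i j
      by_cases hj : m₀ ≤ j
      · obtain ⟨hj1, hj2⟩ := hm₀ j hj
        obtain ⟨y, hy1, hy2⟩ := hVp i j b (hj1.trans_le (hrρ i)) (hb.trans_le (hrρ i))
        by_cases hn : 0 < 2 * j + b + B i
        · refine ⟨⟨_, hm _ hn y hy1⟩, fun _ => ?_⟩
          obtain ⟨h1, h2⟩ := hbound _ y ⟨_, hm _ hn y hy1⟩ hn hy1 rfl
          have hle : 2 * j + b + B i ≤ 3 * j := by have := hj2 i; omega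
          obtain ⟨e, he⟩ := Nat.exists_eq_add_of_le hle
          refine ⟨?_, fun σ => (h2 σ).trans ?_, ?_⟩
          · have h3 : IsIntegral ℤ ((L : K) ^ e) := by
              have := isIntegral_algebraMap (R := ℤ) (A := K) (x := (L : ℤ) ^ e)
              simpa using this
            have h4 := h3.mul h1
            rw [← mul_assoc, ← pow_add] at h4
            push_cast
            rw [← pow_mul, he, add_comm _ e]
            exact h4
          · rw [← pow_mul]
            exact pow_le_pow_right₀ hH hle
          · exact hy2.trans (by ring)
        · have hj0 : j = 0 := by omega
          have hb0 : b = 0 := by omega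
          have hB0 : B i = 0 := by omega
          subst hj0 hb0
          rw [hB0] at hy2
          refine ⟨1, fun _ => ⟨by simpa using isIntegral_one, by simp, ?_⟩⟩
          simpa [polyIter] using hy2
      · exact ⟨0, fun h => absurd h hj⟩
    choose μ hμ using hμ
    obtain ⟨c, hc0, hc⟩ := hM r (fun i z => l ^ b * V i (z, l⁻¹ ^ b)) μ m₀ hr
      (fun i => ((hVd i _ (hb.trans_le (hrρ i))).mono
        (Metric.ball_subset_ball (hrρ i))).const_mul _) fun i j hj => hμ i j hj
    have hcn : ‖c‖ ≠ 0 := norm_ne_zero_iff.2 hc0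
    refine ⟨((‖c‖ : ℂ)⁻¹) • c, ?_, fun z hz => ?_⟩
    · rw [norm_smul, norm_inv, Complex.norm_real, norm_norm, inv_mul_cancel₀ hcn]
    · have h1 := hc z hz
      have h2 : l ^ b * ∑ i, c i * V i (z, l⁻¹ ^ b) = 0 := by
        rw [← h1, Finset.mul_sum]
        exact Finset.sum_congr rfl fun i _ => by ring
      have h3 := (mul_eq_zero.1 h2).resolve_left (pow_ne_zero _ hl)
      simp only [Pi.smul_apply, smul_eq_mul, mul_assoc]
      rw [← Finset.mul_sum, h3, mul_zero]
  obtain ⟨b₀, hb₀⟩ := Filter.eventually_atTop.1 (h.eventually_norm_inv_pow_lt hr)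
  choose c hc1 hc using fun n : ℕ => hrel (b₀ + n) (hb₀ _ (by omega))
  obtain ⟨c', hc', ψ, hψ, hlim⟩ := (isCompact_sphere (0 : Fin M → ℂ) 1).tendsto_subseq
    (x := c) (fun n => by simpa using hc1 n)
  refine ⟨c', ?_, ?_⟩
  · rintro rfl
    simp at hc'
  have hk0 := hk.map_zero_ne
  have hlimz : ∀ z, ‖z‖ < r → ∑ i, c' i * (deriv k 0 * deriv (F i) (z * k 0))⁻¹ = 0 := by
    intro z hz
    have hb : Filter.Tendsto (fun n => l⁻¹ ^ (b₀ + ψ n)) Filter.atTop (nhds 0) :=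
      h.tendsto_inv_pow.comp (Filter.tendsto_atTop_mono (fun n => by omega) hψ.tendsto_atTop)
    have h1 : Filter.Tendsto (fun n => ∑ i, c (ψ n) i * V i (z, l⁻¹ ^ (b₀ + ψ n))) Filter.atTop
        (nhds (∑ i, c' i * (deriv k 0 * deriv (F i) (z * k 0))⁻¹)) :=
      tendsto_finsetSum _ fun i _ => (((continuous_apply i).tendsto c').comp hlim).mul
        ((hVt i z (hz.trans_le (hrρ i))).comp hb)
    refine tendsto_nhds_unique h1 (tendsto_const_nhds.congr fun n => ?_)
    exact (hc (ψ n) z (by simpa using hz)).symm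
  have hs : ∀ᶠ s in nhds (0 : ℂ), ‖s / k 0‖ < r := by
    have : ContinuousAt (fun s : ℂ => ‖s / k 0‖) 0 := by fun_prop
    refine this.eventually_lt_const ?_
    simpa using hr
  filter_upwards [hs] with s hs
  have h1 := hlimz _ hs
  rw [div_mul_cancel₀ _ hk0] at h1
  have h2 : (deriv k 0)⁻¹ * ∑ i, c' i * (deriv (F i) s)⁻¹ = 0 := by
    rw [Finset.mul_sum]
    refine Eq.trans (Finset.sum_congr rfl fun i _ => ?_) h1
    rw [mul_inv]
    ring
  exact (mul_eq_zero.1 h2).resolve_left (inv_ne_zero hk.deriv_ne)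

theorem iteratedDeriv_comp_mul_left_field (n : ℕ) (c : ℂ) (f : ℂ → ℂ) (x : ℂ) :
    iteratedDeriv n (fun x => f (c * x)) x = c ^ n * iteratedDeriv n f (c * x) := by
  induction n generalizing x with
  | zero => simp
  | succ n ih =>
    rw [iteratedDeriv_succ, funext ih, deriv_const_mul_field, deriv_comp_mul_left,
      iteratedDeriv_succ, smul_eq_mul, pow_succ, mul_assoc]

theorem exists_polynomial_of_finite_taylor {g : ℂ → ℂ} (hg : AnalyticAt ℂ g 0)
    (hfin : {n | iteratedDeriv n g 0 ≠ 0}.Finite) : ∃ q : ℂ[X], ∀ᶠ s in nhds 0, g s = q.eval s := by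
  obtain ⟨r, hr, hball⟩ := hg.exists_ball_analyticOnNhd
  refine ⟨∑ n ∈ hfin.toFinset, C ((n.factorial : ℂ)⁻¹ * iteratedDeriv n g 0) * X ^ n, ?_⟩
  filter_upwards [Metric.ball_mem_nhds 0 hr] with s hs
  rw [← Complex.taylorSeries_eq_on_ball' hs hball.differentiableOn,
    tsum_eq_sum (s := hfin.toFinset)]
  · simp [eval_finsetSum]
  · intro n hn
    have : iteratedDeriv n g 0 = 0 := by simpa using hn
    simp [this]

theorem exists_polynomial_of_dependence {g : ℂ → ℂ} (hg : AnalyticAt ℂ g 0) {δ t₀ : ℂ}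
    (hδ0 : δ ≠ 0) (hδ : ‖δ‖ < 1) {M : ℕ}
    (h : ∀ᶠ b : ℕ in Filter.atTop, ∃ c : Fin M → ℂ, c ≠ 0 ∧
      ∀ᶠ x in nhds t₀, ∑ i, c i * g (δ ^ (b + (i : ℕ)) * x) = 0) :
    ∃ q : ℂ[X], ∀ᶠ s in nhds 0, g s = q.eval s := by
  obtain ⟨r, hr, hball⟩ := hg.exists_ball_analyticOnNhd
  have hlim : Filter.Tendsto (fun n : ℕ => δ ^ n * t₀) Filter.atTop (nhds 0) := by
    simpa using (tendsto_pow_atTop_nhds_zero_of_norm_lt_one hδ).mul_const t₀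
  obtain ⟨b, ⟨c, hc0, hc⟩, hb⟩ :=
    (h.and (hlim.eventually (Metric.ball_mem_nhds (0 : ℂ) hr))).exists
  have hδb : δ ^ b ≠ 0 := pow_ne_zero _ hδ0
  have hmaps : ∀ i : ℕ, ∀ y ∈ Metric.ball (0 : ℂ) r, δ ^ i * y ∈ Metric.ball (0 : ℂ) r := by
    intro i y hy
    rw [mem_ball_zero_iff] at hy ⊢
    rw [norm_mul, norm_pow]
    exact (mul_le_of_le_one_left (norm_nonneg y) (pow_le_one₀ (norm_nonneg _) hδ.le)).trans_lt hy
  have hGi : ∀ i : Fin M, AnalyticOnNhd ℂ (fun y => c i * g (δ ^ (i : ℕ) * y))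
      (Metric.ball 0 r) := by
    intro i y hy
    refine analyticAt_const.mul (AnalyticAt.fun_comp (hball _ (hmaps i y hy)) ?_)
    exact analyticAt_const.mul analyticAt_id
  have hG : AnalyticOnNhd ℂ (fun y => ∑ i : Fin M, c i * g (δ ^ (i : ℕ) * y))
      (Metric.ball 0 r) :=
    fun y hy => Finset.analyticAt_fun_sum _ fun i _ => hGi i y hy
  have hev : (fun y => ∑ i : Fin M, c i * g (δ ^ (i : ℕ) * y)) =ᶠ[nhds (δ ^ b * t₀)] 0 := by
    have h1 : Filter.Tendsto (fun y => y / δ ^ b) (nhds (δ ^ b * t₀)) (nhds t₀) := by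
      have : ContinuousAt (fun y => y / δ ^ b) (δ ^ b * t₀) := by fun_prop
      have h2 := this.tendsto
      rwa [mul_div_cancel_left₀ _ hδb] at h2
    filter_upwards [h1.eventually hc] with y hy
    rw [Pi.zero_apply, ← hy]
    refine Finset.sum_congr rfl fun i _ => ?_
    congr 2
    rw [pow_add]
    field_simp
  have hzero := hG.eqOn_zero_of_preconnected_of_eventuallyEq_zero
    (convex_ball (0 : ℂ) r).isPreconnected hb hev
  have hcoef : ∀ n, (∑ i : Fin M, (δ ^ n) ^ (i : ℕ) * c i) * iteratedDeriv n g 0 = 0 := by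
    intro n
    have h1 : iteratedDeriv n (fun y => ∑ i : Fin M, c i * g (δ ^ (i : ℕ) * y)) 0 = 0 := by
      have h2 : (fun y => ∑ i : Fin M, c i * g (δ ^ (i : ℕ) * y)) =ᶠ[nhds 0] fun _ => (0 : ℂ) := by
        filter_upwards [Metric.ball_mem_nhds (0 : ℂ) hr] with y hy
        exact hzero hy
      have h3 := (h2.iteratedDeriv n).eq_of_nhds
      rw [h3]
      simp
    rw [iteratedDeriv_fun_sum fun i _ => (hGi i 0 (Metric.mem_ball_self hr)).contDiffAt] at h1
    rw [Finset.sum_mul]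
    refine Eq.trans (Finset.sum_congr rfl fun i _ => ?_) h1
    rw [iteratedDeriv_const_mul_field, iteratedDeriv_comp_mul_left_field, mul_zero, ← pow_mul,
      ← pow_mul, mul_comm n]
    ring
  refine exists_polynomial_of_finite_taylor hg ?_
  by_contra hinf
  obtain ⟨S, hSsub, hScard⟩ := Set.Infinite.exists_subset_card_eq hinf M
  let e := S.equivFinOfCardEq hScard
  refine hc0 (Matrix.eq_zero_of_forall_index_sum_pow_mul_eq_zero
    (f := fun j => δ ^ ((e.symm j : S) : ℕ)) ?_ fun j => ?_)
  · intro j j' hjj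
    have h1 : ‖δ‖ ^ ((e.symm j : S) : ℕ) = ‖δ‖ ^ ((e.symm j' : S) : ℕ) := by
      rw [← norm_pow, ← norm_pow]
      exact congrArg norm hjj
    have h2 := pow_right_injective₀ (norm_pos_iff.2 hδ0) hδ.ne h1
    exact e.symm.injective (Subtype.ext h2)
  · exact (mul_eq_zero.1 (hcoef _)).resolve_right (hSsub (e.symm j).2)

theorem IsWord.eventually_isWord_comp {P : ℂ[X]} {x₀ l : ℂ} {φ k F : ℂ → ℂ} {B : ℕ}
    (h : IsLinearization P x₀ l φ) (hk : IsWord φ l 0 k) (hF : IsWord φ l B F) :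
    ∀ᶠ b : ℕ in Filter.atTop, IsWord φ l (B + b) (fun s => F (l⁻¹ ^ b * k s)) ∧
      ∀ᶠ s in nhds 0, deriv (fun s => F (l⁻¹ ^ b * k s)) s =
        deriv F (l⁻¹ ^ b * k s) * (l⁻¹ ^ b * deriv k s) := by
  have hlim : Filter.Tendsto (fun n : ℕ => l⁻¹ ^ n * k 0) Filter.atTop (nhds 0) := by
    simpa using h.tendsto_inv_pow.mul_const (k 0)
  have hev := hF.analyticAt.eventually_analyticAt.and <|
    (hF.analyticAt.continuousAt.eventually_ne hF.map_zero_ne).and <|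
    (hF.analyticAt.deriv.continuousAt.eventually_ne hF.deriv_ne).and <|
    hF.eventually_eq.eventually_nhds
  filter_upwards [hlim.eventually hev] with b hb
  obtain ⟨h1, h2, h3, h4⟩ := hb
  have hka : AnalyticAt ℂ (fun s => l⁻¹ ^ b * k s) 0 := analyticAt_const.mul hk.analyticAt
  have hder : ∀ᶠ s in nhds 0, deriv (fun s => F (l⁻¹ ^ b * k s)) s =
        deriv F (l⁻¹ ^ b * k s) * (l⁻¹ ^ b * deriv k s) := by
    filter_upwards [hk.analyticAt.eventually_analyticAt,
      hka.continuousAt.eventually h1.eventually_analyticAt] with s hs1 hs2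
    exact (hs2.differentiableAt.hasDerivAt.comp s
      (hs1.differentiableAt.hasDerivAt.const_mul _)).deriv
  have hl := h.ne_zero
  refine ⟨⟨AnalyticAt.fun_comp h1 hka, h2, ?_, ?_⟩, hder⟩
  · rw [hder.self_of_nhds]
    exact mul_ne_zero h3 (mul_ne_zero (pow_ne_zero _ (inv_ne_zero hl)) hk.deriv_ne)
  · filter_upwards [hka.continuousAt.eventually h4, hk.eventually_eq] with s hs1 hs2
    rw [add_comm, pow_add, mul_assoc, h.map_pow, hs1, ← h.map_pow, ← mul_assoc, ← mul_pow,
      mul_inv_cancel₀ hl, one_pow, one_mul]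
    simpa using hs2

/-- The reciprocal of the derivative of a word is a polynomial. -/
theorem IsWord.exists_polynomial (K : Subfield ℂ) [FiniteDimensional ℚ K] {P : ℂ[X]} {x₀ l : ℂ}
    {φ k F : ℂ → ℂ} {B : ℕ} (h : IsLinearization P x₀ l φ) (hP : P.Monic)
    (hd : 2 ≤ P.natDegree) (hm : MultipliersIn K P) (hk : IsWord φ l 0 k)
    (hF : IsWord φ l B F) : ∃ q : ℂ[X], ∀ᶠ s in nhds 0, (deriv F s)⁻¹ = q.eval s := by
  obtain ⟨M, hM⟩ := h.exists_dependence K hP hd hm hk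
  have hl := h.ne_zero
  refine exists_polynomial_of_dependence (hF.analyticAt.deriv.fun_inv hF.deriv_ne)
    (inv_ne_zero hl) (by rw [norm_inv]; exact inv_lt_one_of_one_lt₀ h.one_lt) (t₀ := k 0)
    (M := M) ?_
  obtain ⟨b₀, hb₀⟩ := Filter.eventually_atTop.1 (IsWord.eventually_isWord_comp h hk hF)
  filter_upwards [Filter.eventually_ge_atTop b₀] with b hb
  obtain ⟨c, hc0, hc⟩ := hM (fun i s => F (l⁻¹ ^ (b + (i : ℕ)) * k s)) (fun i => B + (b + i))
    fun i => (hb₀ (b + i) (by omega)).1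
  refine ⟨fun i => c i * (l⁻¹ ^ (b + (i : ℕ)))⁻¹, ?_, ?_⟩
  · contrapose! hc0
    funext i
    have := congrFun hc0 i
    have hne : (l⁻¹ ^ (b + (i : ℕ)))⁻¹ ≠ 0 := inv_ne_zero (pow_ne_zero _ (inv_ne_zero hl))
    exact (mul_eq_zero.1 this).resolve_right hne
  · have hmap : Filter.map k (nhds 0) = nhds (k 0) :=
      (hk.analyticAt.hasStrictDerivAt).map_nhds_eq hk.deriv_ne
    rw [← hmap, Filter.eventually_map]
    filter_upwards [hc, Filter.eventually_all.2 fun i : Fin M => (hb₀ (b + i) (by omega)).2,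
      hk.analyticAt.deriv.continuousAt.eventually_ne hk.deriv_ne] with s hs1 hs2 hs3
    have h1 : (deriv k s)⁻¹ * ∑ i : Fin M, c i * (l⁻¹ ^ (b + (i : ℕ)))⁻¹ *
        (deriv F (l⁻¹ ^ (b + (i : ℕ)) * k s))⁻¹ = 0 := by
      rw [Finset.mul_sum]
      refine Eq.trans (Finset.sum_congr rfl fun i _ => ?_) hs1
      rw [hs2 i, mul_inv, mul_inv]
      ring
    exact (mul_eq_zero.1 h1).resolve_left (inv_ne_zero hs3)

theorem Polynomial.eq_of_eventually_eval_eq {p q : ℂ[X]} {a : ℂ}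
    (h : ∀ᶠ s in nhds a, p.eval s = q.eval s) : p = q :=
  eq_of_infinite_eval_eq p q (infinite_of_mem_nhds a h)

/-- A nonconstant entire function invariant under a rational map forces the latter to be a
polynomial. -/
theorem eval_ne_zero_of_invariant {φ : ℂ → ℂ} (hφ : Differentiable ℂ φ) (hne : ∃ z, φ z ≠ φ 0)
    {A B : ℂ[X]} (hAB : IsCoprime A B) (hB : B.eval 0 ≠ 0)
    (h : ∀ᶠ s in nhds 0, φ (A.eval s / B.eval s) = φ s) (β : ℂ) : B.eval β ≠ 0 := by
  intro hβ
  have hB0 : B ≠ 0 := by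
    rintro rfl
    simp at hB
  have hA : A.eval β ≠ 0 := by
    intro hA
    obtain ⟨u, v, huv⟩ := hAB
    have := congrArg (eval β) huv
    simp [hA, hβ] at this
  have hglob : ∀ s, B.eval s ≠ 0 → φ (A.eval s / B.eval s) = φ s := by
    have hconn : IsPreconnected (↑B.roots.toFinset : Set ℂ)ᶜ :=
      (Set.Countable.isPathConnected_compl_of_one_lt_rank (by simp)
        (Finset.countable_toSet _)).isConnected.isPreconnected
    have hmem : ∀ s, s ∈ (↑B.roots.toFinset : Set ℂ)ᶜ ↔ B.eval s ≠ 0 := by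
      intro s
      simp [hB0]
    have h1 : AnalyticOnNhd ℂ (fun s => φ (A.eval s / B.eval s)) (↑B.roots.toFinset : Set ℂ)ᶜ := by
      intro s hs
      exact AnalyticAt.fun_comp (hφ.analyticAt _)
        ((A.differentiable.analyticAt s).div (B.differentiable.analyticAt s) ((hmem s).1 hs))
    have h2 : AnalyticOnNhd ℂ φ (↑B.roots.toFinset : Set ℂ)ᶜ := fun s _ => hφ.analyticAt s
    intro s hs
    exact h1.eqOn_of_preconnected_of_eventuallyEq h2 hconn ((hmem 0).2 hB) h ((hmem s).2 hs)
  have hψ : AnalyticAt ℂ (fun s => B.eval s / A.eval s) β :=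
    (B.differentiable.analyticAt β).div (A.differentiable.analyticAt β) hA
  have hAne : ∀ᶠ s in nhds β, A.eval s ≠ 0 := A.continuous.continuousAt.eventually_ne hA
  rcases hψ.eventually_constant_or_nhds_le_map_nhds with hc | hc
  · refine hB0 (Polynomial.eq_of_eventually_eval_eq (a := β) ?_)
    filter_upwards [hc, hAne] with s hs1 hs2
    rw [hβ, zero_div, div_eq_zero_iff] at hs1
    simpa using hs1.resolve_right hs2
  · rw [hβ, zero_div] at hc
    have hmem : (fun s => B.eval s / A.eval s) '' (Metric.closedBall β 1 ∩ {s | A.eval s ≠ 0}) ∈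
        nhds (0 : ℂ) :=
      hc (Filter.image_mem_map (Filter.inter_mem (Metric.closedBall_mem_nhds β one_pos) hAne))
    obtain ⟨ε, hε, hball⟩ := Metric.mem_nhds_iff.1 hmem
    obtain ⟨M₁, hM₁⟩ := (isCompact_closedBall β 1).exists_bound_of_continuousOn
      hφ.continuous.continuousOn
    obtain ⟨M₂, hM₂⟩ := (isCompact_closedBall (0 : ℂ) ε⁻¹).exists_bound_of_continuousOn
      hφ.continuous.continuousOn
    obtain ⟨z, hz⟩ := hne
    refine hz (hφ.apply_eq_apply_of_bounded ?_ z 0)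
    refine (Metric.isBounded_closedBall (x := (0 : ℂ)) (r := max M₁ M₂)).subset ?_
    rintro _ ⟨w, rfl⟩
    rw [mem_closedBall_zero_iff]
    by_cases hw : ‖w‖ ≤ ε⁻¹
    · exact (hM₂ w (by simpa using hw)).trans (le_max_right _ _)
    · push Not at hw
      have hw0 : 0 < ‖w‖ := (inv_pos.2 hε).trans hw
      have hw1 : w⁻¹ ∈ Metric.ball (0 : ℂ) ε := by
        rw [mem_ball_zero_iff, norm_inv]
        exact inv_lt_of_inv_lt₀ hε hw
      obtain ⟨s, ⟨hs1, hs2⟩, hs3⟩ := hball hw1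
      have hs3' : B.eval s / A.eval s = w⁻¹ := hs3
      have hBs : B.eval s ≠ 0 := by
        intro h0
        rw [h0, zero_div] at hs3'
        exact (inv_ne_zero (norm_pos_iff.1 hw0)) hs3'.symm
      have hws : w = A.eval s / B.eval s := by rw [← inv_inv w, ← hs3', inv_div]
      rw [hws, hglob s hBs]
      exact (hM₁ s hs1).trans (le_max_left _ _)

theorem IsLinearization.exists_ne {P : ℂ[X]} {x₀ l : ℂ} {φ : ℂ → ℂ}
    (h : IsLinearization P x₀ l φ) : ∃ z, φ z ≠ φ 0 := by
  by_contra! hc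
  have h1 := h.deriv_zero
  rw [show φ = fun _ => φ 0 from funext hc] at h1
  simp at h1

/-- Eliminating all but the leading coefficient of `g` by evaluating along a geometric
progression. -/
theorem exists_polynomial_pow_mul {k : ℂ → ℂ} {g : ℂ[X]} (hg : g ≠ 0) {δ : ℂ}
    (hδ0 : δ ≠ 0) (hδ : ‖δ‖ < 1)
    (H : ∀ᶠ b : ℕ in Filter.atTop, ∃ q : ℂ[X], ∀ᶠ s in nhds 0,
      g.eval (δ ^ b * k s) * g.eval s = q.eval s) :
    ∃ q : ℂ[X], ∀ᶠ s in nhds 0, k s ^ g.natDegree * g.eval s = q.eval s := by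
  obtain ⟨b, hb⟩ := Filter.eventually_atTop.1 H
  choose q hq using fun i : ℕ => hb (b + i) (by omega)
  obtain ⟨W, hW⟩ : ∃ W : ℂ[X], W = ∏ j ∈ Finset.range g.natDegree, (X - C (δ ^ j)) := ⟨_, rfl⟩
  have hWz : ∀ j < g.natDegree, W.eval (δ ^ j) = 0 := by
    intro j hj
    rw [hW, eval_prod]
    exact Finset.prod_eq_zero (Finset.mem_range.2 hj) (by simp)
  have hWne : W.eval (δ ^ g.natDegree) ≠ 0 := by
    rw [hW, eval_prod, Finset.prod_ne_zero_iff]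
    intro j hj
    simp only [eval_sub, eval_X, eval_C]
    rw [sub_ne_zero]
    intro heq
    have h1 : ‖δ‖ ^ g.natDegree = ‖δ‖ ^ j := by rw [← norm_pow, ← norm_pow, heq]
    have h2 := pow_right_injective₀ (norm_pos_iff.2 hδ0) hδ.ne h1
    exact (Finset.mem_range.1 hj).ne' h2
  obtain ⟨u, hu⟩ : ∃ u, u = g.leadingCoeff * (δ ^ b) ^ g.natDegree * W.eval (δ ^ g.natDegree) :=
    ⟨_, rfl⟩
  have hu0 : u ≠ 0 := by
    rw [hu]
    exact mul_ne_zero (mul_ne_zero (leadingCoeff_ne_zero.2 hg)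
      (pow_ne_zero _ (pow_ne_zero _ hδ0))) hWne
  refine ⟨C u⁻¹ * ∑ i ∈ Finset.range (W.natDegree + 1), C (W.coeff i) * q i, ?_⟩
  filter_upwards [(Finset.eventually_all (Finset.range (W.natDegree + 1))).2 fun i _ => hq i]
    with s hs
  have key : ∑ i ∈ Finset.range (W.natDegree + 1),
      W.coeff i * g.eval (δ ^ (b + i) * k s) = u * k s ^ g.natDegree := by
    have h1 : ∀ i, W.coeff i * g.eval (δ ^ (b + i) * k s) =
        ∑ j ∈ Finset.range (g.natDegree + 1),
          g.coeff j * (δ ^ b) ^ j * k s ^ j * (W.coeff i * (δ ^ j) ^ i) := by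
      intro i
      rw [eval_eq_sum_range, Finset.mul_sum]
      refine Finset.sum_congr rfl fun j _ => ?_
      rw [mul_pow, pow_add, mul_pow, pow_right_comm δ i j]
      ring
    rw [Finset.sum_congr rfl fun i _ => h1 i, Finset.sum_comm]
    have h2 : ∀ j, ∑ i ∈ Finset.range (W.natDegree + 1),
        g.coeff j * (δ ^ b) ^ j * k s ^ j * (W.coeff i * (δ ^ j) ^ i) =
        g.coeff j * (δ ^ b) ^ j * k s ^ j * W.eval (δ ^ j) := by
      intro j
      rw [← Finset.mul_sum, eval_eq_sum_range]
    rw [Finset.sum_congr rfl fun j _ => h2 j, Finset.sum_range_succ, Finset.sum_eq_zero, zero_add,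
      hu, leadingCoeff]
    · ring
    · intro j hj
      rw [hWz j (Finset.mem_range.1 hj), mul_zero]
  rw [eval_mul, eval_C, eval_finsetSum, eq_inv_mul_iff_mul_eq₀ hu0, ← mul_assoc, ← key,
    Finset.sum_mul]
  refine Finset.sum_congr rfl fun i hi => ?_
  rw [eval_mul, eval_C, ← hs i hi, mul_assoc]

theorem exists_isCoprime_factor (A : ℂ[X]) {B : ℂ[X]} (hB : B ≠ 0) :
    ∃ A' B' G : ℂ[X], IsCoprime A' B' ∧ A = G * A' ∧ B = G * B' := by
  let _ := EuclideanDomain.gcdMonoid ℂ[X]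
  have hg : GCDMonoid.gcd A B ≠ 0 := gcd_ne_zero_of_right hB
  exact ⟨A / GCDMonoid.gcd A B, B / GCDMonoid.gcd A B, GCDMonoid.gcd A B,
    isCoprime_div_gcd_div_gcd hB,
    (EuclideanDomain.mul_div_cancel' hg (GCDMonoid.gcd_dvd_left _ _)).symm,
    (EuclideanDomain.mul_div_cancel' hg (GCDMonoid.gcd_dvd_right _ _)).symm⟩

theorem IsWord.natDegree_eq_zero (K : Subfield ℂ) [FiniteDimensional ℚ K] {P : ℂ[X]} {x₀ l : ℂ}
    {φ k : ℂ → ℂ} (h : IsLinearization P x₀ l φ) (hP : P.Monic)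
    (hd : 2 ≤ P.natDegree) (hm : MultipliersIn K P) (hk : IsWord φ l 0 k) {g : ℂ[X]}
    (hg : ∀ᶠ s in nhds 0, (deriv k s)⁻¹ = g.eval s) : g.natDegree = 0 := by
  by_contra hE
  have hl := h.ne_zero
  have hlinv : ‖l⁻¹‖ < 1 := by rw [norm_inv]; exact inv_lt_one_of_one_lt₀ h.one_lt
  have hg0 : g.eval 0 ≠ 0 := by
    rw [← hg.self_of_nhds]
    exact inv_ne_zero hk.deriv_ne
  have hgne : g ≠ 0 := by
    rintro rfl
    simp at hg0
  have hlim : Filter.Tendsto (fun n : ℕ => l⁻¹ ^ n * k 0) Filter.atTop (nhds 0) := by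
    simpa using h.tendsto_inv_pow.mul_const (k 0)
  obtain ⟨f, hf⟩ := exists_polynomial_pow_mul (k := k) hgne (inv_ne_zero hl) hlinv (by
    filter_upwards [IsWord.eventually_isWord_comp h hk hk, hlim.eventually hg.eventually_nhds]
      with b hb1 hb2
    obtain ⟨q, hq⟩ := IsWord.exists_polynomial K h hP hd hm hk hb1.1
    refine ⟨C (l⁻¹ ^ b) * q, ?_⟩
    have hka : ContinuousAt (fun s => l⁻¹ ^ b * k s) 0 :=
      continuousAt_const.mul hk.analyticAt.continuousAt
    filter_upwards [hq, hg, hka.eventually hb2, hb1.2] with s h1 h2 h3 h4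
    rw [eval_mul, eval_C, ← h1, h4, ← h2, ← h3, mul_inv, mul_inv]
    have : l⁻¹ ^ b ≠ 0 := pow_ne_zero _ (inv_ne_zero hl)
    field_simp)
  have hkd : ∀ᶠ s in nhds 0, deriv k s * g.eval s = 1 := by
    filter_upwards [hg, hk.analyticAt.deriv.continuousAt.eventually_ne hk.deriv_ne] with s h1 h2
    rw [← h1, mul_inv_cancel₀ h2]
  have hf0 : f.eval 0 ≠ 0 := by
    rw [← hf.self_of_nhds]
    exact mul_ne_zero (pow_ne_zero _ hk.map_zero_ne) hg0
  have hrat : ∀ᶠ s in nhds 0,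
      k s * (derivative f * g - f * derivative g).eval s = (C (g.natDegree : ℂ) * f).eval s := by
    filter_upwards [hf.eventually_nhds, hkd, hk.analyticAt.eventually_analyticAt] with s h1 h2 h3
    have e1 : HasDerivAt (fun s => k s ^ g.natDegree * g.eval s)
        (g.natDegree * k s ^ (g.natDegree - 1) * deriv k s * g.eval s +
          k s ^ g.natDegree * (derivative g).eval s) s :=
      (h3.differentiableAt.hasDerivAt.pow g.natDegree).mul (g.hasDerivAt s)
    have e2 := e1.deriv
    rw [Filter.EventuallyEq.deriv_eq h1, Polynomial.deriv] at e2
    have e3 := h1.self_of_nhds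
    have e4 : k s ^ g.natDegree = k s * k s ^ (g.natDegree - 1) :=
      (mul_pow_sub_one hE (k s)).symm
    simp only [eval_sub, eval_mul, eval_C]
    rw [e2, ← e3, e4]
    linear_combination (g.natDegree * k s * k s ^ (g.natDegree - 1) * g.eval s) * h2
  obtain ⟨N, hN⟩ : ∃ N, N = derivative f * g - f * derivative g := ⟨_, rfl⟩
  obtain ⟨A₀, hA₀⟩ : ∃ A₀, A₀ = C (g.natDegree : ℂ) * f := ⟨_, rfl⟩
  rw [← hN, ← hA₀] at hrat
  have hA₀0 : A₀.eval 0 ≠ 0 := by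
    rw [hA₀, eval_mul, eval_C]
    exact mul_ne_zero (Nat.cast_ne_zero.2 hE) hf0
  have hN0 : N.eval 0 ≠ 0 := by
    intro h0
    have := hrat.self_of_nhds
    rw [h0, mul_zero] at this
    exact hA₀0 this.symm
  have hNne : N ≠ 0 := by
    rintro rfl
    simp at hN0
  obtain ⟨A, B, G, hAB, hA, hB⟩ := exists_isCoprime_factor A₀ hNne
  have hG0 : G.eval 0 ≠ 0 := by
    intro h0
    rw [hB, eval_mul, h0, zero_mul] at hN0
    exact hN0 rfl
  have hB0 : B.eval 0 ≠ 0 := by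
    intro h0
    rw [hB, eval_mul, h0, mul_zero] at hN0
    exact hN0 rfl
  have hkB : ∀ᶠ s in nhds 0, k s * B.eval s = A.eval s := by
    filter_upwards [hrat, G.continuous.continuousAt.eventually_ne hG0] with s h1 h2
    rw [hA, hB, eval_mul, eval_mul] at h1
    refine mul_left_cancel₀ h2 ?_
    linear_combination h1
  have hroot : ∀ β, B.eval β ≠ 0 := by
    refine eval_ne_zero_of_invariant h.diff h.exists_ne hAB hB0 ?_
    filter_upwards [hkB, B.continuous.continuousAt.eventually_ne hB0, hk.eventually_eq]
      with s h1 h2 h3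
    rw [← h1, mul_div_cancel_right₀ _ h2]
    simpa using h3
  obtain ⟨β, hβ⟩ : ∃ β, B = C β := by
    refine ⟨B.coeff 0, eq_C_of_degree_le_zero ?_⟩
    by_contra! hdeg
    obtain ⟨z, hz⟩ := IsAlgClosed.exists_root B hdeg.ne'
    exact hroot z hz
  subst hβ
  rw [eval_C] at hB0
  have hpoly : derivative A * g = C β := by
    refine Polynomial.eq_of_eventually_eval_eq (a := 0) ?_
    filter_upwards [hkB.eventually_nhds, hkd, hk.analyticAt.eventually_analyticAt] with s h1 h2 h3
    have e1 : deriv (fun s => k s * β) s = (derivative A).eval s := by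
      rw [← Polynomial.deriv]
      refine Filter.EventuallyEq.deriv_eq ?_
      filter_upwards [h1] with y hy
      simpa using hy
    rw [(h3.differentiableAt.hasDerivAt.mul_const β).deriv] at e1
    rw [eval_mul, eval_C, ← e1]
    linear_combination β * h2
  have hunit : IsUnit g := isUnit_of_mul_isUnit_right (x := derivative A)
    (by rw [hpoly]; exact isUnit_C.2 hB0.isUnit)
  exact hE (natDegree_eq_zero_of_isUnit hunit)

theorem IsWord.exists_affine (K : Subfield ℂ) [FiniteDimensional ℚ K] {P : ℂ[X]} {x₀ l : ℂ}
    {φ k : ℂ → ℂ} (h : IsLinearization P x₀ l φ) (hP : P.Monic)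
    (hd : 2 ≤ P.natDegree) (hm : MultipliersIn K P) (hk : IsWord φ l 0 k) :
    ∃ α, α ≠ 0 ∧ ∀ s, φ (α * s + k 0) = φ s := by
  obtain ⟨g, hg⟩ := IsWord.exists_polynomial K h hP hd hm hk hk
  have hdeg := IsWord.natDegree_eq_zero K h hP hd hm hk hg
  obtain ⟨γ, rfl⟩ : ∃ γ, g = C γ := ⟨_, eq_C_of_natDegree_eq_zero hdeg⟩
  have hder : ∀ᶠ s in nhds 0, deriv k s = deriv k 0 := by
    have h0 := hg.self_of_nhds
    filter_upwards [hg] with s hs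
    rw [eval_C] at hs h0
    rw [← inv_inv (deriv k s), hs, ← h0, inv_inv]
  have haff : ∀ᶠ s in nhds 0, k s = deriv k 0 * s + k 0 := by
    obtain ⟨r, hr, hball⟩ := Metric.eventually_nhds_iff_ball.1
      (hder.and hk.analyticAt.eventually_analyticAt)
    filter_upwards [Metric.ball_mem_nhds (0 : ℂ) hr] with s hs
    have hc := (convex_ball (0 : ℂ) r).is_const_of_fderivWithin_eq_zero (𝕜 := ℂ)
      (f := fun s => k s - deriv k 0 * s) (x := s) (y := 0)
      (fun y hy => ((hball y hy).2.differentiableAt.sub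
        (differentiableAt_id.const_mul _)).differentiableWithinAt) (fun y hy => by
        have e1 : HasDerivAt (fun s => k s - deriv k 0 * s) 0 y := by
          have := (hball y hy).2.differentiableAt.hasDerivAt.sub
            ((hasDerivAt_id y).const_mul (deriv k 0))
          rw [(hball y hy).1, mul_one, sub_self] at this
          exact this
        rw [fderivWithin_of_isOpen Metric.isOpen_ball hy, e1.hasFDerivAt.fderiv]
        ext
        simp) hs (Metric.mem_ball_self hr)
    simp only [mul_zero, sub_zero] at hc
    linear_combination hc
  refine ⟨deriv k 0, hk.deriv_ne, fun s => ?_⟩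
  have h1 : AnalyticOnNhd ℂ (fun s => φ (deriv k 0 * s + k 0)) Set.univ := fun s _ =>
    AnalyticAt.fun_comp (h.diff.analyticAt _)
      ((analyticAt_const.mul analyticAt_id).add analyticAt_const)
  have h2 : AnalyticOnNhd ℂ φ Set.univ := fun s _ => h.diff.analyticAt s
  refine congrFun (h1.eq_of_eventuallyEq (z₀ := 0) h2 ?_) s
  filter_upwards [haff, hk.eventually_eq] with y h3 h4
  rw [← h3]
  simpa using h4

/-- Every preimage of the fixed point gives an affine symmetry of the linearization. -/
theorem IsLinearization.exists_affine (K : Subfield ℂ) [FiniteDimensional ℚ K] {P : ℂ[X]}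
    {x₀ l : ℂ} {φ : ℂ → ℂ} (h : IsLinearization P x₀ l φ) (hP : P.Monic)
    (hd : 2 ≤ P.natDegree) (hm : MultipliersIn K P) {t : ℂ} (ht : φ t = x₀) :
    ∃ α, α ≠ 0 ∧ ∀ s, φ (α * s + t) = φ s := by
  rcases eq_or_ne t 0 with rfl | ht0
  · exact ⟨1, one_ne_zero, by simp⟩
  have hφt : AnalyticAt ℂ φ t := h.diff.analyticAt t
  have hne := h.deriv_ne t ht
  obtain ⟨ψ, hψ⟩ : ∃ ψ, ψ = hφt.hasStrictDerivAt.localInverse _ _ _ hne := ⟨_, rfl⟩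
  have hψa : AnalyticAt ℂ ψ x₀ := by
    rw [hψ, ← ht]
    exact hφt.analyticAt_localInverse hne
  have hψx : ψ x₀ = t := by
    rw [hψ, ← ht]
    exact HasStrictFDerivAt.localInverse_apply_image _
  have hψd : deriv ψ x₀ ≠ 0 := by
    have := hφt.hasStrictDerivAt.to_localInverse hne
    rw [← hψ, ht] at this
    rw [this.hasDerivAt.deriv]
    exact inv_ne_zero hne
  have hψe : ∀ᶠ x in nhds x₀, φ (ψ x) = x := by
    have := hφt.hasStrictDerivAt.eventually_right_inverse hne
    rwa [← hψ, ht] at this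
  have hφ0 := h.map_zero
  have hk : IsWord φ l 0 fun s => ψ (φ s) := by
    refine ⟨?_, ?_, ?_, ?_⟩
    · exact AnalyticAt.fun_comp (by rw [hφ0]; exact hψa) (h.diff.analyticAt 0)
    · rw [hφ0, hψx]
      exact ht0
    · have e1 : HasDerivAt ψ (deriv ψ x₀) (φ 0) := by
        rw [hφ0]
        exact hψa.differentiableAt.hasDerivAt
      have e2 := (e1.comp 0 (h.diff 0).hasDerivAt).deriv
      rw [show (fun s => ψ (φ s)) = ψ ∘ φ from rfl, e2, h.deriv_zero, mul_one]
      exact hψd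
    · have e1 : Filter.Tendsto φ (nhds 0) (nhds x₀) := by
        rw [← hφ0]
        exact h.diff.continuous.continuousAt
      filter_upwards [e1.eventually hψe] with s hs
      simpa using hs
  obtain ⟨α, hα, hs⟩ := IsWord.exists_affine K h hP hd hm hk
  rw [hφ0, hψx] at hs
  exact ⟨α, hα, hs⟩

/-- Two periods of a nonconstant entire function are linearly dependent over `ℝ`. -/
theorem im_div_eq_zero_of_periodic {f : ℂ → ℂ} (hf : Differentiable ℂ f) (hne : ∃ z, f z ≠ f 0)
    {u v : ℂ} (hu : Function.Periodic f u) (hv : Function.Periodic f v) (hu0 : u ≠ 0) :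
    (v / u).im = 0 := by
  by_contra him
  obtain ⟨M, hM⟩ := ((isCompact_closedBall (0 : ℂ) (‖u‖ + ‖v‖)).image
    hf.continuous).isBounded.exists_norm_le
  obtain ⟨z, hz⟩ := hne
  refine hz (hf.apply_eq_apply_of_bounded
    (isBounded_iff_forall_norm_le.2 ⟨M, ?_⟩) z 0)
  rintro _ ⟨s, rfl⟩
  obtain ⟨y, hy⟩ : ∃ y : ℝ, y = (s / u).im / (v / u).im := ⟨_, rfl⟩
  obtain ⟨x, hx⟩ : ∃ x : ℝ, x = (s / u).re - y * (v / u).re := ⟨_, rfl⟩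
  have hs : s = x * u + y * v := by
    have h1 : s / u = x + y * (v / u) := by
      apply Complex.ext
      · simp [hx]
      · simp only [Complex.add_im, Complex.ofReal_im, zero_add, Complex.mul_im, Complex.ofReal_re,
          zero_mul, add_zero]
        rw [hy, div_mul_cancel₀ _ him]
    have h2 : s = s / u * u := (div_mul_cancel₀ s hu0).symm
    rw [h2, h1, add_mul, mul_assoc, div_mul_cancel₀ _ hu0]
  have hred : f s = f (Int.fract x * u + Int.fract y * v) := by
    have h1 := (hu.int_mul ⌊x⌋).add_period (hv.int_mul ⌊y⌋)
    rw [← h1 (Int.fract x * u + Int.fract y * v), hs]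
    congr 1
    have e1 : (x : ℂ) = ⌊x⌋ + Int.fract x := by
      exact_mod_cast (Int.floor_add_fract x).symm
    have e2 : (y : ℂ) = ⌊y⌋ + Int.fract y := by
      exact_mod_cast (Int.floor_add_fract y).symm
    rw [e1, e2]
    ring
  rw [hred]
  refine hM _ ⟨_, ?_, rfl⟩
  rw [mem_closedBall_zero_iff]
  refine (norm_add_le _ _).trans ?_
  rw [norm_mul, norm_mul, Complex.norm_real, Complex.norm_real, Real.norm_of_nonneg
    (Int.fract_nonneg x), Real.norm_of_nonneg (Int.fract_nonneg y)]
  have h1 := (Int.fract_lt_one x).le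
  have h2 := (Int.fract_lt_one y).le
  gcongr
  · exact mul_le_of_le_one_left (norm_nonneg _) h1
  · exact mul_le_of_le_one_left (norm_nonneg _) h2

/-- The periods of a nonconstant entire function that is locally injective at the origin form a
cyclic group. -/
theorem exists_generator_of_periodic {f : ℂ → ℂ} (hf : Differentiable ℂ f)
    (hne : ∃ z, f z ≠ f 0) {r : ℝ} (hr : 0 < r) (hinj : ∀ t, f t = f 0 → ‖t‖ < r → t = 0)
    {τ : ℂ} (hτ0 : τ ≠ 0) (hτ : Function.Periodic f τ) :
    ∃ ω, ω ≠ 0 ∧ Function.Periodic f ω ∧ ∀ w, Function.Periodic f w → ∃ n : ℤ, w = n * ω := by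
  have hlow : ∀ w, Function.Periodic f w → w ≠ 0 → r ≤ ‖w‖ := by
    intro w hw hw0
    by_contra! hlt
    exact hw0 (hinj w (by simpa using hw 0) hlt)
  have hclosed : IsClosed {w : ℂ | Function.Periodic f w} := by
    simp only [Function.Periodic, Set.ofPred_forall]
    exact isClosed_iInter fun x =>
      isClosed_eq (hf.continuous.comp (continuous_const.add continuous_id))
      continuous_const
  have hcpt : IsCompact ({w : ℂ | Function.Periodic f w} ∩ {w | r ≤ ‖w‖} ∩
      Metric.closedBall 0 ‖τ‖) :=
    (isCompact_closedBall _ _).inter_left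
      (hclosed.inter (isClosed_le continuous_const continuous_norm))
  obtain ⟨ω, ⟨⟨hω, hωr⟩, hωτ⟩, hmin⟩ := hcpt.exists_isMinOn ⟨τ, ⟨hτ, hlow τ hτ hτ0⟩, by simp⟩
    continuous_norm.continuousOn
  have hω0 : ω ≠ 0 := norm_pos_iff.1 (hr.trans_le hωr)
  refine ⟨ω, hω0, hω, fun w hw => ?_⟩
  have him := im_div_eq_zero_of_periodic hf hne hω hw hω0
  obtain ⟨x, hx⟩ : ∃ x : ℝ, x = (w / ω).re := ⟨_, rfl⟩
  have hwx : w = x * ω := by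
    rw [← div_mul_cancel₀ w hω0]
    congr 1
    apply Complex.ext
    · simp [hx]
    · simpa [hω0] using him
  refine ⟨round x, ?_⟩
  by_contra hcon
  have hper : Function.Periodic f (w - round x * ω) := hw.sub_period (hω.int_mul _)
  have hnorm : ‖w - round x * ω‖ < ‖ω‖ := by
    rw [hwx, ← sub_mul, norm_mul]
    have : ‖(x : ℂ) - round x‖ = |x - round x| := by
      rw [← Real.norm_eq_abs, ← Complex.norm_real]
      push_cast
      rfl
    rw [this]
    have h1 := abs_sub_round x
    nlinarith [norm_pos_iff.2 hω0]
  have hmem : w - round x * ω ∈ {w : ℂ | Function.Periodic f w} ∩ {w | r ≤ ‖w‖} ∩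
      Metric.closedBall 0 ‖τ‖ := by
    refine ⟨⟨hper, hlow _ hper (sub_ne_zero.2 hcon)⟩, ?_⟩
    rw [mem_closedBall_zero_iff] at hωτ ⊢
    exact hnorm.le.trans hωτ
  exact absurd (hmin hmem) (not_le.2 hnorm)

namespace IsLinearization

variable {P : ℂ[X]} {x₀ l : ℂ} {φ : ℂ → ℂ}

theorem exists_isolated (h : IsLinearization P x₀ l φ) :
    ∃ r > 0, ∀ t, φ t = φ 0 → ‖t‖ < r → t = 0 := by
  have h1 : HasDerivAt φ (deriv φ 0) 0 := (h.diff 0).hasDerivAt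
  have h2 := h1.eventually_ne (by rw [h.deriv_zero]; exact one_ne_zero) (c := φ 0)
  obtain ⟨r, hr, hb⟩ := Metric.mem_nhdsWithin_iff.1 h2
  refine ⟨r, hr, fun t ht htr => ?_⟩
  by_contra ht0
  exact hb ⟨mem_ball_zero_iff.2 htr, ht0⟩ ht

theorem periodic_mul (h : IsLinearization P x₀ l φ) {w : ℂ} (hw : Function.Periodic φ w) :
    Function.Periodic φ (l * w) := fun s => by
  have e : s + l * w = l * (s / l + w) := by field_simp [h.ne_zero]
  rw [e, h.map_mul, hw, ← h.map_mul, mul_div_cancel₀ _ h.ne_zero]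

/-- If `φ` has an affine symmetry at each of its zeros, its zeros lie in two arithmetic
progressions of common difference `ω`, and the multiplier is an integer. -/
theorem exists_period (h : IsLinearization P x₀ l φ)
    (haff : ∀ t, φ t = x₀ → ∃ α, α ≠ 0 ∧ ∀ s, φ (α * s + t) = φ s)
    {t₀ : ℂ} (ht₀ : t₀ ≠ 0) (ht : φ t₀ = x₀) :
    ∃ (ω t₁ : ℂ) (a : ℤ), ω ≠ 0 ∧ Function.Periodic φ ω ∧ l = a ∧
      ∀ t, φ t = x₀ → ∃ n : ℤ, t = n * ω ∨ t = t₁ + n * ω := by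
  obtain ⟨r, hr, hinj⟩ := h.exists_isolated
  have hl1 : l ≠ 1 := by
    rintro rfl
    exact absurd h.one_lt (by simp)
  obtain ⟨α, hα, hs⟩ := haff t₀ ht
  have hτ : Function.Periodic φ ((l - 1) * t₀) := fun s => by
    have e1 : s + (l - 1) * t₀ = l * (α * ((s - t₀) / (α * l)) + t₀) := by
      have := h.ne_zero
      field_simp
      ring
    have e2 : α * (l * ((s - t₀) / (α * l))) + t₀ = s := by
      have := h.ne_zero
      field_simp
      ring
    rw [e1, h.map_mul, hs, ← h.map_mul, ← hs, e2]
  obtain ⟨ω, hω0, hω, hgen⟩ := exists_generator_of_periodic h.diff h.exists_ne hr hinj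
    (mul_ne_zero (sub_ne_zero.2 hl1) ht₀) hτ
  obtain ⟨a, ha⟩ := hgen _ (h.periodic_mul hω)
  have hsign : ∀ t β, β ≠ 0 → (∀ s, φ (β * s + t) = φ s) → β = 1 ∨ β = -1 := by
    intro t β hβ hβs
    have h1 : Function.Periodic φ (β * ω) := fun s => by
      have e1 : s + β * ω = β * ((s - t) / β + ω) + t := by
        field_simp
        ring
      have e2 : β * ((s - t) / β) + t = s := by
        field_simp
        ring
      rw [e1, hβs, hω, ← hβs, e2]
    have h2 : Function.Periodic φ (ω / β) := fun s => by
      rw [← hβs, ← hβs s, ← hω (β * s + t)]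
      congr 1
      field_simp
      ring
    obtain ⟨m, hm⟩ := hgen _ h1
    obtain ⟨n, hn⟩ := hgen _ h2
    have hm' : β = m := mul_right_cancel₀ hω0 hm
    have hn' : (1 : ℂ) = n * β := by
      refine mul_right_cancel₀ hω0 ?_
      rw [div_eq_iff hβ] at hn
      linear_combination hn
    rw [hm'] at hn'
    have hmn : n * m = 1 := by exact_mod_cast hn'.symm
    rcases Int.eq_one_or_neg_one_of_mul_eq_one' hmn with ⟨_, h4⟩ | ⟨_, h4⟩
    · left
      rw [hm', h4]
      simp
    · right
      rw [hm', h4]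
      simp
  have hzero : ∀ t, φ t = x₀ → (∃ n : ℤ, t = n * ω) ∨ ∀ s, φ (-s + t) = φ s := by
    intro t ht
    obtain ⟨β, hβ, hβs⟩ := haff t ht
    rcases hsign t β hβ hβs with rfl | rfl
    · left
      exact hgen t fun s => by simpa using hβs s
    · right
      simpa using hβs
  have hla : l = a := mul_right_cancel₀ hω0 ha
  by_cases hex : ∃ t₁, ∀ s, φ (-s + t₁) = φ s
  · obtain ⟨t₁, ht₁⟩ := hex
    refine ⟨ω, t₁, a, hω0, hω, hla, fun t ht => ?_⟩
    rcases hzero t ht with ⟨n, hn⟩ | h1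
    · exact ⟨n, Or.inl hn⟩
    · obtain ⟨n, hn⟩ := hgen (t - t₁) fun s => by
        rw [show s + (t - t₁) = -(t₁ - s) + t by ring, h1, ← ht₁]
        congr 1
        ring
      exact ⟨n, Or.inr (by rw [← hn]; ring)⟩
  · refine ⟨ω, 0, a, hω0, hω, hla, fun t ht => ?_⟩
    rcases hzero t ht with ⟨n, hn⟩ | h1
    · exact ⟨n, Or.inl hn⟩
    · exact absurd ⟨t, h1⟩ hex

end IsLinearization

namespace IsLinearization

variable {P : ℂ[X]} {x₀ l : ℂ} {φ : ℂ → ℂ}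

theorem exists_eq_of_iterate (h : IsLinearization P x₀ l φ) (hd : 2 ≤ P.natDegree)
    {n : ℕ} {y : ℂ} (hy : (polyIter P n).eval y = x₀) : ∃ s, φ s = y := by
  by_contra! hom
  obtain ⟨e, he⟩ := pow_unbounded_of_one_lt (P.natDegree : ℝ) h.one_lt
  obtain ⟨A, hA⟩ := h.exists_growth hd he.le
  obtain ⟨y', hy'⟩ : ∃ y', P.eval y' = y := by
    obtain ⟨y', hy'⟩ := IsAlgClosed.exists_root (P - C y) (by
      rw [degree_sub_C (natDegree_pos_iff_degree_pos.1 (by omega))]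
      exact (natDegree_pos_iff_degree_pos.1 (by omega)).ne')
    exact ⟨y', by simpa [sub_eq_zero] using hy'⟩
  have hyy : y' = y := by
    by_contra hne
    obtain ⟨s, hs⟩ := attains_of_omits h.diff hA hom h.exists_ne hne
    exact hom (l * s) (by rw [h.map_mul, hs, hy'])
  rw [hyy] at hy'
  have hfix : ∀ m, (polyIter P m).eval y = y := by
    intro m
    induction m with
    | zero => simp [polyIter]
    | succ m ih => rw [polyIter, eval_comp, hy', ih]
  exact hom 0 (by rw [h.map_zero, ← hy, hfix])

theorem card_roots_iterate (h : IsLinearization P x₀ l φ) (hd : 2 ≤ P.natDegree)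
    (n : ℕ) : (polyIter P n - C x₀).roots.toFinset.card = P.natDegree ^ n := by
  have hdeg : (polyIter P n - C x₀).natDegree = P.natDegree ^ n := by
    rw [natDegree_sub_C, natDegree_polyIter]
  have hne : polyIter P n - C x₀ ≠ 0 := by
    intro h0
    rw [h0, natDegree_zero] at hdeg
    have : 0 < P.natDegree ^ n := by positivity
    omega
  have hnodup : (polyIter P n - C x₀).roots.Nodup := by
    rw [Multiset.nodup_iff_count_le_one]
    intro y
    rw [count_roots]
    by_contra! hlt
    obtain ⟨h1, h2⟩ := (one_lt_rootMultiplicity_iff_isRoot hne).1 hlt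
    simp only [IsRoot.def, eval_sub, eval_C, sub_eq_zero, derivative_sub, derivative_C,
      sub_zero] at h1 h2
    obtain ⟨s, rfl⟩ := h.exists_eq_of_iterate hd h1
    have h3 := h.deriv_map_pow n s
    rw [h2, zero_mul] at h3
    refine mul_ne_zero (pow_ne_zero n h.ne_zero) (h.deriv_ne _ ?_) h3
    rw [h.map_pow, h1]
  rw [Multiset.toFinset_card_of_nodup hnodup, ← hdeg]
  exact (splits_iff_card_roots.1 (IsAlgClosed.splits _))

theorem natDegree_le_natAbs (h : IsLinearization P x₀ l φ)
    (hd : 2 ≤ P.natDegree) {ω t₁ : ℂ} {a : ℤ} (hω : Function.Periodic φ ω) (hla : l = a)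
    (hz : ∀ t, φ t = x₀ → ∃ n : ℤ, t = n * ω ∨ t = t₁ + n * ω) :
    P.natDegree ≤ a.natAbs := by
  have ha0 : a ≠ 0 := by
    rintro rfl
    exact h.ne_zero (by simp [hla])
  have hcount : ∀ n : ℕ, P.natDegree ^ n ≤ 2 * a.natAbs ^ n := by
    intro n
    rw [← h.card_roots_iterate hd n]
    have hln : l ^ n ≠ 0 := pow_ne_zero n h.ne_zero
    have hsub : (polyIter P n - C x₀).roots.toFinset ⊆
        (Finset.range (a.natAbs ^ n)).image (fun j : ℕ => φ (j * ω / l ^ n)) ∪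
        (Finset.range (a.natAbs ^ n)).image (fun j : ℕ => φ ((t₁ + j * ω) / l ^ n)) := by
      intro y hy
      have hy' : (polyIter P n).eval y = x₀ := by
        have := (mem_roots'.1 (Multiset.mem_toFinset.1 hy)).2
        simpa [sub_eq_zero] using this
      obtain ⟨s, rfl⟩ := h.exists_eq_of_iterate hd hy'
      rw [← h.map_pow] at hy'
      obtain ⟨k, hk⟩ := hz _ hy'
      have han : a ^ n ≠ 0 := pow_ne_zero n ha0
      obtain ⟨j, hj⟩ := Int.eq_ofNat_of_zero_le (Int.emod_nonneg k han)
      have hjlt : j < a.natAbs ^ n := by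
        have h1 := Int.emod_lt_abs k han
        rw [hj, abs_pow, Int.abs_eq_natAbs] at h1
        exact_mod_cast h1
      have hkj : (k : ℂ) = j + l ^ n * (k / a ^ n : ℤ) := by
        rw [hla]
        have h1 := Int.emod_add_mul_ediv k (a ^ n)
        rw [hj] at h1
        exact_mod_cast h1.symm
      have hper := hω.int_mul (k / a ^ n)
      rcases hk with hk | hk
      · refine Finset.mem_union_left _ (Finset.mem_image.2 ⟨j, Finset.mem_range.2 hjlt, ?_⟩)
        rw [← hper (j * ω / l ^ n)]
        congr 1
        refine mul_left_cancel₀ hln ?_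
        rw [hk, hkj, mul_add, mul_div_cancel₀ _ hln]
        ring
      · refine Finset.mem_union_right _ (Finset.mem_image.2 ⟨j, Finset.mem_range.2 hjlt, ?_⟩)
        rw [← hper ((t₁ + j * ω) / l ^ n)]
        congr 1
        refine mul_left_cancel₀ hln ?_
        rw [hk, hkj, mul_add, mul_div_cancel₀ _ hln]
        ring
    refine (Finset.card_le_card hsub).trans ((Finset.card_union_le _ _).trans ?_)
    rw [two_mul]
    exact add_le_add (Finset.card_image_le.trans (Finset.card_range _).le)
      (Finset.card_image_le.trans (Finset.card_range _).le)
  by_contra! hlt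
  have hapos : (0 : ℝ) < a.natAbs := by
    exact_mod_cast Int.natAbs_pos.2 ha0
  obtain ⟨n, hn⟩ := pow_unbounded_of_one_lt (2 : ℝ)
    (show 1 < (P.natDegree : ℝ) / a.natAbs by
      rw [one_lt_div hapos]
      exact_mod_cast hlt)
  rw [div_pow, lt_div_iff₀ (pow_pos hapos n)] at hn
  have h1 : ((P.natDegree : ℝ)) ^ n ≤ 2 * (a.natAbs : ℝ) ^ n := by exact_mod_cast hcount n
  linarith

end IsLinearization

theorem dickson_eval_add_div (t s : ℂ) (n : ℕ) :
    (dickson 1 (t * s) n).eval (t + s) = t ^ n + s ^ n := by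
  induction n using Nat.twoStepInduction with
  | zero => norm_num
  | one => simp
  | more n ih1 ih2 =>
    rw [dickson_add_two]
    simp only [eval_sub, eval_mul, eval_X, eval_C, ih1, ih2]
    ring

theorem dickson_one_zero {n : ℕ} (hn : n ≠ 0) : dickson 1 (0 : ℂ) n = X ^ n := by
  obtain ⟨m, rfl⟩ := Nat.exists_eq_succ_of_ne_zero hn
  refine Polynomial.funext fun x => ?_
  have := dickson_eval_add_div x 0 (m + 1)
  simpa using this

theorem exists_add_mul_eq (w c : ℂ) : ∃ t s : ℂ, t + s = w ∧ t * s = c := by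
  obtain ⟨t, ht⟩ := IsAlgClosed.exists_root (X ^ 2 - C w * X + C c) (by
    rw [show (X ^ 2 - C w * X + C c : ℂ[X]) = C 1 * X ^ 2 + C (-w) * X + C c by
      simp; ring, degree_quadratic one_ne_zero]
    norm_num)
  refine ⟨t, w - t, by ring, ?_⟩
  simp only [IsRoot.def, eval_add, eval_sub, eval_pow, eval_X, eval_mul, eval_C] at ht
  linear_combination -ht

/-- A polynomial agreeing with the Dickson polynomial on all `t + c / t` equals it. -/
theorem eq_dickson_of_eval {R : ℂ[X]} {c : ℂ} {n : ℕ}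
    (h : ∀ t s : ℂ, t ≠ 0 → t * s = c → R.eval (t + s) = t ^ n + s ^ n) : R = dickson 1 c n := by
  refine eq_of_infinite_eval_eq _ _ ?_
  refine (Set.infinite_univ (α := ℂ)).sdiff (Set.finite_singleton 0) |>.mono ?_
  rintro w ⟨-, hw⟩
  obtain ⟨t, s, rfl, rfl⟩ := exists_add_mul_eq w c
  rw [Set.mem_ofPred_eq]
  rcases eq_or_ne t 0 with rfl | ht
  · have hs : s ≠ 0 := by
      rintro rfl
      exact hw (by simp)
    have h1 := h s 0 hs (by ring)
    have h2 := dickson_eval_add_div s 0 n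
    rw [show s * 0 = 0 * s by ring] at h2
    rw [show (0 : ℂ) + s = s + 0 by ring, h1, h2]
  · rw [h t s ht rfl, dickson_eval_add_div]

theorem dickson_comp_dickson (c : ℂ) (m n : ℕ) :
    (dickson 1 (c ^ n) m).comp (dickson 1 c n) = dickson 1 c (n * m) := by
  refine eq_dickson_of_eval fun t s _ hts => ?_
  rw [eval_comp, ← hts, dickson_eval_add_div, mul_pow, dickson_eval_add_div, pow_mul, pow_mul]

theorem coeff_dickson_of_lt (c : ℂ) {n k : ℕ} (h : n < k) : (dickson 1 c n).coeff k = 0 := by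
  induction n using Nat.twoStepInduction generalizing k with
  | zero =>
    rw [dickson_zero, show (3 - (1 : ℕ) : ℂ[X]) = C 2 by rw [map_ofNat]; norm_num,
      coeff_C, if_neg (by omega)]
  | one => rw [dickson_one, coeff_X, if_neg (by omega)]
  | more n ih1 ih2 =>
    obtain ⟨k, rfl⟩ := Nat.exists_eq_succ_of_ne_zero (show k ≠ 0 by omega)
    rw [dickson_add_two, coeff_sub, coeff_X_mul, coeff_C_mul, ih1 (by omega), ih2 (by omega)]
    simp

theorem coeff_dickson_self (c : ℂ) (n : ℕ) : (dickson 1 c (n + 1)).coeff (n + 1) = 1 := by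
  induction n with
  | zero => simp
  | succ n ih =>
    rw [dickson_add_two, coeff_sub, coeff_X_mul, coeff_C_mul, ih,
      coeff_dickson_of_lt c (by omega)]
    simp

theorem coeff_dickson_pred (c : ℂ) (n : ℕ) : (dickson 1 c (n + 1)).coeff n = 0 := by
  induction n with
  | zero => simp
  | succ n ih =>
    rw [dickson_add_two, coeff_sub, coeff_X_mul, coeff_C_mul, ih,
      coeff_dickson_of_lt c (by omega)]
    simp

theorem coeff_dickson_add_two (c : ℂ) (n : ℕ) :
    (dickson 1 c (n + 2)).coeff n = -(n + 2) * c := by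
  induction n with
  | zero =>
    rw [dickson_two, show (3 - (1 : ℕ) : ℂ[X]) = C 2 by rw [map_ofNat]; norm_num]
    simp
    ring
  | succ n ih =>
    rw [dickson_add_two, coeff_sub, coeff_X_mul, coeff_C_mul, ih, coeff_dickson_self]
    push_cast
    ring

theorem natDegree_dickson (c : ℂ) (n : ℕ) : (dickson 1 c (n + 1)).natDegree = n + 1 :=
  natDegree_eq_of_le_of_coeff_ne_zero
    (natDegree_le_iff_coeff_eq_zero.2 fun _ h => coeff_dickson_of_lt c h)
    (by rw [coeff_dickson_self]; exact one_ne_zero)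

theorem monic_dickson (c : ℂ) (n : ℕ) : (dickson 1 c (n + 1)).Monic := by
  rw [Monic, leadingCoeff, natDegree_dickson, coeff_dickson_self]

/-- The polynomial form of the functional equation `P (L u) = L (u ^ (m + 2))` for the Laurent
polynomial `L u = G u / u ^ N`. -/
theorem expand_eq_of_eval {P G : ℂ[X]} {N m : ℕ} (hP : P.Monic) (hD : P.natDegree = m + 2)
    (hc : P.coeff (m + 1) = 0)
    (hE : ∀ u : ℂ, u ≠ 0 → P.eval (G.eval u / u ^ N) = G.eval (u ^ (m + 2)) / (u ^ (m + 2)) ^ N) :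
    expand ℂ (m + 2) G = G ^ (m + 2) +
      ∑ k ∈ Finset.range (m + 1), C (P.coeff k) * G ^ k * X ^ (N * (m + 2 - k)) := by
  refine eq_of_infinite_eval_eq _ _ ?_
  refine (Set.infinite_univ (α := ℂ)).sdiff (Set.finite_singleton 0) |>.mono ?_
  rintro u ⟨-, hu⟩
  have hu : u ≠ 0 := hu
  have h1 := hE u hu
  obtain ⟨v, hv⟩ : ∃ v, v = u ^ N := ⟨_, rfl⟩
  have hv0 : v ≠ 0 := hv ▸ pow_ne_zero N hu
  rw [pow_right_comm, ← hv, eq_div_iff (pow_ne_zero _ hv0), eval_eq_sum_range, hD,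
    Finset.sum_range_succ, Finset.sum_range_succ, hc, zero_mul, add_zero] at h1
  have hlead : P.coeff (m + 2) = 1 := by rw [← hD]; exact hP
  rw [Set.mem_ofPred_eq, expand_eval, ← h1, hlead, eval_add, eval_finsetSum, add_mul, add_comm,
    one_mul, div_pow, div_mul_cancel₀ _ (pow_ne_zero _ hv0), eval_pow, Finset.sum_mul]
  congr 1
  refine Finset.sum_congr rfl fun k hk => ?_
  have hk : k ≤ m + 2 := by
    have := Finset.mem_range.1 hk
    omega
  simp only [eval_mul, eval_C, eval_pow, eval_X]
  rw [pow_mul, ← hv, div_pow, mul_assoc, mul_assoc]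
  congr 1
  conv_lhs => rw [← Nat.add_sub_of_le hk, pow_add]
  field_simp

theorem coeff_eq_zero_of_expand {G R : ℂ[X]} {N m : ℕ} (hN : N < G.natDegree)
    (hR : R.natDegree ≤ m * G.natDegree + 2 * N)
    (hE : expand ℂ (m + 2) G = G ^ (m + 2) + R) :
    G.leadingCoeff ^ (m + 2) = G.leadingCoeff ∧
      ∀ i, i < G.natDegree → 2 * N < i + G.natDegree → G.coeff i = 0 := by
  obtain ⟨n, hn⟩ : ∃ n, n = G.natDegree := ⟨_, rfl⟩
  obtain ⟨α, hα⟩ : ∃ α, α = G.leadingCoeff := ⟨_, rfl⟩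
  rw [← hn] at hN hR ⊢
  rw [← hα]
  have hα0 : α ≠ 0 := by
    rw [hα, Ne, leadingCoeff_eq_zero]
    rintro rfl
    simp at hn
    omega
  have hpow : α ^ (m + 2) = α := by
    have h1 := congrArg (coeff · ((m + 2) * n)) hE
    simp only [coeff_add] at h1
    rw [coeff_expand_mul' (by omega), coeff_pow_of_natDegree_le hn.ge,
      coeff_eq_zero_of_natDegree_lt (p := R) (by nlinarith), add_zero] at h1
    rw [hα, leadingCoeff, ← hn]
    exact h1.symm
  refine ⟨hpow, fun i hin hi => ?_⟩
  by_contra hne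
  obtain ⟨G₁, hG₁⟩ : ∃ G₁, G₁ = G.eraseLead := ⟨_, rfl⟩
  have hG : G - C α * X ^ n = G₁ := by
    rw [hG₁, hα, hn, sub_eq_iff_eq_add, eraseLead_add_C_mul_X_pow]
  have hci : G₁.coeff i ≠ 0 := by
    rw [hG₁, eraseLead_coeff_of_ne _ (by omega)]
    exact hne
  have hG₁0 : G₁ ≠ 0 := by
    rintro h0
    rw [h0] at hci
    simp at hci
  obtain ⟨j, hj⟩ : ∃ j, j = G₁.natDegree := ⟨_, rfl⟩
  have hij : i ≤ j := hj ▸ le_natDegree_of_ne_zero hci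
  have hjn : j < n := by
    have := eraseLead_natDegree_le G
    rw [← hG₁, ← hj, ← hn] at this
    omega
  obtain ⟨S, hS⟩ : ∃ S, S = ∑ k ∈ Finset.range (m + 2), G ^ k * (C α * X ^ n) ^ (m + 2 - 1 - k) :=
    ⟨_, rfl⟩
  have hgeom : G₁ * S = G ^ (m + 2) - (C α * X ^ n) ^ (m + 2) := by
    rw [← hG, hS, (Commute.all _ _).mul_geom_sum₂]
  have hexp : expand ℂ (m + 2) G₁ = G₁ * S + R := by
    rw [hgeom, ← hG, map_sub, hE, map_mul, expand_C, map_pow, expand_X, mul_pow, ← C_pow, hpow,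
      pow_right_comm]
    ring
  have hmon : (C α * X ^ n : ℂ[X]).natDegree ≤ n := natDegree_C_mul_X_pow_le _ _
  have hterm : ∀ k ∈ Finset.range (m + 2),
      (G ^ k).natDegree ≤ k * n ∧ ((C α * X ^ n) ^ (m + 2 - 1 - k)).natDegree ≤ (m + 1 - k) * n ∧
      (m + 1) * n = k * n + (m + 1 - k) * n := by
    intro k hk
    have hk : k ≤ m + 1 := by
      have := Finset.mem_range.1 hk
      omega
    refine ⟨natDegree_pow_le_of_le k hn.ge, natDegree_pow_le_of_le _ hmon, ?_⟩
    rw [← add_mul, Nat.add_sub_of_le hk]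
  have hSdeg : S.natDegree ≤ (m + 1) * n := by
    rw [hS]
    refine natDegree_sum_le_of_forall_le _ _ fun k hk => ?_
    obtain ⟨h1, h2, h3⟩ := hterm k hk
    rw [h3]
    exact natDegree_mul_le_of_le h1 h2
  have hScoeff : S.coeff ((m + 1) * n) = (m + 2) * α ^ (m + 1) := by
    rw [hS, finsetSum_coeff]
    have : ∀ k ∈ Finset.range (m + 2),
        (G ^ k * (C α * X ^ n) ^ (m + 2 - 1 - k)).coeff ((m + 1) * n) = α ^ (m + 1) := by
      intro k hk
      obtain ⟨h1, h2, h3⟩ := hterm k hk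
      rw [h3, coeff_mul_add_eq_of_natDegree_le h1 h2, coeff_pow_of_natDegree_le hn.ge,
        show m + 2 - 1 - k = m + 1 - k by omega, coeff_pow_of_natDegree_le hmon, coeff_C_mul_X_pow,
        if_pos rfl, hn, ← leadingCoeff, ← hα, ← pow_add]
      congr 1
      have := Finset.mem_range.1 hk
      omega
    rw [Finset.sum_congr rfl this]
    simp
  have hco := congrArg (coeff · (j + (m + 1) * n)) hexp
  simp only [coeff_add] at hco
  rw [coeff_eq_zero_of_natDegree_lt (p := expand ℂ (m + 2) G₁)
    (by rw [natDegree_expand, ← hj]; nlinarith),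
    coeff_eq_zero_of_natDegree_lt (p := R) (by nlinarith), add_zero,
    coeff_mul_add_eq_of_natDegree_le hj.ge hSdeg, hScoeff] at hco
  refine mul_ne_zero ?_ (mul_ne_zero ?_ (pow_ne_zero _ hα0)) hco.symm
  · rw [hj]
    exact leadingCoeff_ne_zero.2 hG₁0
  · exact_mod_cast (show m + 2 ≠ 0 by omega)

theorem laurent_top {P G : ℂ[X]} {N m : ℕ} (hP : P.Monic) (hD : P.natDegree = m + 2)
    (hc : P.coeff (m + 1) = 0)
    (hE : ∀ u : ℂ, u ≠ 0 → P.eval (G.eval u / u ^ N) = G.eval (u ^ (m + 2)) / (u ^ (m + 2)) ^ N)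
    (hN : N < G.natDegree) :
    G.leadingCoeff ^ (m + 2) = G.leadingCoeff ∧
      ∀ i, i < G.natDegree → 2 * N < i + G.natDegree → G.coeff i = 0 := by
  refine coeff_eq_zero_of_expand hN ?_ (expand_eq_of_eval hP hD hc hE)
  refine natDegree_sum_le_of_forall_le _ _ fun k hk => ?_
  have hk := Finset.mem_range.1 hk
  obtain ⟨r, rfl⟩ : ∃ r, m = k + r := ⟨m - k, by omega⟩
  refine (natDegree_mul_le_of_le (natDegree_mul_le_of_le (natDegree_C _).le
    (natDegree_pow_le_of_le k le_rfl)) (natDegree_X_pow_le _)).trans ?_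
  rw [show k + r + 2 - k = r + 2 by omega]
  nlinarith

theorem eval_reflect_div_pow {G : ℂ[X]} {N : ℕ} (hG : G.natDegree ≤ 2 * N) {u : ℂ} (hu : u ≠ 0) :
    (reflect (2 * N) G).eval u / u ^ N = G.eval u⁻¹ / u⁻¹ ^ N := by
  let _ := invertibleOfNonzero (inv_ne_zero hu)
  have h1 := eval₂_reflect_mul_pow (RingHom.id ℂ) u⁻¹ (2 * N) G hG
  rw [invOf_eq_inv, inv_inv, eval₂_id, eval₂_id] at h1
  rw [← h1, two_mul, pow_add, inv_pow]
  field_simp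

theorem eval_reflect_div {P G : ℂ[X]} {N D : ℕ} (hG : G.natDegree ≤ 2 * N)
    (hE : ∀ u : ℂ, u ≠ 0 → P.eval (G.eval u / u ^ N) = G.eval (u ^ D) / (u ^ D) ^ N) (u : ℂ)
    (hu : u ≠ 0) : P.eval ((reflect (2 * N) G).eval u / u ^ N) =
      (reflect (2 * N) G).eval (u ^ D) / (u ^ D) ^ N := by
  rw [eval_reflect_div_pow hG hu, eval_reflect_div_pow hG (pow_ne_zero _ hu),
    hE _ (inv_ne_zero hu), inv_pow]

/-- A nonconstant Laurent polynomial `L` with `P (L u) = L (u ^ D)` for a centered monic `P` of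
degree `D` is of the form `α u ^ M + γ u ^ (-M)`. -/
theorem laurent_form_of_lt {P G : ℂ[X]} {N m : ℕ} (hP : P.Monic) (hD : P.natDegree = m + 2)
    (hc : P.coeff (m + 1) = 0)
    (hE : ∀ u : ℂ, u ≠ 0 → P.eval (G.eval u / u ^ N) = G.eval (u ^ (m + 2)) / (u ^ (m + 2)) ^ N)
    (hG : G.natDegree ≤ 2 * N) (hN : N < G.natDegree) :
    ∃ γ : ℂ, γ ^ (m + 2) = γ ∧ G.leadingCoeff ^ (m + 2) = G.leadingCoeff ∧
      ∀ u : ℂ, u ≠ 0 → G.eval u / u ^ N = G.leadingCoeff * u ^ (G.natDegree - N) +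
        γ / u ^ (G.natDegree - N) := by
  obtain ⟨hlead, hgap⟩ := laurent_top hP hD hc hE hN
  obtain ⟨n, hn⟩ : ∃ n, n = G.natDegree := ⟨_, rfl⟩
  rw [← hn] at hG hN hgap ⊢
  obtain ⟨M, hM⟩ : ∃ M, n = N + M := ⟨n - N, by omega⟩
  have hlow : ∀ i, i < n → G.coeff i ≠ 0 → i = N - M ∧ G.coeff i ^ (m + 2) = G.coeff i := by
    intro i hin hi
    have hle : i + n ≤ 2 * N := by
      by_contra! hlt
      exact hi (hgap i hin hlt)
    have hH : N < (reflect (2 * N) G).natDegree := by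
      refine lt_of_lt_of_le (show N < 2 * N - i by omega) (le_natDegree_of_ne_zero ?_)
      rw [coeff_reflect, revAt_le (by omega), show 2 * N - (2 * N - i) = i by omega]
      exact hi
    obtain ⟨hlead', hgap'⟩ := laurent_top hP hD hc (eval_reflect_div (hn ▸ hG) hE) hH
    obtain ⟨m', hm'⟩ : ∃ m', m' = (reflect (2 * N) G).natDegree := ⟨_, rfl⟩
    have hm'N : m' ≤ 2 * N := by
      rw [hm']
      refine natDegree_le_iff_coeff_eq_zero.2 fun k hk => ?_
      rw [coeff_reflect, revAt_eq_self_of_lt hk]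
      exact coeff_eq_zero_of_natDegree_lt (by omega)
    rw [← hm'] at hgap' hH
    have hle2 : 2 * N - i ≤ m' := by
      rw [hm']
      refine le_natDegree_of_ne_zero ?_
      rw [coeff_reflect, revAt_le (by omega), show 2 * N - (2 * N - i) = i by omega]
      exact hi
    have hcm : (reflect (2 * N) G).coeff (2 * N - n) ≠ 0 := by
      rw [coeff_reflect, revAt_le (by omega), show 2 * N - (2 * N - n) = n by omega, hn]
      refine leadingCoeff_ne_zero.2 ?_
      rintro rfl
      simp at hi
    have h3 : ¬ 2 * N < (2 * N - n) + m' := fun hlt => hcm (hgap' _ (by omega) hlt)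
    have him : 2 * N - m' = i := by omega
    rw [leadingCoeff, ← hm', coeff_reflect, revAt_le (by omega), him] at hlead'
    exact ⟨by omega, hlead'⟩
  have hGeq : G = C G.leadingCoeff * X ^ (N + M) + C (G.coeff (N - M)) * X ^ (N - M) := by
    ext i
    rw [coeff_add, coeff_C_mul_X_pow, coeff_C_mul_X_pow]
    rcases lt_trichotomy i n with hi | rfl | hi
    · rw [if_neg (by omega), zero_add]
      split_ifs with h1
      · rw [h1]
      · by_contra h2
        exact h1 (hlow i hi h2).1
    · rw [if_pos hM, if_neg (by omega), add_zero, hn]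
      rfl
    · rw [if_neg (by omega), if_neg (by omega), add_zero]
      exact coeff_eq_zero_of_natDegree_lt (by omega)
  refine ⟨G.coeff (N - M), ?_, hlead, fun u hu => ?_⟩
  · by_cases h0 : G.coeff (N - M) = 0
    · rw [h0, zero_pow (by omega)]
    · exact (hlow (N - M) (by omega) h0).2
  · obtain ⟨r, hr⟩ : ∃ r, N = r + M := ⟨N - M, by omega⟩
    have h1 := congrArg (eval u) hGeq
    simp only [eval_add, eval_mul, eval_C, eval_pow, eval_X] at h1
    rw [h1, hM, Nat.add_sub_cancel_left, show N - M = r by omega, hr, pow_add, pow_add]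
    field_simp

theorem laurent_form {P G : ℂ[X]} {N m : ℕ} (hP : P.Monic) (hD : P.natDegree = m + 2)
    (hc : P.coeff (m + 1) = 0)
    (hE : ∀ u : ℂ, u ≠ 0 → P.eval (G.eval u / u ^ N) = G.eval (u ^ (m + 2)) / (u ^ (m + 2)) ^ N)
    (hne : ∀ c : ℂ, ∃ u : ℂ, u ≠ 0 ∧ G.eval u / u ^ N ≠ c) :
    ∃ (M : ℕ) (α γ : ℂ), 0 < M ∧ α ^ (m + 2) = α ∧ γ ^ (m + 2) = γ ∧ (α ≠ 0 ∨ γ ≠ 0) ∧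
      ∀ u : ℂ, u ≠ 0 → G.eval u / u ^ N = α * u ^ M + γ / u ^ M := by
  wlog hG : G.natDegree ≤ 2 * N generalizing G N
  · have hL : ∀ u : ℂ, u ≠ 0 → (G * X ^ G.natDegree).eval u / u ^ (N + G.natDegree) =
        G.eval u / u ^ N := by
      intro u hu
      rw [eval_mul, eval_pow, eval_X, pow_add, mul_div_mul_right _ _ (pow_ne_zero _ hu)]
    obtain ⟨M, α, γ, h1, h2, h3, h4, h5⟩ := this (G := G * X ^ G.natDegree)
      (N := N + G.natDegree) (fun u hu => by
        rw [hL u hu, hL _ (pow_ne_zero _ hu), hE u hu]) (fun c => by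
        obtain ⟨u, hu, huc⟩ := hne c
        exact ⟨u, hu, by rwa [hL u hu]⟩) (by
        refine (natDegree_mul_le_of_le le_rfl (natDegree_X_pow_le _)).trans ?_
        omega)
    exact ⟨M, α, γ, h1, h2, h3, h4, fun u hu => by rw [← hL u hu, h5 u hu]⟩
  rcases lt_or_ge N G.natDegree with hlt | hge
  · obtain ⟨γ, h1, h2, h3⟩ := laurent_form_of_lt hP hD hc hE hG hlt
    refine ⟨_, _, γ, Nat.sub_pos_of_lt hlt, h2, h1, Or.inl (leadingCoeff_ne_zero.2 ?_), h3⟩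
    rintro rfl
    simp at hlt
  · have hlt : N < (reflect (2 * N) G).natDegree := by
      by_contra! hle
      have hz : ∀ i, i ≠ N → G.coeff i = 0 := by
        intro i hi
        rcases lt_or_gt_of_ne hi with h1 | h1
        · have := coeff_eq_zero_of_natDegree_lt (p := reflect (2 * N) G) (n := 2 * N - i) (by omega)
          rwa [coeff_reflect, revAt_le (by omega), show 2 * N - (2 * N - i) = i by omega] at this
        · exact coeff_eq_zero_of_natDegree_lt (by omega)
      have hGm : G = C (G.coeff N) * X ^ N := by
        ext i
        rw [coeff_C_mul_X_pow]
        split_ifs with h1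
        · rw [h1]
        · exact hz i h1
      obtain ⟨u, hu, huc⟩ := hne (G.coeff N)
      refine huc ?_
      have h1 := congrArg (eval u) hGm
      simp only [eval_mul, eval_C, eval_pow, eval_X] at h1
      rw [h1, mul_div_cancel_right₀ _ (pow_ne_zero _ hu)]
    obtain ⟨γ, h1, h2, h3⟩ := laurent_form_of_lt hP hD hc (eval_reflect_div hG hE)
      (natDegree_reflect_le.trans (by simp [hG])) hlt
    refine ⟨_, γ, _, Nat.sub_pos_of_lt hlt, h1, h2, Or.inr (leadingCoeff_ne_zero.2 ?_),
      fun u hu => ?_⟩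
    · intro h0
      rw [h0] at hlt
      simp at hlt
    · have h4 := h3 u⁻¹ (inv_ne_zero hu)
      rw [eval_reflect_div_pow hG (inv_ne_zero hu), inv_inv] at h4
      rw [h4, inv_pow]
      field_simp
      ring

theorem eq_dickson_of_laurent {P : ℂ[X]} {M D : ℕ} (hM : 0 < M) {α γ : ℂ}
    (hα : α ^ D = α) (hγ : γ ^ D = γ) (hne : α ≠ 0 ∨ γ ≠ 0)
    (h : ∀ u : ℂ, u ≠ 0 → P.eval (α * u ^ M + γ / u ^ M) =
      α * (u ^ D) ^ M + γ / (u ^ D) ^ M) : P = dickson 1 (α * γ) D := by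
  have key : ∀ α γ : ℂ, α ≠ 0 → α ^ D = α → γ ^ D = γ →
      (∀ u : ℂ, u ≠ 0 → P.eval (α * u ^ M + γ / u ^ M) =
      α * (u ^ D) ^ M + γ / (u ^ D) ^ M) → P = dickson 1 (α * γ) D := by
    intro α γ hα0 hα hγ h
    refine eq_dickson_of_eval fun t s ht hts => ?_
    obtain ⟨u, hu⟩ := IsAlgClosed.exists_pow_nat_eq (t / α) hM
    have hu0 : u ≠ 0 := by
      rintro rfl
      rw [zero_pow hM.ne'] at hu
      exact div_ne_zero ht hα0 hu.symm
    have e1 : t = α * u ^ M := by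
      rw [hu]
      field_simp
    have e2 : s = γ / u ^ M := by
      rw [eq_div_iff (pow_ne_zero _ hu0)]
      refine mul_left_cancel₀ hα0 ?_
      rw [← hts, e1]
      ring
    rw [e1, e2, h u hu0, mul_pow, div_pow, hα, hγ, pow_right_comm]
  rcases hne with h0 | h0
  · exact key α γ h0 hα hγ h
  · rw [mul_comm]
    refine key γ α h0 hγ hα fun u hu => ?_
    have := h u⁻¹ (inv_ne_zero hu)
    simp only [inv_pow, div_inv_eq_mul] at this
    rw [add_comm, div_eq_mul_inv, this]
    ring

/-- A polynomial semiconjugating two Dickson polynomials is itself a Dickson polynomial. -/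
theorem eq_dickson_of_semiconj {q : ℂ[X]} (hq : q.Monic) (hd : 0 < q.natDegree) {m : ℕ} {a b : ℂ}
    (ha : a ^ (m + 2) = a)
    (hcomm : q.comp (dickson 1 a (m + 2)) = (dickson 1 b (m + 2)).comp q) :
    q = dickson 1 a q.natDegree ∧ b = a ^ q.natDegree := by
  obtain ⟨d, hdd⟩ : ∃ d, d = q.natDegree := ⟨_, rfl⟩
  rw [← hdd] at hd ⊢
  obtain ⟨R, hR⟩ : ∃ R : ℂ[X], R = ∑ k ∈ Finset.range d, C (q.coeff k) * (X ^ 2 + C a) ^ k *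
    X ^ (d - k) := ⟨_, rfl⟩
  obtain ⟨G, hG⟩ : ∃ G : ℂ[X], G = (X ^ 2 + C a) ^ d + R := ⟨_, rfl⟩
  have hR0 : R.eval 0 = 0 := by
    rw [hR, eval_finsetSum]
    refine Finset.sum_eq_zero fun k hk => ?_
    have := Finset.mem_range.1 hk
    simp [zero_pow (show d - k ≠ 0 by omega)]
  have hRdeg : R.natDegree < 2 * d := by
    have : R.natDegree ≤ 2 * d - 1 := by
      rw [hR]
      refine natDegree_sum_le_of_forall_le _ _ fun k hk => ?_
      have := Finset.mem_range.1 hk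
      refine (natDegree_mul_le_of_le (natDegree_mul_le_of_le (natDegree_C _).le
        (natDegree_pow_le_of_le k (natDegree_X_pow_add_C (n := 2) (r := a)).le))
        (natDegree_X_pow_le _)).trans ?_
      omega
    omega
  have hlead : ((X ^ 2 + C a : ℂ[X]) ^ d).Monic := (monic_X_pow_add_C a two_ne_zero).pow d
  have hdeg1 : ((X ^ 2 + C a : ℂ[X]) ^ d).natDegree = 2 * d := by
    rw [natDegree_pow, natDegree_X_pow_add_C, mul_comm]
  have hlt : R.degree < ((X ^ 2 + C a : ℂ[X]) ^ d).degree := by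
    rw [degree_eq_natDegree hlead.ne_zero, hdeg1]
    exact (degree_le_natDegree).trans_lt (by exact_mod_cast hRdeg)
  have hGm : G.Monic := hG ▸ hlead.add_of_left hlt
  have hGdeg : G.natDegree = 2 * d := by
    rw [hG, natDegree_add_eq_left_of_degree_lt hlt, hdeg1]
  have hGe : ∀ u : ℂ, u ≠ 0 → G.eval u / u ^ d = q.eval (u + a / u) := by
    intro u hu
    rw [eval_eq_sum_range (p := q), ← hdd, Finset.sum_range_succ, hG, hR, eval_add,
      eval_finsetSum, add_div,
      add_comm, Finset.sum_div]
    have hqd : q.coeff d = 1 := by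
      rw [hdd]
      exact hq
    have e0 : u + a / u = (u ^ 2 + a) / u := by field_simp
    congr 1
    · refine Finset.sum_congr rfl fun k hk => ?_
      have hk := Finset.mem_range.1 hk
      simp only [eval_mul, eval_C, eval_pow, eval_add, eval_X]
      obtain ⟨r, rfl⟩ : ∃ r, d = k + r := ⟨d - k, by omega⟩
      rw [e0, div_pow, Nat.add_sub_cancel_left, pow_add]
      field_simp
    · rw [hqd, e0, div_pow]
      simp
  have hdick : ∀ u : ℂ, u ≠ 0 → (dickson 1 a (m + 2)).eval (u + a / u) =
      u ^ (m + 2) + a / u ^ (m + 2) := by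
    intro u hu
    have h1 := dickson_eval_add_div u (a / u) (m + 2)
    rwa [mul_div_cancel₀ _ hu, div_pow, ha] at h1
  have hE : ∀ u : ℂ, u ≠ 0 → (dickson 1 b (m + 2)).eval (G.eval u / u ^ d) =
      G.eval (u ^ (m + 2)) / (u ^ (m + 2)) ^ d := by
    intro u hu
    rw [hGe u hu, hGe _ (pow_ne_zero _ hu), ← hdick u hu, ← eval_comp, ← eval_comp, hcomm]
  obtain ⟨γ, hγ, -, hform⟩ := laurent_form_of_lt (monic_dickson b (m + 1))
    (natDegree_dickson b (m + 1)) (coeff_dickson_pred b (m + 1)) hE hGdeg.le (by omega)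
  rw [hGm, hGdeg, show 2 * d - d = d by omega] at hform
  have hGX : G = X ^ (2 * d) + C γ := by
    refine eq_of_infinite_eval_eq _ _ ?_
    refine (Set.infinite_univ (α := ℂ)).sdiff (Set.finite_singleton 0) |>.mono ?_
    rintro u ⟨-, hu⟩
    have hu : u ≠ 0 := hu
    have h1 := hform u hu
    rw [div_eq_iff (pow_ne_zero _ hu)] at h1
    rw [Set.mem_ofPred_eq, h1, eval_add, eval_pow, eval_X, eval_C, two_mul, pow_add]
    field_simp
  have hγa : γ = a ^ d := by
    have h1 := congrArg (eval 0) hGX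
    rw [hG] at h1
    simp only [eval_add, eval_pow, eval_X, eval_C, hR0] at h1
    rw [zero_pow (by omega), zero_pow (by omega)] at h1
    simpa using h1.symm
  constructor
  · refine eq_dickson_of_eval fun t s ht hts => ?_
    have hs : s = a / t := by
      rw [← hts]
      field_simp
    rw [hs, ← hGe t ht, hform t ht, hγa, div_pow, one_mul]
  · rw [← hγa]
    have h1 : dickson 1 b (m + 2) = dickson 1 (1 * γ) (m + 2) := by
      refine eq_dickson_of_laurent hd (by simp) hγ (Or.inl one_ne_zero) fun u hu => ?_
      rw [← hform u hu, ← hform _ (pow_ne_zero _ hu), hE u hu]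
    have h2 := congrArg (coeff · m) h1
    simp only [coeff_dickson_add_two, one_mul] at h2
    refine mul_left_cancel₀ ?_ h2
    rw [neg_ne_zero]
    exact_mod_cast (show m + 2 ≠ 0 by omega)

theorem exists_norm_le_exp_im {f : ℂ → ℂ} (hper : Function.Periodic f (1 : ℝ)) {A : ℝ}
    (h : ∀ s, ‖f s‖ ≤ Real.exp (A * (1 + ‖s‖))) (s : ℂ) :
    ‖f s‖ ≤ Real.exp (2 * |A| * (1 + |s.im|)) := by
  have h1 := hper.int_mul (-⌊s.re⌋) s
  obtain ⟨s', hs'⟩ : ∃ s' : ℂ, s' = s + (-⌊s.re⌋ : ℤ) * (1 : ℝ) := ⟨_, rfl⟩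
  rw [← hs'] at h1
  have hnorm : ‖s'‖ ≤ 1 + |s.im| := by
    refine (Complex.norm_le_abs_re_add_abs_im s').trans ?_
    have e1 : s'.re = Int.fract s.re := by
      rw [hs']
      simp [Int.fract, sub_eq_add_neg]
    have e2 : s'.im = s.im := by
      rw [hs']
      simp
    rw [e1, e2, abs_of_nonneg (Int.fract_nonneg _)]
    gcongr
    exact (Int.fract_lt_one _).le
  rw [← h1]
  refine (h s').trans (Real.exp_le_exp.2 ?_)
  have h2 := le_abs_self A
  have h3 := abs_nonneg A
  have h4 := abs_nonneg s.im
  nlinarith [norm_nonneg s']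

/-- A periodic entire function of exponential type is a trigonometric polynomial. -/
theorem exists_trigonometric {f : ℂ → ℂ} (hf : Differentiable ℂ f)
    (hper : Function.Periodic f (1 : ℝ)) {A : ℝ}
    (h : ∀ s, ‖f s‖ ≤ Real.exp (A * (1 + ‖s‖))) :
    ∃ (N : ℕ) (G : ℂ[X]), ∀ s, f s = G.eval (Function.Periodic.qParam 1 s) /
      Function.Periodic.qParam 1 s ^ N := by
  obtain ⟨B, hB⟩ : ∃ B, B = 2 * |A| := ⟨_, rfl⟩
  have hB0 : 0 ≤ B := by rw [hB]; positivity
  have hfB : ∀ s : ℂ, ‖f s‖ ≤ Real.exp (B * (1 + |s.im|)) := by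
    rw [hB]
    exact exists_norm_le_exp_im hper h
  obtain ⟨N, hN⟩ := exists_nat_ge B
  have hNB : B ≤ 2 * Real.pi * N := by
    have := Real.pi_gt_three
    nlinarith
  obtain ⟨g, hg⟩ : ∃ g : ℂ → ℂ, g = fun s => f s * Function.Periodic.qParam 1 s ^ N := ⟨_, rfl⟩
  have hgd : Differentiable ℂ g := by
    rw [hg]
    exact hf.mul (Function.Periodic.differentiable_qParam.pow N)
  have hgp : Function.Periodic g (1 : ℝ) := by
    rw [hg]
    intro s
    have : Function.Periodic.qParam 1 (s + (1 : ℝ)) = Function.Periodic.qParam 1 s := by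
      rw [Function.Periodic.qParam, Function.Periodic.qParam,
        ← Complex.exp_periodic (2 * Real.pi * Complex.I * s / (1 : ℝ))]
      congr 1
      push_cast
      ring
    simp only [hper s, this]
  have hgb : ∀ s, ‖g s‖ ≤ Real.exp (B * (1 + |s.im|)) * ‖Function.Periodic.qParam 1 s‖ ^ N := by
    intro s
    rw [hg]
    simp only [norm_mul, norm_pow]
    gcongr
    exact hfB s
  have hbound : ∀ s, ‖g s‖ ≤ Real.exp B * (1 + ‖Function.Periodic.qParam 1 s‖ ^ (2 * N)) := by
    intro s
    refine (hgb s).trans ?_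
    rw [Function.Periodic.norm_qParam, ← Real.exp_nat_mul, ← Real.exp_nat_mul, ← Real.exp_add,
      mul_add (Real.exp B), mul_one, ← Real.exp_add]
    rcases le_total 0 s.im with hs | hs
    · refine le_add_of_le_of_nonneg (Real.exp_le_exp.2 ?_) (Real.exp_pos _).le
      rw [abs_of_nonneg hs]
      nlinarith
    · refine le_add_of_nonneg_of_le (Real.exp_pos _).le (Real.exp_le_exp.2 ?_)
      rw [abs_of_nonpos hs]
      push_cast
      nlinarith
  have hbd : Filter.BoundedAtFilter (Filter.comap Complex.im Filter.atTop) g := by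
    refine Asymptotics.IsBigO.of_bound (Real.exp B * 2) ?_
    filter_upwards [Filter.tendsto_comap.eventually (Filter.eventually_ge_atTop (0 : ℝ))] with s hs
    rw [Pi.one_apply, norm_one, mul_one]
    refine (hbound s).trans ?_
    have : ‖Function.Periodic.qParam 1 s‖ ^ (2 * N) ≤ 1 := by
      refine pow_le_one₀ (norm_nonneg _) ?_
      rw [Function.Periodic.norm_qParam, Real.exp_le_one_iff]
      have := Real.pi_pos
      nlinarith
    have := Real.exp_pos B
    nlinarith
  obtain ⟨F, hF⟩ : ∃ F, F = Function.Periodic.cuspFunction 1 g := ⟨_, rfl⟩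
  have hFq : ∀ s, F (Function.Periodic.qParam 1 s) = g s := fun s => by
    rw [hF]
    exact Function.Periodic.eq_cuspFunction one_ne_zero hgp s
  have hFd : Differentiable ℂ F := by
    intro q
    rcases eq_or_ne q 0 with rfl | hq
    · rw [hF]
      exact Function.Periodic.differentiableAt_cuspFunction_zero one_pos hgp
        (Filter.Eventually.of_forall fun s => hgd s) hbd
    · rw [hF, ← Function.Periodic.qParam_right_inv one_ne_zero hq]
      exact Function.Periodic.differentiableAt_cuspFunction one_ne_zero hgp (hgd _)
  obtain ⟨G, hG⟩ := exists_polynomial_of_growth (A := Real.exp B + ‖F 0‖) (e := 2 * N) hFd (by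
    intro q
    have h0 : 0 ≤ ‖q‖ ^ (2 * N) := by positivity
    have h1 := Real.exp_pos B
    have h2 := norm_nonneg (F 0)
    rcases eq_or_ne q 0 with rfl | hq
    · nlinarith
    · have h3 := hbound (Function.Periodic.invQParam 1 q)
      rw [← hFq, Function.Periodic.qParam_right_inv one_ne_zero hq] at h3
      nlinarith)
  refine ⟨N, G, fun s => ?_⟩
  rw [← hG, hFq, hg]
  exact (mul_div_cancel_right₀ _ (pow_ne_zero _ (Function.Periodic.qParam_ne_zero s))).symm

theorem exists_reduced_laurent (N : ℕ) (G : ℂ[X]) : ∃ (N' : ℕ) (G' : ℂ[X]),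
    (N' = 0 ∨ G'.eval 0 ≠ 0) ∧ ∀ u : ℂ, u ≠ 0 → G.eval u / u ^ N = G'.eval u / u ^ N' := by
  induction N generalizing G with
  | zero => exact ⟨0, G, Or.inl rfl, fun _ _ => rfl⟩
  | succ N ih =>
    by_cases h0 : G.eval 0 = 0
    · rw [← coeff_zero_eq_eval_zero, ← X_dvd_iff] at h0
      obtain ⟨H, rfl⟩ := h0
      obtain ⟨N', G', h1, h2⟩ := ih H
      refine ⟨N', G', h1, fun u hu => ?_⟩
      rw [← h2 u hu, eval_mul, eval_X, pow_succ', mul_div_mul_left _ _ hu]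
    · exact ⟨N + 1, G, Or.inr h0, fun _ _ => rfl⟩

/-- If `P (L u) = L (u ^ a)` for a nonconstant Laurent polynomial `L` then `a = deg P`. -/
theorem eq_natDegree_of_laurent {P G : ℂ[X]} {N a : ℕ} (hd : 2 ≤ P.natDegree)
    (ha : P.natDegree ≤ a) (hN : N = 0 ∨ G.eval 0 ≠ 0)
    (hE : ∀ u : ℂ, u ≠ 0 → P.eval (G.eval u / u ^ N) = G.eval (u ^ a) / (u ^ a) ^ N)
    (hne : ∀ c : ℂ, ∃ u : ℂ, u ≠ 0 ∧ G.eval u / u ^ N ≠ c) : a = P.natDegree := by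
  rcases Nat.eq_zero_or_pos N with rfl | hN0
  · have h1 : P.comp G = G.comp (X ^ a) := by
      refine eq_of_infinite_eval_eq _ _ ?_
      refine (Set.infinite_univ (α := ℂ)).sdiff (Set.finite_singleton 0) |>.mono ?_
      rintro u ⟨-, hu⟩
      simpa using hE u hu
    have h2 := congrArg natDegree h1
    rw [natDegree_comp, natDegree_comp, natDegree_X_pow, mul_comm] at h2
    refine (Nat.eq_of_mul_eq_mul_left ?_ h2).symm
    by_contra! h3
    obtain ⟨u, -, hu⟩ := hne (G.coeff 0)
    refine hu ?_
    rw [eq_C_of_natDegree_le_zero h3]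
    simp
  · have hG0 : G.eval 0 ≠ 0 := hN.resolve_left hN0.ne'
    by_contra hne'
    have h1 : G.comp (X ^ a) = ∑ k ∈ Finset.range (P.natDegree + 1),
        C (P.coeff k) * G ^ k * X ^ (N * (a - k)) := by
      refine eq_of_infinite_eval_eq _ _ ?_
      refine (Set.infinite_univ (α := ℂ)).sdiff (Set.finite_singleton 0) |>.mono ?_
      rintro u ⟨-, hu⟩
      have hu : u ≠ 0 := hu
      have h2 := hE u hu
      obtain ⟨v, hv⟩ : ∃ v, v = u ^ N := ⟨_, rfl⟩
      have hv0 : v ≠ 0 := hv ▸ pow_ne_zero N hu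
      rw [pow_right_comm, ← hv, eq_div_iff (pow_ne_zero _ hv0), eval_eq_sum_range,
        Finset.sum_mul] at h2
      rw [Set.mem_ofPred_eq, eval_comp, eval_pow, eval_X, ← h2, eval_finsetSum]
      refine Finset.sum_congr rfl fun k hk => ?_
      have hk : k ≤ a := by
        have := Finset.mem_range.1 hk
        omega
      simp only [eval_mul, eval_C, eval_pow, eval_X]
      rw [pow_mul, ← hv, div_pow, mul_assoc, mul_assoc]
      congr 1
      conv_lhs => rw [← Nat.add_sub_of_le hk, pow_add]
      field_simp
    have h2 := congrArg (eval 0) h1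
    rw [eval_comp, eval_pow, eval_X, zero_pow (by omega), eval_finsetSum] at h2
    refine hG0 (h2.trans (Finset.sum_eq_zero fun k hk => ?_))
    have hk := Finset.mem_range.1 hk
    have hak : N * (a - k) ≠ 0 := mul_ne_zero hN0.ne' (by omega)
    simp [zero_pow hak]

theorem monic_conj_translation {P : ℂ[X]} (hP : P.Monic) (hd : 2 ≤ P.natDegree) (e : ℂ) :
    (P.comp (X + C e) - C e).Monic ∧ (P.comp (X + C e) - C e).natDegree = P.natDegree := by
  have h1 : (P.comp (X + C e)).natDegree = P.natDegree := by
    rw [natDegree_comp, natDegree_X_add_C, mul_one]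
  have h2 : (P.comp (X + C e)).Monic := hP.comp_X_add_C e
  refine ⟨h2.sub_of_left ?_, by rw [natDegree_sub_C, h1]⟩
  refine degree_C_le.trans_lt (natDegree_pos_iff_degree_pos.1 (by omega))

theorem exists_centered {P : ℂ[X]} (hP : P.Monic) {m : ℕ} (hd : P.natDegree = m + 2) :
    ∃ e : ℂ, (P.comp (X + C e) - C e).coeff (m + 1) = 0 := by
  refine ⟨-P.coeff (m + 1) / (m + 2), ?_⟩
  obtain ⟨e, he⟩ : ∃ e, e = -P.coeff (m + 1) / (m + 2) := ⟨_, rfl⟩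
  have hm : (m + 2 : ℂ) ≠ 0 := by exact_mod_cast (show m + 2 ≠ 0 by omega)
  have hlead : P.coeff (m + 2) = 1 := by rw [← hd]; exact hP
  rw [← he, coeff_sub, coeff_C_of_ne_zero (by omega), sub_zero, ← taylor_apply, taylor_coeff,
    eval_eq_sum_range' (n := 2) ((natDegree_hasseDeriv_le _ _).trans_lt (by omega)),
    Finset.sum_range_succ, Finset.sum_range_one, hasseDeriv_coeff, hasseDeriv_coeff]
  simp only [zero_add, Nat.choose_self, pow_zero, pow_one, show 1 + (m + 1) = m + 2 by omega,
    hlead, show (m + 2).choose (m + 1) = m + 2 from Nat.choose_succ_self_right (m + 1)]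
  rw [he]
  push_cast
  field_simp
  ring

/-- A polynomial whose linearization is periodic, the degree being at most the multiplier, is
conjugate to a Dickson polynomial. -/
theorem IsLinearization.exists_dickson {P : ℂ[X]} {x₀ l : ℂ} {φ : ℂ → ℂ}
    (h : IsLinearization P x₀ l φ) (hP : P.Monic) (hd : 2 ≤ P.natDegree) {ω : ℂ} (hω0 : ω ≠ 0)
    (hω : Function.Periodic φ ω) {a : ℕ} (hla : l = a) (hDa : P.natDegree ≤ a) :
    ∃ e c : ℂ, c ^ P.natDegree = c ∧
      P.comp (X + C e) - C e = dickson 1 c P.natDegree := by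
  obtain ⟨A, hA⟩ := h.exists_growth (e := 1) hd (by
    rw [hla, pow_one, Complex.norm_natCast]
    exact_mod_cast hDa)
  obtain ⟨N₀, G₀, hG₀⟩ := exists_trigonometric (f := fun s => φ (ω * s))
    (A := |A| * (1 + ‖ω‖)) (h.diff.comp (differentiable_id.const_mul ω))
    (fun s => by
      simp only [mul_add, Complex.ofReal_one, mul_one]
      exact hω _) (fun s => by
      refine (hA _).trans (Real.exp_le_exp.2 ?_)
      rw [pow_one, norm_mul]
      have h1 := le_abs_self A
      have h2 := abs_nonneg A
      have h3 := norm_nonneg ω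
      have h4 := norm_nonneg s
      have h5 : 0 ≤ ‖ω‖ * ‖s‖ := by positivity
      nlinarith [mul_nonneg h2 h3, mul_nonneg h2 h4])
  obtain ⟨N, G, hN, hGG⟩ := exists_reduced_laurent N₀ G₀
  have hG : ∀ s, φ (ω * s) = G.eval (Function.Periodic.qParam 1 s) /
      Function.Periodic.qParam 1 s ^ N := fun s => by
    rw [← hGG _ (Function.Periodic.qParam_ne_zero s)]
    exact hG₀ s
  have hE : ∀ u : ℂ, u ≠ 0 → P.eval (G.eval u / u ^ N) = G.eval (u ^ a) / (u ^ a) ^ N := by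
    intro u hu
    have h1 := Function.Periodic.qParam_right_inv one_ne_zero hu
    obtain ⟨s, hs⟩ : ∃ s, s = Function.Periodic.invQParam 1 u := ⟨_, rfl⟩
    rw [← hs] at h1
    have h2 : Function.Periodic.qParam 1 (a * s) = u ^ a := by
      rw [← h1, Function.Periodic.qParam, Function.Periodic.qParam, ← Complex.exp_nat_mul]
      congr 1
      ring
    rw [← h2, ← h1, ← hG, ← hG, ← h.map_mul, hla]
    congr 1
    ring
  have hne : ∀ c : ℂ, ∃ u : ℂ, u ≠ 0 ∧ G.eval u / u ^ N ≠ c := by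
    intro c
    by_contra! hcon
    obtain ⟨z, hz⟩ := h.exists_ne
    have hc : ∀ z, φ z = c := fun z => by
      rw [← mul_div_cancel₀ z hω0, hG]
      exact hcon _ (Function.Periodic.qParam_ne_zero _)
    exact hz (by rw [hc, hc])
  obtain rfl := eq_natDegree_of_laurent hd hDa hN hE hne
  obtain ⟨m, hm⟩ : ∃ m, P.natDegree = m + 2 := ⟨P.natDegree - 2, by omega⟩
  obtain ⟨e, he⟩ := exists_centered hP hm
  obtain ⟨hm1, hm2⟩ := monic_conj_translation hP hd e
  have hT : ∀ u : ℂ, u ≠ 0 → (G - C e * X ^ N).eval u / u ^ N = G.eval u / u ^ N - e := by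
    intro u hu
    rw [eval_sub, eval_mul, eval_C, eval_pow, eval_X, sub_div,
      mul_div_cancel_right₀ _ (pow_ne_zero _ hu)]
  rw [hm] at hE
  obtain ⟨M, α, γ, hM, hα, hγ, h0, hform⟩ := laurent_form (G := G - C e * X ^ N) (N := N) hm1
    (hm2.trans hm) he (fun u hu => by
      rw [hT u hu, hT _ (pow_ne_zero _ hu), eval_sub, eval_comp, eval_add, eval_X, eval_C,
        sub_add_cancel, hE u hu]) (fun c => by
      obtain ⟨u, hu, huc⟩ := hne (c + e)
      refine ⟨u, hu, fun hc => huc ?_⟩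
      rw [hT u hu] at hc
      rw [← hc]
      ring)
  refine ⟨e, α * γ, by rw [hm, mul_pow, hα, hγ], ?_⟩
  rw [hm]
  refine eq_dickson_of_laurent hM hα hγ h0 fun u hu => ?_
  rw [← hform u hu, ← hform _ (pow_ne_zero _ hu), hT u hu, hT _ (pow_ne_zero _ hu), eval_sub,
    eval_comp, eval_add, eval_X, eval_C, sub_add_cancel, hE u hu]

theorem translate_comp (p r : ℂ[X]) (e : ℂ) :
    (p.comp r).comp (X + C e) - C e =
      (p.comp (X + C e) - C e).comp (r.comp (X + C e) - C e) := by
  refine Polynomial.funext fun x => ?_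
  simp [eval_comp]

theorem exists_iterate_translate_eq_dickson (K : Subfield ℂ) [FiniteDimensional ℚ K] {p : ℂ[X]}
    (hp : p.Monic) (hd : 2 ≤ p.natDegree) (hm : MultipliersIn K p) :
    ∃ (k : ℕ) (e c : ℂ), 0 < k ∧ c ^ (polyIter p k).natDegree = c ∧
      (polyIter p k).comp (X + C e) - C e = dickson 1 c (polyIter p k).natDegree := by
  obtain ⟨k, x₀, l, φ, hk, h⟩ := exists_isLinearization hp hd
  have hP : (polyIter p k).Monic := monic_polyIter hp (by omega) k
  have hdeg : 2 ≤ (polyIter p k).natDegree := by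
    rw [natDegree_polyIter]
    exact hd.trans (Nat.le_self_pow hk.ne' _)
  rcases h.exists_zero_or_power hP hdeg with ⟨t₀, ht₀, ht⟩ | ⟨y₀, hy⟩
  · obtain ⟨ω, t₁, a, hω0, hω, hla, hz⟩ := h.exists_period
      (fun t ht => h.exists_affine K hP hdeg (hm.polyIter hk) ht) ht₀ ht
    have hle := h.natDegree_le_natAbs hdeg hω hla hz
    have hN : ((polyIter p k).comp (polyIter p k)).natDegree =
        (polyIter p k).natDegree ^ 2 := by rw [natDegree_comp, sq]
    obtain ⟨e, c, hc, hec⟩ := h.comp_self.exists_dickson (hP.comp hP (by omega))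
      (by rw [hN]; nlinarith) hω0 hω (a := a.natAbs ^ 2)
      (by rw [hla, ← Int.cast_pow, ← Int.natAbs_sq a]; norm_cast)
      (by rw [hN]; exact Nat.pow_le_pow_left hle 2)
    rw [← polyIter_add] at hc hec
    exact ⟨k + k, e, c, by omega, hc, hec⟩
  · obtain ⟨N, hN⟩ : ∃ N, N = (polyIter p k).natDegree := ⟨_, rfl⟩
    rw [← hN] at hy hdeg
    refine ⟨k, y₀, 0, hk, by rw [← hN, zero_pow (by omega)], ?_⟩
    rw [← hN, dickson_one_zero (by omega), hy]
    simp

theorem exists_translate_eq_dickson (K : Subfield ℂ) [FiniteDimensional ℚ K] {p : ℂ[X]}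
    (hp : p.Monic) (hd : 2 ≤ p.natDegree) (hm : MultipliersIn K p) :
    ∃ e c : ℂ, c ^ p.natDegree = c ∧ p.comp (X + C e) - C e = dickson 1 c p.natDegree := by
  obtain ⟨k, e, c, hk, hc, h⟩ := exists_iterate_translate_eq_dickson K hp hd hm
  obtain ⟨hq, hqd⟩ := monic_conj_translation hp hd e
  have hdeg : 2 ≤ (polyIter p k).natDegree := by
    rw [natDegree_polyIter]
    exact hd.trans (Nat.le_self_pow hk.ne' _)
  obtain ⟨m, hm⟩ : ∃ m, (polyIter p k).natDegree = m + 2 :=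
    ⟨(polyIter p k).natDegree - 2, by omega⟩
  rw [hm] at hc h
  obtain ⟨h1, h2⟩ := eq_dickson_of_semiconj hq (by omega) hc (b := c) (by
    rw [← h, ← translate_comp, ← translate_comp, ← polyIter_succ', polyIter])
  rw [hqd] at h1 h2
  exact ⟨e, c, h2.symm, h1⟩

theorem sub_mul_derivative_dickson_eval (t s : ℂ) (n : ℕ) :
    (t - s) * (derivative (dickson 1 (t * s) n)).eval (t + s) = n * (t ^ n - s ^ n) := by
  induction n using Nat.twoStepInduction with
  | zero => norm_num [dickson_zero]
  | one => simp
  | more n ih₀ ih₁ =>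
    rw [dickson_add_two, derivative_sub, derivative_mul, derivative_X, one_mul, derivative_mul,
      derivative_C, zero_mul, zero_add, eval_sub, eval_add, eval_mul, eval_mul, eval_X, eval_C,
      dickson_eval_add_div]
    push_cast at ih₁ ⊢
    linear_combination (t + s) * ih₁ - t * s * ih₀

theorem derivative_dickson_eval_two_mul (t : ℂ) (n : ℕ) :
    (derivative (dickson 1 (t * t) (n + 1))).eval (t + t) = (n + 1) ^ 2 * t ^ n := by
  induction n using Nat.twoStepInduction with
  | zero => simp
  | one =>
    rw [dickson_add_two, derivative_sub, derivative_mul, derivative_X, one_mul, derivative_mul,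
      derivative_C, zero_mul, zero_add, dickson_one, dickson_zero]
    norm_num
    ring
  | more n ih₀ ih₁ =>
    rw [dickson_add_two, derivative_sub, derivative_mul, derivative_X, one_mul, derivative_mul,
      derivative_C, zero_mul, zero_add, eval_sub, eval_add, eval_mul, eval_mul, eval_X, eval_C,
      dickson_eval_add_div, ih₀, ih₁]
    push_cast
    ring

theorem derivative_dickson_eval_mem (K : Subfield ℂ) {c w : ℂ} {N : ℕ} (hN : 0 < N)
    (hc : c ^ N = c) (hw : (dickson 1 c N).eval w = w) :
    (derivative (dickson 1 c N)).eval w ∈ K := by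
  obtain ⟨t, s, rfl, rfl⟩ := exists_add_mul_eq w c
  rw [dickson_eval_add_div] at hw
  have hNK : (N : ℂ) ∈ K := natCast_mem K N
  rcases eq_or_ne t s with rfl | hts
  · obtain ⟨n, rfl⟩ := Nat.exists_eq_succ_of_ne_zero hN.ne'
    rw [Nat.succ_eq_add_one, derivative_dickson_eval_two_mul]
    have ht : t ^ (n + 1) = t := by
      rw [Nat.succ_eq_add_one] at hw
      linear_combination hw / 2
    refine K.mul_mem (K.pow_mem (by exact_mod_cast hNK) 2) ?_
    rcases eq_or_ne t 0 with rfl | ht0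
    · exact K.pow_mem K.zero_mem n
    · rw [pow_succ] at ht
      rw [mul_eq_right₀ ht0 |>.1 ht]
      exact K.one_mem
  · have h := sub_mul_derivative_dickson_eval t s N
    have hts' := sub_ne_zero.2 hts
    have hmul : (t ^ N - t) * (t ^ N - s) = 0 := by
      rw [mul_pow] at hc
      linear_combination t ^ N * hw - hc
    rcases mul_eq_zero.1 hmul with h1 | h1
    · have : (derivative (dickson 1 (t * s) N)).eval (t + s) = N := by
        refine mul_left_cancel₀ hts' ?_
        linear_combination h + 2 * N * h1 - N * hw
      rwa [this]
    · have : (derivative (dickson 1 (t * s) N)).eval (t + s) = -N := by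
        refine mul_left_cancel₀ hts' ?_
        linear_combination h + 2 * N * h1 - N * hw
      rw [this]
      exact K.neg_mem hNK

theorem dickson_comp_C_mul_X (a c : ℂ) (n : ℕ) :
    (dickson 1 (c ^ 2 * a) n).comp (C c * X) = C (c ^ n) * dickson 1 a n := by
  refine Polynomial.funext fun w => ?_
  obtain ⟨t, s, rfl, rfl⟩ := exists_add_mul_eq w a
  have := dickson_eval_add_div (c * t) (c * s) n
  rw [eval_comp, eval_mul, eval_mul, eval_C, eval_X, eval_C, dickson_eval_add_div]
  rw [show c ^ 2 * (t * s) = c * t * (c * s) by ring, mul_add, this]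
  ring

/-- The model polynomials `X ^ d`, `T_d`, `-T_d` are linearly conjugate to Dickson polynomials. -/
theorem exists_scaling_to_dickson {d : ℕ} (hd : 2 ≤ d) {P : ℂ[X]}
    (hP : P = X ^ d ∨ P = ChebT d ∨ P = -ChebT d) :
    ∃ c a : ℂ, c ≠ 0 ∧ a ^ d = a ∧ P.comp (C c * X) = C c * dickson 1 a d := by
  rcases hP with rfl | rfl | rfl
  · exact ⟨1, 0, one_ne_zero, zero_pow (by omega), by
      rw [dickson_one_zero (by omega)]; simp⟩
  · exact ⟨1, 1, one_ne_zero, one_pow _, by simp [ChebT]⟩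
  · obtain ⟨c, hc⟩ := IsAlgClosed.exists_pow_nat_eq (-1 : ℂ) (show 0 < d - 1 by omega)
    have hc0 : c ≠ 0 := by
      rintro rfl
      rw [zero_pow (by omega)] at hc
      norm_num at hc
    have hcd : c ^ d = -c := by
      rw [← Nat.sub_add_cancel (show 1 ≤ d by omega), pow_succ, hc, neg_one_mul]
    refine ⟨c, (c ^ 2)⁻¹, hc0, by rw [inv_pow, ← pow_mul, mul_comm, pow_mul, hcd, neg_sq], ?_⟩
    have := dickson_comp_C_mul_X (c ^ 2)⁻¹ c d
    rw [mul_inv_cancel₀ (pow_ne_zero 2 hc0), hcd] at this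
    rw [ChebT, neg_comp, this, C_neg]
    ring

theorem exists_scaling_from_dickson {d : ℕ} (hd : 2 ≤ d) {a : ℂ} (ha : a ^ d = a) :
    ∃ (c : ℂ) (P : ℂ[X]), c ≠ 0 ∧ (P = X ^ d ∨ P = ChebT d ∨ P = -ChebT d) ∧
      (dickson 1 a d).comp (C c * X) = C c * P := by
  rcases eq_or_ne a 0 with rfl | ha0
  · exact ⟨1, X ^ d, one_ne_zero, Or.inl rfl, by rw [dickson_one_zero (by omega)]; simp⟩
  · obtain ⟨c, hc⟩ := IsAlgClosed.exists_pow_nat_eq a (show 0 < 2 by omega)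
    have hc0 : c ≠ 0 := by
      rintro rfl
      exact ha0 (by rw [← hc, zero_pow two_ne_zero])
    have h1 := dickson_comp_C_mul_X 1 c d
    rw [mul_one, hc] at h1
    have h2 : (c ^ d - c) * (c ^ d + c) = 0 := by
      rw [← hc] at ha
      linear_combination (exp := 1) (by rw [← pow_mul, mul_comm, pow_mul] at ha; exact ha :
        (c ^ d) ^ 2 = c ^ 2)
    rcases mul_eq_zero.1 h2 with h | h
    · refine ⟨c, ChebT d, hc0, Or.inr (Or.inl rfl), ?_⟩
      rw [h1, sub_eq_zero.1 h, ChebT]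
    · refine ⟨c, -ChebT d, hc0, Or.inr (Or.inr rfl), ?_⟩
      rw [h1, eq_neg_of_add_eq_zero_left h, ChebT, C_neg, neg_mul, mul_neg]

/-- The fibrewise iterates of the skew product over `p` with fibre maps `F`. -/
def famIter (p : ℂ[X]) (F : ℂ → ℂ[X]) : ℕ → ℂ → ℂ[X]
  | 0, _ => X
  | n + 1, z => (famIter p F n (p.eval z)).comp (F z)

/-- The skew product over `p` with fibre maps `F`. -/
def famMap (p : ℂ[X]) (F : ℂ → ℂ[X]) : ℂ × ℂ → ℂ × ℂ :=
  fun zw => (p.eval zw.1, (F zw.1).eval zw.2)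

/-- All multipliers of periodic points of the skew product lie in `K`. -/
def SkewMultipliersIn (K : Subfield ℂ) (p : ℂ[X]) (F : ℂ → ℂ[X]) : Prop :=
  ∀ n : ℕ, 0 < n → ∀ z₀ w₀ : ℂ,
    (polyIter p n).eval z₀ = z₀ → (famIter p F n z₀).eval w₀ = w₀ →
      (derivative (polyIter p n)).eval z₀ ∈ K ∧ (derivative (famIter p F n z₀)).eval w₀ ∈ K

theorem QIter_eq_famIter (p : ℂ[X]) (q : ℂ[X][X]) (n : ℕ) (z : ℂ) :
    QIter p q n z = famIter p (fiber q) n z := by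
  induction n generalizing z with
  | zero => rfl
  | succ n ih => rw [QIter, famIter, ih]

theorem famIter_add (p : ℂ[X]) (F : ℂ → ℂ[X]) (m n : ℕ) (z : ℂ) :
    famIter p F (m + n) z = (famIter p F m ((polyIter p n).eval z)).comp (famIter p F n z) := by
  induction n generalizing z with
  | zero => simp [famIter, polyIter]
  | succ n ih => rw [← add_assoc, famIter, ih, famIter, polyIter, eval_comp, comp_assoc]

theorem monic_famIter {p : ℂ[X]} {F : ℂ → ℂ[X]} {d : ℕ} (hd : 2 ≤ d) (hF : ∀ z, (F z).Monic)
    (hFd : ∀ z, (F z).natDegree = d) (n : ℕ) (z : ℂ) :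
    (famIter p F n z).Monic ∧ (famIter p F n z).natDegree = d ^ n := by
  induction n generalizing z with
  | zero => simp [famIter, monic_X]
  | succ n ih =>
    rw [famIter]
    refine ⟨(ih _).1.comp (hF z) (by rw [hFd]; omega), ?_⟩
    rw [natDegree_comp, (ih _).2, hFd, pow_succ]

theorem polyIter_eval_of_isFixed {p : ℂ[X]} {n : ℕ} {z : ℂ} (hz : (polyIter p n).eval z = z)
    (j : ℕ) : (polyIter p (n * j)).eval z = z := by
  induction j with
  | zero => simp [polyIter]
  | succ j ih => rw [mul_add, mul_one, polyIter_add, eval_comp, hz, ih]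

theorem polyIter_famIter {p : ℂ[X]} (F : ℂ → ℂ[X]) {n : ℕ} {z : ℂ}
    (hz : (polyIter p n).eval z = z) (j : ℕ) :
    polyIter (famIter p F n z) j = famIter p F (n * j) z := by
  induction j with
  | zero => simp [polyIter, famIter]
  | succ j ih => rw [polyIter, ih, mul_add, mul_one, famIter_add, hz]

theorem SkewMultipliersIn.multipliersIn_famIter {K : Subfield ℂ} {p : ℂ[X]} {F : ℂ → ℂ[X]}
    (h : SkewMultipliersIn K p F) {n : ℕ} (hn : 0 < n) {z : ℂ}
    (hz : (polyIter p n).eval z = z) : MultipliersIn K (famIter p F n z) := by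
  intro j hj w hw
  rw [polyIter_famIter F hz] at hw ⊢
  exact (h _ (Nat.mul_pos hn hj) z w (polyIter_eval_of_isFixed hz j) hw).2

theorem SkewMultipliersIn.multipliersIn_base {K : Subfield ℂ} {p : ℂ[X]} {F : ℂ → ℂ[X]}
    (h : SkewMultipliersIn K p F) {d : ℕ} (hd : 2 ≤ d) (hF : ∀ z, (F z).Monic)
    (hFd : ∀ z, (F z).natDegree = d) : MultipliersIn K p := by
  intro n hn z hz
  have hdeg : 2 ≤ (famIter p F n z).natDegree := by
    rw [(monic_famIter hd hF hFd n z).2]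
    exact hd.trans (Nat.le_self_pow hn.ne' _)
  have hsub : (famIter p F n z - X).natDegree = (famIter p F n z).natDegree :=
    natDegree_sub_eq_left_of_natDegree_lt (by rw [natDegree_X]; omega)
  obtain ⟨w, hw⟩ := IsAlgClosed.exists_root (famIter p F n z - X) fun h0 => by
    have := natDegree_eq_zero_iff_degree_le_zero.2 h0.le
    omega
  rw [IsRoot, eval_sub, eval_X, sub_eq_zero] at hw
  exact (h n hn z w hz hw).1

theorem TriangConj.trans {f g h : ℂ × ℂ → ℂ × ℂ} (hfg : TriangConj f g) (hgh : TriangConj g h) :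
    TriangConj f h := by
  obtain ⟨α, β, γ, δ, ε, hα, hγ, H⟩ := hfg
  obtain ⟨α', β', γ', δ', ε', hα', hγ', H'⟩ := hgh
  refine ⟨α * α', α * β' + β, γ * γ', ε * β' + γ * δ' + δ, ε * α' + γ * ε', mul_ne_zero hα hα',
    mul_ne_zero hγ hγ', fun zw => ?_⟩
  have h1 := H (α' * zw.1 + β', ε' * zw.1 + γ' * zw.2 + δ')
  rw [← H' zw] at h1
  convert h1 using 2
  · ring
  · ring
  · ext <;> ring

theorem skewMultipliersIn_iff_of_triangConj {K : Subfield ℂ} {p p' : ℂ[X]} {F F' : ℂ → ℂ[X]}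
    (h : TriangConj (famMap p F) (famMap p' F')) :
    SkewMultipliersIn K p F ↔ SkewMultipliersIn K p' F' := by
  obtain ⟨α, β, γ, δ, ε, hα, hγ, H⟩ := h
  have hp : ∀ n, (polyIter p n).comp (C α * X + C β) = C α * polyIter p' n + C β := by
    have h1 : p.comp (C α * X + C β) = C α * p' + C β := by
      refine Polynomial.funext fun z => ?_
      have := congrArg Prod.fst (H (z, 0))
      simpa [famMap, eval_comp] using this.symm
    intro n
    induction n with
    | zero => simp [polyIter]
    | succ n ih =>
      rw [polyIter_succ', comp_assoc, ih, polyIter_succ',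
        show C α * polyIter p' n + C β = (C α * X + C β).comp (polyIter p' n) by simp,
        ← comp_assoc, h1]
      simp
  have hF : ∀ n z, (famIter p F n (α * z + β)).comp (C γ * X + C (ε * z + δ)) =
      C γ * famIter p' F' n z + C (ε * (polyIter p' n).eval z + δ) := by
    have h1 : ∀ z, (F (α * z + β)).comp (C γ * X + C (ε * z + δ)) =
        C γ * F' z + C (ε * p'.eval z + δ) := by
      intro z
      refine Polynomial.funext fun w => ?_
      have := congrArg Prod.snd (H (z, w))
      simp only [famMap] at this
      simp only [eval_comp, eval_add, eval_mul, eval_C, eval_X]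
      rw [show γ * w + (ε * z + δ) = ε * z + γ * w + δ by ring, ← this]
      ring
    intro n
    induction n with
    | zero => intro z; simp [famIter, polyIter]
    | succ n ih =>
      intro z
      have h2 : p.eval (α * z + β) = α * p'.eval z + β := by
        have := congrArg (eval z) (hp 1)
        simpa [polyIter_one, eval_comp] using this
      rw [famIter, comp_assoc, h1, h2,
        show C γ * F' z + C (ε * p'.eval z + δ) =
          (C γ * X + C (ε * p'.eval z + δ)).comp (F' z) by simp, ← comp_assoc, ih, famIter,
        polyIter, eval_comp]
      simp
  have hpe : ∀ n z, (polyIter p n).eval (α * z + β) = α * (polyIter p' n).eval z + β := by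
    intro n z
    simpa [eval_comp] using congrArg (eval z) (hp n)
  have hpd : ∀ n z, (derivative (polyIter p n)).eval (α * z + β) =
      (derivative (polyIter p' n)).eval z := by
    intro n z
    have := congrArg (fun r => (derivative r).eval z) (hp n)
    simp only [derivative_comp, derivative_add, derivative_mul, derivative_C, derivative_X,
      eval_add, eval_mul, eval_C, eval_comp, eval_X, eval_zero, eval_one] at this
    exact mul_left_cancel₀ hα (by linear_combination this)
  have hFe : ∀ n z w, (famIter p F n (α * z + β)).eval (γ * w + (ε * z + δ)) =
      γ * (famIter p' F' n z).eval w + (ε * (polyIter p' n).eval z + δ) := by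
    intro n z w
    simpa [eval_comp] using congrArg (eval w) (hF n z)
  have hFd : ∀ n z w, (derivative (famIter p F n (α * z + β))).eval (γ * w + (ε * z + δ)) =
      (derivative (famIter p' F' n z)).eval w := by
    intro n z w
    have := congrArg (fun r => (derivative r).eval w) (hF n z)
    simp only [derivative_comp, derivative_add, derivative_mul, derivative_C, derivative_X,
      eval_add, eval_mul, eval_C, eval_comp, eval_X, eval_zero, eval_one] at this
    exact mul_left_cancel₀ hγ (by linear_combination this)
  constructor
  · intro h n hn z w hz hw
    rw [← hpd, ← hFd]
    exact h n hn _ _ (by rw [hpe, hz]) (by rw [hFe, hz, hw])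
  · intro h n hn z w hz hw
    obtain ⟨x, rfl⟩ : ∃ x, α * x + β = z := ⟨(z - β) / α, by field_simp; ring⟩
    obtain ⟨y, rfl⟩ : ∃ y, γ * y + (ε * x + δ) = w :=
      ⟨(w - (ε * x + δ)) / γ, by field_simp; ring⟩
    rw [hpd, hFd]
    rw [hpe, add_left_inj, mul_right_inj' hα] at hz
    rw [hFe, hz, add_left_inj, mul_right_inj' hγ] at hw
    exact h n hn _ _ hz hw

theorem skewMultipliersIn_dickson (K : Subfield ℂ) {d : ℕ} (hd : 0 < d) {a : ℂ} (ha : a ^ d = a)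
    {b : ℂ[X]} (hb : b.comp (dickson 1 a d) = b ^ d) :
    SkewMultipliersIn K (dickson 1 a d) fun z => dickson 1 (b.eval z) d := by
  have ha' : ∀ n, a ^ d ^ n = a := by
    intro n
    induction n with
    | zero => simp
    | succ n ih => rw [pow_succ, pow_mul, ih, ha]
  have hbe : ∀ z, b.eval ((dickson 1 a d).eval z) = b.eval z ^ d := fun z => by
    simpa [eval_comp] using congrArg (eval z) hb
  have hp : ∀ n, polyIter (dickson 1 a d) n = dickson 1 a (d ^ n) := by
    intro n
    induction n with
    | zero => simp [polyIter]
    | succ n ih =>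
      have := dickson_comp_dickson a (d ^ n) d
      rw [ha] at this
      rw [polyIter, ih, this, pow_succ']
  have hF : ∀ n z, famIter (dickson 1 a d) (fun z => dickson 1 (b.eval z) d) n z =
      dickson 1 (b.eval z) (d ^ n) := by
    intro n
    induction n with
    | zero => simp [famIter]
    | succ n ih =>
      intro z
      rw [famIter, ih, hbe, dickson_comp_dickson, pow_succ']
  have hbn : ∀ n z, b.eval ((dickson 1 a (d ^ n)).eval z) = b.eval z ^ d ^ n := by
    intro n
    simp only [← hp]
    induction n with
    | zero => simp [polyIter]
    | succ n ih =>
      intro z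
      rw [polyIter_succ', eval_comp, hbe, ih, pow_succ, pow_mul]
  intro n _ z w hz hw
  rw [hp] at hz ⊢
  rw [hF] at hw ⊢
  have hN : 0 < d ^ n := Nat.pow_pos hd
  refine ⟨derivative_dickson_eval_mem K hN (ha' n) hz, derivative_dickson_eval_mem K hN ?_ hw⟩
  rw [← hbn, hz]

/-- In a centered skew product, the fibre maps over periodic points are Dickson polynomials. -/
theorem fibre_eq_dickson_of_periodic (K : Subfield ℂ) [FiniteDimensional ℚ K] {p : ℂ[X]}
    {F : ℂ → ℂ[X]} {d : ℕ} (hd : 2 ≤ d) (hF : ∀ z, (F z).Monic) (hFd : ∀ z, (F z).natDegree = d)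
    (hFc : ∀ z, (F z).coeff (d - 1) = 0) (hK : SkewMultipliersIn K p F) {n : ℕ} (hn : 0 < n)
    {z : ℂ} (hz : (polyIter p n).eval z = z) :
    ∃ c, F z = dickson 1 c d ∧ F (p.eval z) = dickson 1 (c ^ d) d := by
  obtain ⟨M, hM⟩ : ∃ M, d ^ n = M + 2 := ⟨d ^ n - 2, by
    have := hd.trans (Nat.le_self_pow hn.ne' d); omega⟩
  have hper : ∀ {z}, (polyIter p n).eval z = z →
      (polyIter p n).eval (p.eval z) = p.eval z := fun {z} hz => by
    rw [← eval_comp, ← polyIter, polyIter_succ', eval_comp, hz]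
  have hA : ∀ {z}, (polyIter p n).eval z = z → ∃ e c : ℂ, c ^ (M + 2) = c ∧
      (famIter p F n z).comp (X + C e) - C e = dickson 1 c (M + 2) := by
    intro z hz
    obtain ⟨h1, h2⟩ := monic_famIter (p := p) hd hF hFd n z
    rw [hM] at h2
    have := exists_translate_eq_dickson K h1 (by omega) (hK.multipliersIn_famIter hn hz)
    rwa [h2] at this
  have hstep : ∀ {z}, (polyIter p n).eval z = z → ∀ {e c e' c' : ℂ}, c ^ (M + 2) = c →
      (famIter p F n z).comp (X + C e) - C e = dickson 1 c (M + 2) →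
      (famIter p F n (p.eval z)).comp (X + C e') - C e' = dickson 1 c' (M + 2) →
      e = 0 ∧ (F z).comp (X + C e) - C e' = dickson 1 c d ∧ c' = c ^ d := by
    intro z hz e c e' c' hc h h'
    have hcomp : (F z).comp (famIter p F n z) = (famIter p F n (p.eval z)).comp (F z) := by
      have := famIter_add p F 1 n z
      rw [add_comm, famIter, hz] at this
      simpa [famIter] using this.symm
    have h1 : ((F z).comp (X + C e)).natDegree = d := by
      rw [natDegree_comp, natDegree_X_add_C, mul_one, hFd]
    have h2 : ((F z).comp (X + C e)).Monic := (hF z).comp_X_add_C e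
    have h3 : ((F z).comp (X + C e) - C e').natDegree = d := by rw [natDegree_sub_C, h1]
    have h4 : ((F z).comp (X + C e) - C e').Monic := by
      rw [Monic, leadingCoeff, h3, coeff_sub, coeff_C_of_ne_zero (by omega), sub_zero, ← h1]
      exact h2
    obtain ⟨h5, h6⟩ := eq_dickson_of_semiconj h4 (by omega) hc (b := c') (by
      rw [← h, ← h']
      refine Polynomial.funext fun x => ?_
      have := congrArg (eval (x + e)) hcomp
      simp only [eval_comp] at this
      simp [eval_comp, this])
    rw [h3] at h5 h6
    refine ⟨?_, h5, h6⟩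
    obtain ⟨m, rfl⟩ : ∃ m, d = m + 2 := ⟨d - 2, by omega⟩
    have h7 := congrArg (fun r => r.coeff (m + 1)) h5
    have hlead : (F z).coeff (m + 2) = 1 := by rw [← hFd z]; exact hF z
    have hsub : (F z).coeff (m + 1) = 0 := hFc z
    simp only [coeff_dickson_pred] at h7
    rw [coeff_sub, coeff_C_of_ne_zero (by omega), sub_zero, ← taylor_apply, taylor_coeff,
      eval_eq_sum_range' (n := 2) ((natDegree_hasseDeriv_le _ _).trans_lt (by rw [hFd]; omega)),
      Finset.sum_range_succ, Finset.sum_range_one, hasseDeriv_coeff, hasseDeriv_coeff] at h7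
    simp only [zero_add, Nat.choose_self, pow_zero, pow_one, show 1 + (m + 1) = m + 2 by omega,
      hlead, hsub, show (m + 2).choose (m + 1) = m + 2 from Nat.choose_succ_self_right (m + 1)]
      at h7
    have hm : (m + 2 : ℂ) ≠ 0 := by exact_mod_cast (show m + 2 ≠ 0 by omega)
    push_cast at h7
    simpa [hm] using h7
  obtain ⟨e₀, c₀, hc₀, h₀⟩ := hA hz
  obtain ⟨e₁, c₁, hc₁, h₁⟩ := hA (hper hz)
  obtain ⟨e₂, c₂, hc₂, h₂⟩ := hA (hper (hper hz))
  obtain ⟨e₃, c₃, hc₃, h₃⟩ := hA (hper (hper (hper hz)))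
  obtain ⟨he₀, hF₀, hcc⟩ := hstep hz hc₀ h₀ h₁
  obtain ⟨he₁, hF₁, -⟩ := hstep (hper hz) hc₁ h₁ h₂
  obtain ⟨he₂, -, -⟩ := hstep (hper (hper hz)) hc₂ h₂ h₃
  refine ⟨c₀, ?_, ?_⟩
  · rw [← hF₀, he₀, he₁]; simp
  · rw [← hcc, ← hF₁, he₁, he₂]; simp

theorem eq_dickson_of_skewMultipliersIn (K : Subfield ℂ) [FiniteDimensional ℚ K] {p : ℂ[X]}
    {q : ℂ[X][X]} {d : ℕ} (hd : 2 ≤ d) (hp : p.Monic) (hpd : p.natDegree = d) (hq : q.Monic)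
    (hqd : q.natDegree = d) (hqc : q.coeff (d - 1) = 0) (hK : SkewMultipliersIn K p (fiber q)) :
    ∃ b : ℂ[X], q = dickson 1 b d ∧ b.comp p = b ^ d := by
  have hF : ∀ z, (fiber q z).Monic := fun z => hq.map _
  have hFd : ∀ z, (fiber q z).natDegree = d := fun z => by
    rw [fiber, hq.natDegree_map, hqd]
  have hFc : ∀ z, (fiber q z).coeff (d - 1) = 0 := fun z => by
    rw [fiber, coeff_map, hqc, map_zero]
  obtain ⟨m, rfl⟩ : ∃ m, d = m + 2 := ⟨d - 2, by omega⟩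
  have hm : (m + 2 : ℂ) ≠ 0 := by exact_mod_cast (show m + 2 ≠ 0 by omega)
  obtain ⟨b, hb⟩ : ∃ b, b = C (-(m + 2 : ℂ))⁻¹ * q.coeff m := ⟨_, rfl⟩
  have hbc : ∀ {z c}, fiber q z = dickson 1 c (m + 2) → b.eval z = c := by
    intro z c h
    have := congrArg (fun r => r.coeff m) h
    simp only [coeff_dickson_add_two, fiber, coeff_map, coe_evalRingHom] at this
    rw [hb, eval_mul, eval_C, this, inv_mul_cancel_left₀ (neg_ne_zero.2 hm)]
  have hinf : {x | IsRepelling p x}.Infinite := infinite_repelling hp (by omega)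
  have key : ∀ z, IsRepelling p z → fiber q z = dickson 1 (b.eval z) (m + 2) ∧
      b.eval (p.eval z) = b.eval z ^ (m + 2) := by
    rintro z ⟨n, hn, hz, -⟩
    obtain ⟨c, h1, h2⟩ := fibre_eq_dickson_of_periodic K hd hF hFd hFc hK hn hz
    rw [hbc h1, hbc h2]
    exact ⟨h1, rfl⟩
  refine ⟨b, ?_, ?_⟩
  · ext1 k
    refine eq_of_infinite_eval_eq _ _ (hinf.mono fun z hz => ?_)
    have h1 := congrArg (fun r => r.coeff k) (key z hz).1
    have h2 : dickson 1 (b.eval z) (m + 2) = (dickson 1 b (m + 2)).map (evalRingHom z) := by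
      rw [map_dickson, coe_evalRingHom]
    simp only [h2, fiber, coeff_map, coe_evalRingHom] at h1
    exact h1
  · refine eq_of_infinite_eval_eq _ _ (hinf.mono fun z hz => ?_)
    rw [Set.mem_ofPred_eq, eval_comp, eval_pow]
    exact (key z hz).2

theorem SpecialSkew.of_triangConj {d : ℕ} {f g : ℂ × ℂ → ℂ × ℂ} (hg : SpecialSkew d g)
    (h : TriangConj f g) : SpecialSkew d f := by
  rcases hg with ⟨P, Q, hP, hQ, hc⟩ | ⟨ζ, m, hζ, hm, hc⟩
  · exact Or.inl ⟨P, Q, hP, hQ, h.trans hc⟩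
  · exact Or.inr ⟨ζ, m, hζ, hm, h.trans hc⟩

theorem triangConj_of_scaling {p p' q q' : ℂ[X]} {c c' : ℂ} (hc : c ≠ 0) (hc' : c' ≠ 0)
    (hp : p.comp (C c * X) = C c * p') (hq : q.comp (C c' * X) = C c' * q') :
    TriangConj (fun zw => (p.eval zw.1, q.eval zw.2)) fun zw => (p'.eval zw.1, q'.eval zw.2) := by
  refine ⟨c, 0, c', 0, 0, hc, hc', fun zw => ?_⟩
  have h1 := congrArg (eval zw.1) hp
  have h2 := congrArg (eval zw.2) hq
  simp only [eval_comp, eval_mul, eval_C, eval_X] at h1 h2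
  simp [h1, h2]

theorem specialSkew_dickson {d : ℕ} (hd : 2 ≤ d) {a : ℂ} (ha : a ^ d = a) {b : ℂ[X]}
    (hb2 : b.natDegree ≤ 2) (hb : b.comp (dickson 1 a d) = b ^ d) :
    SpecialSkew d (famMap (dickson 1 a d) fun z => dickson 1 (b.eval z) d) := by
  rcases Nat.eq_zero_or_pos b.natDegree with h0 | hpos
  · obtain ⟨β, rfl⟩ := natDegree_eq_zero.1 h0
    have hβ : β ^ d = β := by
      rw [C_comp, ← C_pow] at hb
      exact (C_injective hb).symm
    obtain ⟨c, P, hc, hP, h1⟩ := exists_scaling_from_dickson hd ha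
    obtain ⟨c', Q, hc', hQ, h2⟩ := exists_scaling_from_dickson hd hβ
    refine Or.inl ⟨P, Q, hP, hQ, ?_⟩
    simp only [eval_C]
    exact triangConj_of_scaling hc hc' h1 h2
  · obtain ⟨ζ, hζ⟩ : ∃ ζ, ζ = b.leadingCoeff := ⟨_, rfl⟩
    have hζ0 : ζ ≠ 0 := by
      rw [hζ, leadingCoeff_ne_zero]
      rintro rfl
      simp at hpos
    obtain ⟨m, rfl⟩ : ∃ m, d = m + 2 := ⟨d - 2, by omega⟩
    have hζd : ζ ^ (m + 2) = ζ := by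
      have := congrArg leadingCoeff hb
      rwa [leadingCoeff_comp (by rw [natDegree_dickson]; omega),
        (monic_dickson a (m + 1)).leadingCoeff,
        one_pow, mul_one, leadingCoeff_pow, ← hζ, eq_comm] at this
    have hr : (C ζ⁻¹ * b).Monic := by
      rw [Monic, leadingCoeff_mul, leadingCoeff_C, ← hζ, inv_mul_cancel₀ hζ0]
    have hrd : (C ζ⁻¹ * b).natDegree = b.natDegree := natDegree_C_mul (inv_ne_zero hζ0)
    obtain ⟨h1, h2⟩ := eq_dickson_of_semiconj hr (by omega) ha (b := 0) (by
      rw [dickson_one_zero (by omega), mul_comp, C_comp, hb, X_pow_comp, mul_pow, ← C_pow,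
        inv_pow, hζd])
    rw [hrd] at h1 h2
    obtain rfl : a = 0 := pow_eq_zero_iff hpos.ne' |>.1 h2.symm
    rw [dickson_one_zero hpos.ne'] at h1
    have hbX : ∀ z, b.eval z = ζ * z ^ b.natDegree := by
      intro z
      have := congrArg (eval z) h1
      simp only [eval_mul, eval_C, eval_pow, eval_X] at this
      rw [← this, mul_inv_cancel_left₀ hζ0]
    refine Or.inr ⟨ζ, b.natDegree, ?_, by omega, 1, 0, 1, 0, 0, one_ne_zero, one_ne_zero,
      fun zw => ?_⟩
    · rw [show m + 2 - 1 = m + 1 by omega]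
      rw [pow_succ] at hζd
      exact (mul_eq_right₀ hζ0).1 hζd
    · simp only [famMap, hbX, dickson_one_zero (show m + 2 ≠ 0 by omega)]
      simp

theorem exists_ne_zero_pow_mul_eq_one {k : ℕ} (hk : 0 < k) {l : ℂ} (hl : l ≠ 0) :
    ∃ α : ℂ, α ≠ 0 ∧ l * α ^ k = 1 := by
  obtain ⟨α, hα⟩ := IsAlgClosed.exists_pow_nat_eq l⁻¹ hk
  refine ⟨α, ?_, by rw [hα, mul_inv_cancel₀ hl]⟩
  rintro rfl
  rw [zero_pow hk.ne'] at hα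
  exact inv_ne_zero hl hα.symm

/-- A regular skew product is conjugate to a monic one with centered fibre maps. -/
theorem IsRegularSkew.exists_normalized {d : ℕ} (hd : 2 ≤ d) {p : ℂ[X]} {q : ℂ[X][X]}
    (hreg : IsRegularSkew d p q) :
    ∃ (p₁ : ℂ[X]) (q₁ : ℂ[X][X]), p₁.Monic ∧ p₁.natDegree = d ∧ q₁.Monic ∧ q₁.natDegree = d ∧
      q₁.coeff (d - 1) = 0 ∧ (q₁.coeff (d - 2)).natDegree ≤ 2 ∧
      TriangConj (skewMap p q) (famMap p₁ (fiber q₁)) := by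
  obtain ⟨hpd, hqk, hqd⟩ := hreg
  obtain ⟨m, rfl⟩ : ∃ m, d = m + 2 := ⟨d - 2, by omega⟩
  obtain ⟨α, hα, hlα⟩ := exists_ne_zero_pow_mul_eq_one (k := m + 1) (by omega)
    (l := p.leadingCoeff) (leadingCoeff_ne_zero.2 (by rintro rfl; simp at hpd))
  obtain ⟨l, hl⟩ : ∃ l, q.coeff (m + 2) = C l := by
    have := hqk _ hqd
    obtain ⟨l, hl⟩ := natDegree_eq_zero.1 (show (q.coeff (m + 2)).natDegree = 0 by omega)
    exact ⟨l, hl.symm⟩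
  have hl0 : l ≠ 0 := by
    rintro rfl
    exact hqd (by rw [hl, C_0])
  obtain ⟨γ, hγ, hlγ⟩ := exists_ne_zero_pow_mul_eq_one (k := m + 1) (by omega) hl0
  have hm : (m + 2 : ℂ) ≠ 0 := by exact_mod_cast (show m + 2 ≠ 0 by omega)
  obtain ⟨q₀, hq₀⟩ : ∃ q₀ : ℂ[X][X], q₀ = q.map (compRingHom (C α * X)) := ⟨_, rfl⟩
  have hq₀k : ∀ k, (q₀.coeff k).natDegree + k ≤ m + 2 ∨ q₀.coeff k = 0 := by
    intro k
    rw [hq₀, coeff_map, coe_compRingHom_apply]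
    by_cases h : q.coeff k = 0
    · exact Or.inr (by rw [h, zero_comp])
    · left
      rw [natDegree_comp, natDegree_C_mul_X _ hα, mul_one]
      exact hqk k h
  have hq₀l : q₀.coeff (m + 2) = C l := by
    rw [hq₀, coeff_map, hl, coe_compRingHom_apply, C_comp]
  have hq₀d : q₀.natDegree ≤ m + 2 := natDegree_le_iff_coeff_eq_zero.2 fun k hk =>
    (hq₀k k).resolve_left (by omega)
  have hdeg : ∀ k, (q₀.coeff k).natDegree ≤ m + 2 - k := by
    intro k
    rcases hq₀k k with h | h
    · omega
    · simp [h]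
  obtain ⟨ε, δ, hc⟩ := exists_eq_X_add_C_of_natDegree_le_one
    (p := C (-((m + 2) * l)⁻¹) * q₀.coeff (m + 1))
    ((natDegree_C_mul_le _ _).trans ((hdeg _).trans (by omega)))
  obtain ⟨c, hcdef⟩ : ∃ c, c = C (-((m + 2) * l)⁻¹) * q₀.coeff (m + 1) := ⟨_, rfl⟩
  rw [← hcdef] at hc
  have hc1 : c.natDegree ≤ 1 := by
    rw [hc]
    exact natDegree_linear_le
  obtain ⟨p₁, hp₁⟩ : ∃ p₁, p₁ = C α⁻¹ * p.comp (C α * X) := ⟨_, rfl⟩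
  have hp₁d : p₁.natDegree = m + 2 := by
    rw [hp₁, natDegree_C_mul (inv_ne_zero hα), natDegree_comp, natDegree_C_mul_X _ hα, mul_one,
      hpd]
  have hp₁m : p₁.Monic := by
    rw [Monic, hp₁, leadingCoeff_mul, leadingCoeff_C,
      leadingCoeff_comp (by rw [natDegree_C_mul_X _ hα]; exact one_ne_zero), hpd,
      leadingCoeff_C_mul_X]
    field_simp
    linear_combination α * hlα
  obtain ⟨q₁, hq₁⟩ : ∃ q₁ : ℂ[X][X], q₁ = C (C γ⁻¹) *
      ((taylor c q₀).comp (C (C γ) * X) - C (C ε * p₁ + C δ)) := ⟨_, rfl⟩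
  have hcoeff : ∀ k, q₁.coeff k = C γ⁻¹ * ((taylor c q₀).coeff k * C γ ^ k -
      (C (C ε * p₁ + C δ)).coeff k) := by
    intro k
    rw [hq₁, coeff_C_mul, coeff_sub, comp_C_mul_X_coeff]
  have htop : q₁.coeff (m + 2) = 1 := by
    rw [hcoeff, coeff_C_of_ne_zero (by omega), sub_zero, taylor_coeff,
      eval_eq_sum_range' (n := 1) ((natDegree_hasseDeriv_le _ _).trans_lt (by omega)),
      Finset.sum_range_one, hasseDeriv_coeff]
    simp only [zero_add, Nat.choose_self, Nat.cast_one, one_mul, pow_zero, mul_one, hq₀l]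
    rw [← C_pow, ← C_mul, ← C_mul, ← C_1]
    congr 1
    field_simp
    linear_combination γ * hlγ
  have hq₁d : q₁.natDegree = m + 2 := by
    refine natDegree_eq_of_le_of_coeff_ne_zero
      (natDegree_le_iff_coeff_eq_zero.2 fun k hk => ?_) (by rw [htop]; exact one_ne_zero)
    rw [hcoeff, coeff_C_of_ne_zero (by omega), sub_zero,
      coeff_eq_zero_of_natDegree_lt (by rw [natDegree_taylor]; omega), zero_mul, mul_zero]
  refine ⟨p₁, q₁, hp₁m, hp₁d, by rw [Monic, leadingCoeff, hq₁d, htop], hq₁d, ?_, ?_,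
    α, 0, γ, δ, ε, hα, hγ, fun zw => ?_⟩
  · rw [show m + 2 - 1 = m + 1 by omega, hcoeff, coeff_C_of_ne_zero (by omega), sub_zero,
      taylor_coeff,
      eval_eq_sum_range' (n := 2) ((natDegree_hasseDeriv_le _ _).trans_lt (by omega)),
      Finset.sum_range_succ, Finset.sum_range_one, hasseDeriv_coeff, hasseDeriv_coeff]
    simp only [zero_add, Nat.choose_self, pow_zero, pow_one, show 1 + (m + 1) = m + 2 by omega,
      show (m + 2).choose (m + 1) = m + 2 from Nat.choose_succ_self_right (m + 1), hq₀l]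
    have : q₀.coeff (m + 1) + C ((m + 2) * l) * c = 0 := by
      rw [hcdef, ← mul_assoc, ← C_mul, mul_neg, mul_inv_cancel₀ (mul_ne_zero hm hl0), C_neg, C_1]
      ring
    rw [C_mul] at this
    push_cast
    simp only [C_add, C_ofNat, map_natCast] at this
    linear_combination C γ⁻¹ * C γ ^ (m + 1) * this
  · rw [show m + 2 - 2 = m by omega, hcoeff]
    refine (natDegree_C_mul_le _ _).trans ((natDegree_sub_le _ _).trans (max_le ?_ ?_))
    · rw [← C_pow]
      refine (natDegree_mul_C_le _ _).trans ?_
      rw [taylor_coeff,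
        eval_eq_sum_range' (n := 3) ((natDegree_hasseDeriv_le _ _).trans_lt (by omega))]
      refine natDegree_sum_le_of_forall_le _ _ fun i hi => ?_
      rw [Finset.mem_range] at hi
      rw [hasseDeriv_coeff]
      refine natDegree_mul_le.trans ?_
      have h1 : ((((i + m).choose m : ℕ) : ℂ[X]) * q₀.coeff (i + m)).natDegree ≤ 2 - i := by
        refine natDegree_mul_le.trans ?_
        rw [natDegree_natCast, zero_add]
        exact (hdeg _).trans (by omega)
      have h2 : (c ^ i).natDegree ≤ i := by
        refine natDegree_pow_le.trans ?_
        nlinarith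
      omega
    · rcases Nat.eq_zero_or_pos m with rfl | h
      · rw [coeff_C_zero]
        refine (natDegree_add_C).le.trans ((natDegree_C_mul_le _ _).trans ?_)
        rw [hp₁d]
      · rw [coeff_C_of_ne_zero h.ne', natDegree_zero]
        omega
  · have h1 : p.eval (α * zw.1) = α * p₁.eval zw.1 := by
      rw [hp₁, eval_mul, eval_C, eval_comp, eval_mul, eval_C, eval_X, mul_inv_cancel_left₀ hα]
    have h2 : (fiber q₁ zw.1).eval zw.2 = γ⁻¹ * ((fiber q (α * zw.1)).eval
        (ε * zw.1 + γ * zw.2 + δ) - (ε * p₁.eval zw.1 + δ)) := by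
      have h3 : (q₀.map (evalRingHom zw.1)) = fiber q (α * zw.1) := by
        rw [hq₀, fiber, map_map]
        congr 1
        ext <;> simp
      rw [fiber, hq₁, taylor_apply]
      simp only [Polynomial.map_mul, Polynomial.map_sub, Polynomial.map_add, map_C, map_X, h3,
        Polynomial.map_comp, eval_mul, eval_sub, eval_add, eval_comp, eval_C, eval_X,
        coe_evalRingHom, hc]
      rw [show γ * zw.2 + (ε * zw.1 + δ) = ε * zw.1 + γ * zw.2 + δ by ring]
    refine Prod.ext ?_ ?_
    · simp [famMap, skewMap, h1]
    · simp only [famMap, skewMap, add_zero, h2]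
      field_simp
      ring

theorem SpecialSkew.exists_triangConj_dickson {d : ℕ} (hd : 2 ≤ d) {f : ℂ × ℂ → ℂ × ℂ}
    (h : SpecialSkew d f) :
    ∃ (a : ℂ) (b : ℂ[X]), a ^ d = a ∧ b.comp (dickson 1 a d) = b ^ d ∧
      TriangConj f (famMap (dickson 1 a d) fun z => dickson 1 (b.eval z) d) := by
  rcases h with ⟨P, Q, hP, hQ, hc⟩ | ⟨ζ, m, hζ, -, hc⟩
  · obtain ⟨c, a, hc0, ha, h1⟩ := exists_scaling_to_dickson hd hP
    obtain ⟨c', a', hc0', ha', h2⟩ := exists_scaling_to_dickson hd hQ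
    refine ⟨a, C a', ha, by rw [C_comp, ← C_pow, ha'], ?_⟩
    simp only [eval_C]
    exact hc.trans (triangConj_of_scaling hc0 hc0' h1 h2)
  · have hζd : ζ ^ d = ζ := by
      rw [← Nat.sub_add_cancel (show 1 ≤ d by omega), pow_succ, hζ, one_mul]
    have hd0 : d ≠ 0 := by omega
    refine ⟨0, C ζ * X ^ m, zero_pow hd0, ?_, ?_⟩
    · rw [dickson_one_zero hd0, mul_comp, C_comp, X_pow_comp, mul_pow, ← C_pow, hζd, ← pow_mul,
        ← pow_mul, mul_comm d m]
    · convert hc using 1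
      funext zw
      simp [famMap, dickson_one_zero hd0]

theorem triangConj_translation (p : ℂ[X]) (F : ℂ → ℂ[X]) (e : ℂ) :
    TriangConj (famMap p F) (famMap (p.comp (X + C e) - C e) fun z => F (z + e)) :=
  ⟨1, e, 1, 0, 0, one_ne_zero, one_ne_zero, fun zw => by simp [famMap, eval_comp]⟩

theorem specialSkew_of_skewMultipliersIn (K : Subfield ℂ) [FiniteDimensional ℚ K] {d : ℕ}
    (hd : 2 ≤ d) {p : ℂ[X]} {q : ℂ[X][X]} (hreg : IsRegularSkew d p q)
    (hK : SkewMultipliersIn K p (fiber q)) : SpecialSkew d (skewMap p q) := by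
  obtain ⟨p₁, q₁, hp₁, hp₁d, hq₁, hq₁d, hq₁c, hq₁2, hconj⟩ := hreg.exists_normalized hd
  have hK₁ : SkewMultipliersIn K p₁ (fiber q₁) :=
    (skewMultipliersIn_iff_of_triangConj (p := p) (F := fiber q) hconj).1 hK
  obtain ⟨b, rfl, hb⟩ := eq_dickson_of_skewMultipliersIn K hd hp₁ hp₁d hq₁ hq₁d hq₁c hK₁
  have hfib : ∀ z, fiber (dickson 1 b d) z = dickson 1 (b.eval z) d := fun z => by
    rw [fiber, map_dickson, coe_evalRingHom]
  have hm₁ : MultipliersIn K p₁ := hK₁.multipliersIn_base hd (fun z => hq₁.map _) fun z => by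
    rw [fiber, hq₁.natDegree_map, hq₁d]
  obtain ⟨e, a, ha, hea⟩ := exists_translate_eq_dickson K hp₁ (by omega) hm₁
  rw [hp₁d] at ha hea
  have hb2 : b.natDegree ≤ 2 := by
    obtain ⟨m, rfl⟩ : ∃ m, d = m + 2 := ⟨d - 2, by omega⟩
    have hm : (-(m + 2) : ℂ) ≠ 0 := by
      rw [neg_ne_zero]
      exact_mod_cast (show m + 2 ≠ 0 by omega)
    have hcoe : (dickson 1 b (m + 2)).coeff m = C (-(m + 2) : ℂ) * b := by
      refine Polynomial.funext fun z => ?_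
      have := congrArg (fun r => r.coeff m) (hfib z)
      simp only [fiber, coeff_map, coe_evalRingHom, coeff_dickson_add_two] at this
      rw [this, eval_mul, eval_C]
    rw [show m + 2 - 2 = m by omega, hcoe, natDegree_C_mul hm] at hq₁2
    exact hq₁2
  have hconj₂ := triangConj_translation p₁ (fiber (dickson 1 b d)) e
  refine SpecialSkew.of_triangConj ?_ (hconj.trans hconj₂)
  rw [hea]
  have hb' : (b.comp (X + C e)).comp (dickson 1 a d) = b.comp (X + C e) ^ d := by
    rw [← hea, ← pow_comp, ← hb]
    refine Polynomial.funext fun z => ?_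
    simp [eval_comp]
  convert specialSkew_dickson hd ha (b := b.comp (X + C e))
    (by rwa [natDegree_comp, natDegree_X_add_C, mul_one]) hb' using 3
  rw [hfib, eval_comp, eval_add, eval_X, eval_C]

theorem stmt0 (d : ℕ) (hd : 2 ≤ d) (p : Polynomial ℂ) (q : Polynomial (Polynomial ℂ))
    (hreg : IsRegularSkew d p q) :
    SpecialSkew d (skewMap p q) ↔
      ∃ K : Subfield ℂ, FiniteDimensional ℚ K ∧
        ∀ n : ℕ, 0 < n → ∀ z₀ w₀ : ℂ,
          (polyIter p n).eval z₀ = z₀ → (QIter p q n z₀).eval w₀ = w₀ →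
            (Polynomial.derivative (polyIter p n)).eval z₀ ∈ K ∧
            (Polynomial.derivative (QIter p q n z₀)).eval w₀ ∈ K := by
  simp only [QIter_eq_famIter]
  constructor
  · intro h
    obtain ⟨a, b, ha, hb, hconj⟩ := h.exists_triangConj_dickson hd
    refine ⟨(⊥ : IntermediateField ℚ ℂ).toSubfield,
      inferInstanceAs (FiniteDimensional ℚ (⊥ : IntermediateField ℚ ℂ)), ?_⟩
    exact (skewMultipliersIn_iff_of_triangConj (p := p) (F := fiber q) hconj).2
      (skewMultipliersIn_dickson _ (by omega) ha hb)
  · rintro ⟨K, hfin, hK⟩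
    exact specialSkew_of_skewMultipliersIn K hd hreg hK
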